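/- arXiv:2209.11828 — 4 statements merged into one kernel-verified Lean document; each statement's English description precedes it below -/
import Mathlib

section
/- Let A be a locally finite metric space and X a Banach space. Assume the finite subsets of A admit uniformly bi-Lipschitz embeddings into X: there exists a constant D ≥ 1 such that for every finite subset F of A there exist r_F > 0 and a map f_F : F → X with r_F·d(x,y) ≤ ‖f_F(x) − f_F(y)‖ ≤ D·r_F·d(x,y) for all x, y ∈ F. Then A admits a bi-Lipschitz embedding into X: there exist r > 0, D' ≥ 1 and a map f : A → X with r·d(x,y) ≤ ‖f(x) − f(y)‖ ≤ D'·r·d(x,y) for all x, y ∈ A. -/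
open Filter

theorem norm_sub_le_of_forall_norm_succ_sub_le {X : Type*} [SeminormedAddCommGroup X]
    {a : ℕ → X} {M : ℝ} {m n : ℕ} (hmn : m ≤ n)
    (h : ∀ j, m ≤ j → ‖a (j + 1) - a j‖ ≤ M) : ‖a n - a m‖ ≤ M * (n - m) := by
  induction n, hmn using Nat.le_induction with
  | base => simp
  | succ n hn ih =>
    have h₁ := norm_sub_le_norm_sub_add_norm_sub (a (n + 1)) (a n) (a m)
    have h₂ := h n hn
    push_cast
    linarith

section Interpolation

variable {X : Type*} [NormedAddCommGroup X] [NormedSpace ℝ X]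

/-- The piecewise linear path through the points `a 0, a 1, a 2, …` of a sequence. -/
noncomputable def interpolate (a : ℕ → X) (t : ℝ) : X :=
  (1 - (t - ⌊t⌋₊)) • a ⌊t⌋₊ + (t - ⌊t⌋₊) • a (⌊t⌋₊ + 1)

/-- A piecewise linear path is Lipschitz from `s` on if its steps from `s` on are bounded. -/
theorem norm_interpolate_sub_le {a : ℕ → X} {M s t : ℝ} (hs : 0 ≤ s) (hst : s ≤ t)
    (h : ∀ j, ⌊s⌋₊ ≤ j → ‖a (j + 1) - a j‖ ≤ M) :
    ‖interpolate a t - interpolate a s‖ ≤ M * (t - s) := by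
  have hs₁ := Nat.floor_le hs
  have hs₂ := (Nat.lt_floor_add_one s).le
  have ht₁ := Nat.floor_le (hs.trans hst)
  have hfl : ⌊s⌋₊ ≤ ⌊t⌋₊ := Nat.floor_mono hst
  have hM : 0 ≤ M := (norm_nonneg _).trans (h _ le_rfl)
  unfold interpolate
  generalize hm : ⌊s⌋₊ = m at *
  generalize hn : ⌊t⌋₊ = n at *
  have hbound (u : ℝ) (hu : 0 ≤ u) (j : ℕ) (hj : m ≤ j) :
      ‖u • (a (j + 1) - a j)‖ ≤ M * u := by
    rw [norm_smul, Real.norm_of_nonneg hu, mul_comm]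
    exact mul_le_mul_of_nonneg_right (h j hj) hu
  rcases hfl.eq_or_lt with rfl | hlt
  · have := hbound (t - s) (by linarith) m le_rfl
    convert this using 2
    module
  · have h₁ := hbound (t - n) (by linarith) n hfl
    have h₂ := hbound (1 - (s - m)) (by linarith) m le_rfl
    have h₃ : ‖a n - a (m + 1)‖ ≤ M * (n - (m + 1 : ℕ)) :=
      norm_sub_le_of_forall_norm_succ_sub_le hlt fun j hj ↦ h j (by lia)
    push_cast at h₃
    calc _ = ‖(t - n) • (a (n + 1) - a n) + (a n - a (m + 1))
            + (1 - (s - m)) • (a (m + 1) - a m)‖ := by congr 1; module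
      _ ≤ _ := norm_add₃_le
      _ ≤ M * (t - n) + M * (n - (m + 1)) + M * (1 - (s - m)) := by gcongr
      _ = M * (t - s) := by ring

end Interpolation

section Separation

variable {X : Type*} [NormedAddCommGroup X] [NormedSpace ℝ X]

/-- Either one functional of norm at most `1` is larger than `δ` on both `u` and `v`, or some
norming functional of `u` is bounded by `δ` on `v`. -/
def WellSeparated (δ : ℝ) (u v : X) : Prop :=
  (∃ φ : X →L[ℝ] ℝ, ‖φ‖ ≤ 1 ∧ δ < φ u ∧ δ < φ v) ∨
    ∃ φ : X →L[ℝ] ℝ, ‖φ‖ ≤ 1 ∧ φ u = ‖u‖ ∧ |φ v| ≤ δ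

theorem WellSeparated.le_norm_combo {u v : X} {c d D θ : ℝ} (h : WellSeparated (c * d) u v)
    (hd : 0 ≤ d) (hc : 0 < c) (hcD : c * (3 + 2 * D) ≤ 1)
    (hu : d ≤ ‖u‖) (hv : d ≤ ‖v‖) (hu' : ‖u‖ ≤ D * d) (hθ₀ : 0 ≤ θ) (hθ₁ : θ ≤ 1) :
    c * d ≤ ‖(1 - θ) • u + θ • v‖ := by
  have key (φ : X →L[ℝ] ℝ) (hφ : ‖φ‖ ≤ 1) :
      (1 - θ) * φ u + θ * φ v ≤ ‖(1 - θ) • u + θ • v‖ := by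
    have := (le_abs_self _).trans (φ.le_of_opNorm_le hφ ((1 - θ) • u + θ • v))
    simpa using this
  rcases h with ⟨φ, hφ, h₁, h₂⟩ | ⟨φ, hφ, h₁, h₂⟩
  · have := key φ hφ
    nlinarith
  · rcases le_total (2 * c) (1 - θ) with hcase | hcase
    · have := key φ hφ
      have h₃ := (abs_le.mp h₂).1
      rw [h₁] at this
      nlinarith [mul_le_mul_of_nonneg_left hu (sub_nonneg.mpr hθ₁),
        mul_le_mul_of_nonneg_left h₃ hθ₀, mul_le_mul_of_nonneg_right hcase hd,
        mul_nonneg (sub_nonneg.mpr hθ₁) (mul_nonneg hc.le hd)]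
    · have h₃ : ‖θ • v‖ ≤ ‖(1 - θ) • u + θ • v‖ + ‖(1 - θ) • u‖ := by
        simpa using norm_sub_le ((1 - θ) • u + θ • v) ((1 - θ) • u)
      rw [norm_smul, norm_smul, Real.norm_of_nonneg hθ₀,
        Real.norm_of_nonneg (sub_nonneg.mpr hθ₁)] at h₃
      have h₄ : θ * d ≤ θ * ‖v‖ := by gcongr
      have h₅ : (1 - θ) * ‖u‖ ≤ 2 * c * (D * d) := by gcongr
      nlinarith [mul_le_mul_of_nonneg_right hcD hd, mul_le_mul_of_nonneg_right hcase hd]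

/-- From a family of maps indexed along an ultrafilter one can extract a sequence whose
consecutive members have well separated differences on larger and larger finite sets. -/
theorem exists_seq_wellSeparated {A ι : Type*} (U : Ultrafilter ι) (f : ι → A → X)
    (δ : A → A → ℝ) (B : ℕ → Set A) (hBfin : ∀ k, (B k).Finite) (hBmono : Monotone B)
    (P : ℕ → ι → Prop) (hP : ∀ k, ∀ᶠ i in U, P k i) :
    ∃ n : ℕ → ι, (∀ k, P k (n k)) ∧ ∀ k, ∀ x ∈ B k, ∀ y ∈ B k,
      WellSeparated (δ x y) (f (n k) x - f (n k) y) (f (n (k + 1)) x - f (n (k + 1)) y) := by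
  let Large (x y : A) (φ : X →L[ℝ] ℝ) : Prop :=
    ‖φ‖ ≤ 1 ∧ ∀ᶠ i in U, δ x y < φ (f i x - f i y)
  have hdual (v : X) : ∃ ψ : X →L[ℝ] ℝ, ‖ψ‖ ≤ 1 ∧ ψ v = ‖v‖ := exists_dual_vector'' ℝ v
  choose ψ hψ hψv using hdual
  let Φ (x y : A) : X →L[ℝ] ℝ := Classical.epsilon (Large x y)
  let Q (k : ℕ) (i j : ι) : Prop := ∀ x ∈ B k, ∀ y ∈ B k,
    ((∃ φ, Large x y φ) → δ x y < Φ x y (f j x - f j y)) ∧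
    ((¬ ∃ φ, Large x y φ) → |ψ (f i x - f i y) (f j x - f j y)| ≤ δ x y)
  have hQ (k : ℕ) (i : ι) : ∀ᶠ j in U, Q k i j := by
    refine (eventually_all_finite (hBfin k)).2 fun x _ ↦
      (eventually_all_finite (hBfin k)).2 fun y _ ↦ Eventually.and ?_ ?_
    · by_cases h : ∃ φ, Large x y φ
      · filter_upwards [(Classical.epsilon_spec h).2] with j hj _ using hj
      · exact .of_forall fun j h' ↦ absurd h' h
    · by_cases h : ∃ φ, Large x y φ
      · exact .of_forall fun j h' ↦ absurd h h'
      · have hsmall (φ : X →L[ℝ] ℝ) (hφ : ‖φ‖ ≤ 1) :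
            ∀ᶠ j in U, φ (f j x - f j y) ≤ δ x y := by
          have : ¬ ∀ᶠ j in U, δ x y < φ (f j x - f j y) := fun h' ↦ h ⟨φ, hφ, h'⟩
          simpa using Ultrafilter.eventually_not.mpr this
        filter_upwards [hsmall _ (hψ (f i x - f i y)),
          hsmall (-ψ (f i x - f i y)) (by simpa using hψ _)] with j h₁ h₂ _
        exact abs_le'.mpr ⟨h₁, h₂⟩
  choose next hnext using fun k i ↦ ((hP k).and (hQ k i)).exists
  obtain ⟨i₀, -⟩ := (hP 0).exists
  let n : ℕ → ι := Nat.rec (next 0 i₀) fun k i ↦ next (k + 1) i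
  have hn (k : ℕ) : P k (n k) ∧ ∃ i, Q k i (n k) := by
    cases k with
    | zero => exact ⟨(hnext 0 i₀).1, i₀, (hnext 0 i₀).2⟩
    | succ k => exact ⟨(hnext (k + 1) (n k)).1, n k, (hnext (k + 1) (n k)).2⟩
  refine ⟨n, fun k ↦ (hn k).1, fun k x hx y hy ↦ ?_⟩
  have hstep : Q (k + 1) (n k) (n (k + 1)) := (hnext (k + 1) (n k)).2
  have hstep := hstep x (hBmono k.le_succ hx) y (hBmono k.le_succ hy)
  obtain ⟨i, hi⟩ := (hn k).2
  by_cases h : ∃ φ, Large x y φ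
  · exact .inl ⟨Φ x y, (Classical.epsilon_spec h).1, (hi x hx y hy).1 h, hstep.1 h⟩
  · exact .inr ⟨_, hψ _, hψv _, hstep.2 h⟩

end Separation

/-- Finite subsets that embed with distortion `D` admit embeddings which are normalized: they
do not contract distances and they send a base point to `0`. -/
theorem exists_normalized_embedding {A X : Type*} [MetricSpace A] [NormedAddCommGroup X]
    [NormedSpace ℝ X] {D : ℝ}
    (hunif : ∀ F : Set A, F.Finite → ∃ r : ℝ, 0 < r ∧ ∃ f : F → X,
      ∀ x y : F, r * dist (x : A) (y : A) ≤ ‖f x - f y‖ ∧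
        ‖f x - f y‖ ≤ D * r * dist (x : A) (y : A)) (o : A) (F : Finset A) :
    ∃ f : A → X, f o = 0 ∧ ∀ x ∈ F, ∀ y ∈ F,
      dist x y ≤ ‖f x - f y‖ ∧ ‖f x - f y‖ ≤ D * dist x y := by
  classical
  obtain ⟨r, hr, f, hf⟩ := hunif F F.finite_toSet
  let g (x : A) : X := if hx : x ∈ (F : Set A) then f ⟨x, hx⟩ else 0
  refine ⟨fun x ↦ r⁻¹ • (g x - g o), by simp, fun x hx y hy ↦ ?_⟩
  have hg : r⁻¹ • (g x - g o) - r⁻¹ • (g y - g o) = r⁻¹ • (f ⟨x, hx⟩ - f ⟨y, hy⟩) := by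
    rw [show g x = f ⟨x, hx⟩ from dif_pos hx, show g y = f ⟨y, hy⟩ from dif_pos hy]
    module
  obtain ⟨h₁, h₂⟩ := hf ⟨x, hx⟩ ⟨y, hy⟩
  rw [hg, norm_smul, Real.norm_of_nonneg (inv_nonneg.mpr hr.le), ← div_eq_inv_mul,
    le_div_iff₀ hr, div_le_iff₀ hr]
  constructor <;> linarith

theorem mul_log_sub_log_le {s t : ℝ} (hs : 0 ≤ s) (hst : s ≤ t) :
    s * (Real.log (1 + t) - Real.log (1 + s)) ≤ t - s := by
  have hs' : 0 < 1 + s := by linarith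
  have ht' : 0 < 1 + t := by linarith
  have hlog : Real.log (1 + t) - Real.log (1 + s) ≤ (t - s) / (1 + s) := by
    rw [← Real.log_div ht'.ne' hs'.ne']
    refine (Real.log_le_sub_one_of_pos (div_pos ht' hs')).trans_eq ?_
    field_simp
    ring
  calc _ ≤ s * ((t - s) / (1 + s)) := by gcongr
    _ = s / (1 + s) * (t - s) := by ring
    _ ≤ 1 * (t - s) := by
      gcongr
      exact (div_le_one hs').mpr (by linarith)
    _ = t - s := one_mul _


/-- **Theorem 1.1 (Ostrovskii).** A locally finite metric space whose finite
subsets admit uniformly bi-Lipschitz embeddings into a Banach space `X`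
admits a bi-Lipschitz embedding into `X`. -/
theorem locallyFinite_biLipschitz_embeds
    (A : Type*) [MetricSpace A]
    (X : Type*) [NormedAddCommGroup X] [NormedSpace ℝ X] [CompleteSpace X]
    (hloc : ∀ (x : A) (R : ℝ), (Metric.ball x R).Finite)
    (D : ℝ) (hD : 1 ≤ D)
    (hunif : ∀ F : Set A, F.Finite → ∃ r : ℝ, 0 < r ∧ ∃ f : F → X,
      ∀ x y : F, r * dist (x : A) (y : A) ≤ ‖f x - f y‖ ∧
        ‖f x - f y‖ ≤ D * r * dist (x : A) (y : A)) :
    ∃ r : ℝ, 0 < r ∧ ∃ D' : ℝ, 1 ≤ D' ∧ ∃ f : A → X,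
      ∀ x y : A, r * dist x y ≤ ‖f x - f y‖ ∧ ‖f x - f y‖ ≤ D' * r * dist x y := by
  rcases isEmpty_or_nonempty A with hA | ⟨⟨o⟩⟩
  · exact ⟨1, one_pos, 1, le_rfl, fun _ ↦ 0, fun x ↦ isEmptyElim x⟩
  have hD₀ : 0 < D := by linarith
  choose f hfo hf using exists_normalized_embedding hunif o
  set c : ℝ := 1 / (5 * D) with hc_def
  have hc : 0 < c := by positivity
  have hcD : c * (3 + 2 * D) ≤ 1 := by
    rw [hc_def, one_div_mul_eq_div, div_le_one (by positivity)]
    linarith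
  set L : ℝ := 4 * D / c with hL_def
  have hL : 0 < L := by positivity
  let τ (x : A) : ℝ := Real.log (1 + dist x o) / L
  have hτ₀ (x : A) : 0 ≤ τ x :=
    div_nonneg (Real.log_nonneg (by linarith [dist_nonneg (x := x) (y := o)])) hL.le
  have hτmono {x y : A} (h : dist y o ≤ dist x o) : τ y ≤ τ x := by
    have : 0 < 1 + dist y o := by linarith [dist_nonneg (x := y) (y := o)]
    simp only [τ]
    gcongr
  let B (k : ℕ) : Set A := {x | τ x < k + 1}
  have hBmono : Monotone B := fun i j hij x (hx : τ x < i + 1) ↦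
    show τ x < j + 1 from hx.trans_le (by gcongr)
  have hBfin (k : ℕ) : (B k).Finite := by
    refine (hloc o (Real.exp ((k + 1) * L))).subset fun x (hx : τ x < k + 1) ↦ ?_
    have hpos : 0 < 1 + dist x o := by linarith [dist_nonneg (x := x) (y := o)]
    have := (Real.log_lt_iff_lt_exp hpos).mp ((div_lt_iff₀ hL).mp hx)
    rw [Metric.mem_ball]
    linarith
  have hoB (k : ℕ) : o ∈ B k := by
    change τ o < k + 1
    simp only [τ, dist_self, add_zero, Real.log_one, zero_div]
    positivity
  obtain ⟨n, hnB, hsep⟩ := exists_seq_wellSeparated (Ultrafilter.of (atTop : Filter (Finset A)))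
    f (fun x y ↦ c * dist x y) B hBfin hBmono (fun k F ↦ (hBfin k).toFinset ≤ F)
    fun k ↦ Ultrafilter.of_le _ (eventually_ge_atTop _)
  have hbi {k : ℕ} {x y : A} (hx : x ∈ B k) (hy : y ∈ B k) :
      dist x y ≤ ‖f (n k) x - f (n k) y‖ ∧ ‖f (n k) x - f (n k) y‖ ≤ D * dist x y :=
    hf (n k) x (hnB k (by simpa using hx)) y (hnB k (by simpa using hy))
  have hbase {k : ℕ} {x : A} (hx : x ∈ B k) : ‖f (n k) x‖ ≤ D * dist x o := by
    simpa [hfo] using (hbi hx (hoB k)).2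
  let H (x : A) (t : ℝ) : X := interpolate (fun k ↦ f (n k) x) t
  have hpath {x y : A} (h : dist y o ≤ dist x o) :
      ‖H y (τ x) - H y (τ y)‖ ≤ c / 2 * dist x y := by
    have h₁ : ‖H y (τ x) - H y (τ y)‖ ≤ 2 * D * dist y o * (τ x - τ y) := by
      refine norm_interpolate_sub_le (hτ₀ y) (hτmono h) fun j hj ↦ ?_
      have hy : y ∈ B j := hBmono hj (Nat.lt_floor_add_one (τ y))
      have h₁ := hbase hy
      have h₂ := hbase (hBmono j.le_succ hy)
      have h₃ := norm_sub_le (f (n (j + 1)) y) (f (n j) y)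
      rw [Nat.succ_eq_add_one] at h₂
      linarith
    calc _ ≤ _ := h₁
      _ = 2 * D / L *
          (dist y o * (Real.log (1 + dist x o) - Real.log (1 + dist y o))) := by
        simp only [τ]
        ring
      _ ≤ 2 * D / L * dist x y := by
        gcongr
        refine (mul_log_sub_log_le dist_nonneg h).trans ?_
        linarith [dist_triangle x y o]
      _ = c / 2 * dist x y := by
        rw [hL_def]
        field_simp
        norm_num
  have hmain {x y : A} (h : dist y o ≤ dist x o) :
      c * dist x y ≤ ‖H x (τ x) - H y (τ x)‖ ∧ ‖H x (τ x) - H y (τ x)‖ ≤ D * dist x y := by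
    set k := ⌊τ x⌋₊ with hk
    have hx : x ∈ B k := Nat.lt_floor_add_one (τ x)
    have hy : y ∈ B k := (hτmono h).trans_lt hx
    have hu := hbi hx hy
    have hv := hbi (hBmono k.le_succ hx) (hBmono k.le_succ hy)
    rw [Nat.succ_eq_add_one] at hv
    have hθ₀ : 0 ≤ τ x - k := sub_nonneg.mpr (Nat.floor_le (hτ₀ x))
    have hθ₁ : τ x - k ≤ 1 := by
      have : τ x < k + 1 := hx
      linarith
    have heq : H x (τ x) - H y (τ x) = (1 - (τ x - k)) • (f (n k) x - f (n k) y)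
        + (τ x - k) • (f (n (k + 1)) x - f (n (k + 1)) y) := by
      simp only [H, interpolate, ← hk]
      module
    rw [heq]
    refine ⟨(hsep k x hx y hy).le_norm_combo dist_nonneg hc hcD hu.1 hv.1 hu.2 hθ₀ hθ₁,
      ?_⟩
    have := (convex_closedBall (0 : X) (D * dist x y)) (mem_closedBall_zero_iff.mpr hu.2)
      (mem_closedBall_zero_iff.mpr hv.2) (sub_nonneg.mpr hθ₁) hθ₀ (by ring)
    exact mem_closedBall_zero_iff.mp this
  refine ⟨c / 2, by positivity, (D + c / 2) / (c / 2), ?_, fun x ↦ H x (τ x), fun x y ↦ ?_⟩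
  · rw [one_le_div (by positivity)]
    linarith
  rw [div_mul_cancel₀ _ (by positivity)]
  wlog h : dist y o ≤ dist x o generalizing x y
  · rw [dist_comm, norm_sub_rev]
    exact this y x (le_of_not_ge h)
  have hm := hmain h
  have hp := hpath h
  have h₁ := norm_sub_le_norm_sub_add_norm_sub (H x (τ x)) (H y (τ x)) (H y (τ y))
  have h₂ := norm_sub_le_norm_sub_add_norm_sub (H x (τ x)) (H y (τ y)) (H y (τ x))
  rw [norm_sub_rev (H y (τ y))] at h₂
  constructor <;> linarith
end

section
/- Let X and Y be infinite-dimensional Banach spaces such that X is finitely crudely representable in Y, i.e., there exists C > 1 such that X is C-finitely crudely representable in Y. Let A be a subset of X that is locally finite as a metric space (with the metric induced by the norm of X). Then A admits a bi-Lipschitz embedding into Y: there exist r > 0, D ≥ 1 and a map f : A → Y with r·‖x−y‖ ≤ ‖f(x) − f(y)‖ ≤ D·r·‖x−y‖ for all x, y ∈ A. -/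
/-- `X` is `C`-finitely crudely representable in `Y`. -/
def CFinRep (C : ℝ) (X Y : Type*) [NormedAddCommGroup X] [NormedSpace ℝ X]
    [NormedAddCommGroup Y] [NormedSpace ℝ Y] : Prop :=
  ∀ E : Submodule ℝ X, FiniteDimensional ℝ E →
    ∃ T : E →L[ℝ] Y, (∀ x : E, ‖x‖ ≤ ‖T x‖) ∧ ‖T‖ < C

open Filter Topology NormedSpace

/-- The filter of combinations `T a + T b - T c`, where `a`, `b`, `c` go to the limit along `U`
one after the other, `c` first. -/
def mixFilter {ι X Y : Type*} [AddCommGroup X] [Module ℝ X] [AddCommGroup Y] [Module ℝ Y]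
    (U : Filter ι) (T : ι → X →ₗ[ℝ] Y) : Filter (X →ₗ[ℝ] Y) :=
  U.bind fun a => U.bind fun b => U.map fun c => T a + T b - T c

theorem eventually_mixFilter {ι X Y : Type*} [AddCommGroup X] [Module ℝ X] [AddCommGroup Y]
    [Module ℝ Y] {U : Filter ι} {T : ι → X →ₗ[ℝ] Y} {P : (X →ₗ[ℝ] Y) → Prop} :
    (∀ᶠ G in mixFilter U T, P G) ↔
      ∀ᶠ a in U, ∀ᶠ b in U, ∀ᶠ c in U, P (T a + T b - T c) := by
  simp only [mixFilter, eventually_bind, eventually_map]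

instance mixFilter_neBot {ι X Y : Type*} [AddCommGroup X] [Module ℝ X] [AddCommGroup Y]
    [Module ℝ Y] {U : Filter ι} [U.NeBot] {T : ι → X →ₗ[ℝ] Y} : (mixFilter U T).NeBot := by
  refine ⟨fun h => ?_⟩
  have h' : ∀ᶠ _ in mixFilter U T, False := by simp [h]
  rw [eventually_mixFilter] at h'
  simp only [eventually_false_iff_eq_bot, eventually_const] at h'
  exact NeBot.ne ‹_› h'

/-- A bounded real function converges along every ultrafilter. -/
theorem Ultrafilter.exists_tendsto_of_eventually_abs_le {ι : Type*} (U : Ultrafilter ι)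
    {φ : ι → ℝ} {M : ℝ} (h : ∀ᶠ s in (U : Filter ι), |φ s| ≤ M) :
    ∃ l, |l| ≤ M ∧ Tendsto φ U (𝓝 l) := by
  obtain ⟨l, hl, hl'⟩ := (isCompact_Icc (a := -M) (b := M)).ultrafilter_le_nhds' (U.map φ)
    (by
      rw [Ultrafilter.mem_map]
      filter_upwards [h] with s hs
      exact abs_le.1 hs)
  exact ⟨l, abs_le.2 hl, hl'⟩

/-- The iterated limit of the norms of differences of a bounded family. -/
theorem exists_oscillation {ι Y : Type*} [NormedAddCommGroup Y] (U : Ultrafilter ι) (y : ι → Y)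
    {M : ℝ} (h : ∀ᶠ s in (U : Filter ι), ‖y s‖ ≤ M) :
    ∃ q : ℝ, ∀ ε > 0, ∀ᶠ b in (U : Filter ι), ∀ᶠ c in (U : Filter ι),
      |‖y b - y c‖ - q| < ε := by
  have hb : ∀ b, ∀ᶠ c in (U : Filter ι), |‖y b - y c‖| ≤ ‖y b‖ + M := by
    intro b
    filter_upwards [h] with c hc
    rw [abs_norm]
    exact (norm_sub_le _ _).trans (by gcongr)
  choose r hr hlim using fun b => U.exists_tendsto_of_eventually_abs_le (hb b)
  obtain ⟨q, -, hq⟩ := U.exists_tendsto_of_eventually_abs_le (φ := r) (M := M + M) (by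
    filter_upwards [h] with b hb
    exact (hr b).trans (by gcongr))
  refine ⟨q, fun ε hε => ?_⟩
  filter_upwards [Metric.tendsto_nhds.1 hq (ε / 2) (half_pos hε)] with b hb
  filter_upwards [Metric.tendsto_nhds.1 (hlim b) (ε / 2) (half_pos hε)] with c hc
  rw [Real.dist_eq] at hb hc
  calc |‖y b - y c‖ - q| = |(‖y b - y c‖ - r b) + (r b - q)| := by ring_nf
    _ ≤ _ := abs_add_le _ _
    _ < ε := by linarith

section Limits

variable {ι X Y : Type*} [NormedAddCommGroup X] [NormedSpace ℝ X]
  [NormedAddCommGroup Y] [NormedSpace ℝ Y]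

/-- Pointwise bounded families have weak-star limits in the bidual along ultrafilters. -/
theorem exists_bidual_limit (U : Ultrafilter ι) (y : ι → Y) {M : ℝ}
    (h : ∀ᶠ s in (U : Filter ι), ‖y s‖ ≤ M) :
    ∃ z : StrongDual ℝ (StrongDual ℝ Y), ∀ g : StrongDual ℝ Y,
      Tendsto (fun s => g (y s)) U (𝓝 (z g)) := by
  have hb : ∀ g : StrongDual ℝ Y, ∀ᶠ s in (U : Filter ι), |g (y s)| ≤ M * ‖g‖ := by
    intro g
    filter_upwards [h] with s hs
    calc |g (y s)| = ‖g (y s)‖ := rfl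
      _ ≤ ‖g‖ * ‖y s‖ := g.le_opNorm _
      _ ≤ M * ‖g‖ := by rw [mul_comm]; gcongr
  choose l hl hlim using fun g => U.exists_tendsto_of_eventually_abs_le (hb g)
  let z : StrongDual ℝ Y →ₗ[ℝ] ℝ :=
    { toFun := l
      map_add' := fun g h => tendsto_nhds_unique (hlim (g + h)) ((hlim g).add (hlim h))
      map_smul' := fun c g => tendsto_nhds_unique (hlim (c • g)) ((hlim g).const_mul c) }
  exact ⟨z.mkContinuous M hl, hlim⟩

/-- The norm of a functional is almost attained, from below, on the unit ball. -/
theorem exists_norm_sub_lt_apply (z : StrongDual ℝ (StrongDual ℝ Y)) {ε : ℝ} (hε : 0 < ε) :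
    ∃ g : StrongDual ℝ Y, ‖g‖ ≤ 1 ∧ ‖z‖ - ε < z g := by
  obtain ⟨g, hg, hz⟩ := z.exists_lt_apply_of_lt_opNorm (sub_lt_self ‖z‖ hε)
  rw [Real.norm_eq_abs] at hz
  rcases abs_choice (z g) with h | h
  · exact ⟨g, hg.le, h ▸ hz⟩
  · exact ⟨-g, by simpa using hg.le, by rw [map_neg, ← h]; exact hz⟩

theorem apply_le_norm_of_norm_le_one (z : StrongDual ℝ (StrongDual ℝ Y)) {g : StrongDual ℝ Y}
    (hg : ‖g‖ ≤ 1) : z g ≤ ‖z‖ :=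
  (le_abs_self _).trans ((z.le_opNorm g).trans (mul_le_of_le_one_right (norm_nonneg z) hg))

/-- Weak-star convergence at a functional, read along `mixFilter`. -/
theorem eventually_mixFilter_abs_sub_lt {U : Filter ι} [U.NeBot] {T : ι → X →ₗ[ℝ] Y} {u : X}
    {g : StrongDual ℝ Y} {l : ℝ} (hl : Tendsto (fun s => g (T s u)) U (𝓝 l)) {ε : ℝ}
    (hε : 0 < ε) : ∀ᶠ G in mixFilter U T, |g (G u) - l| < ε := by
  have h := Metric.tendsto_nhds.1 hl (ε / 3) (by positivity)
  rw [eventually_mixFilter]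
  filter_upwards [h] with a ha
  filter_upwards [h] with b hb
  filter_upwards [h] with c hc
  simp only [Real.dist_eq, abs_lt, LinearMap.sub_apply, LinearMap.add_apply, map_add, map_sub]
    at *
  constructor <;> linarith

theorem eventually_mixFilter_norm_le {U : Filter ι} {T : ι → X →ₗ[ℝ] Y} {u : X} {C : ℝ}
    (h : ∀ᶠ s in U, ‖T s u‖ ≤ C * ‖u‖) : ∀ᶠ G in mixFilter U T, ‖G u‖ ≤ 3 * C * ‖u‖ := by
  rw [eventually_mixFilter]
  filter_upwards [h] with a ha
  filter_upwards [h] with b hb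
  filter_upwards [h] with c hc
  calc ‖(T a + T b - T c) u‖ ≤ ‖T a u‖ + ‖T b u‖ + ‖T c u‖ := by
        simp only [LinearMap.sub_apply, LinearMap.add_apply]
        exact (norm_sub_le _ _).trans (by gcongr; exact norm_add_le _ _)
    _ ≤ 3 * C * ‖u‖ := by linarith

/-- Lower semicontinuity of the bidual norm under weak-star limits. -/
theorem eventually_mixFilter_norm_add_limit_le {U : Filter ι} [U.NeBot] {T : ι → X →ₗ[ℝ] Y}
    {u : X} {t : StrongDual ℝ (StrongDual ℝ Y)}
    (ht : ∀ g : StrongDual ℝ Y, Tendsto (fun s => g (T s u)) U (𝓝 (t g)))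
    (z : StrongDual ℝ (StrongDual ℝ Y)) {ε : ℝ} (hε : 0 < ε) :
    ∀ᶠ G in mixFilter U T, ‖z + t‖ ≤ ‖z + inclusionInDoubleDualLi ℝ (G u)‖ + ε := by
  obtain ⟨g, hg, hz⟩ := exists_norm_sub_lt_apply (z + t) (half_pos hε)
  filter_upwards [eventually_mixFilter_abs_sub_lt (ht g) (half_pos hε)] with G hG
  have h1 := apply_le_norm_of_norm_le_one (z + inclusionInDoubleDualLi ℝ (G u)) hg
  have h2 : (z + inclusionInDoubleDualLi ℝ (G u)) g = z g + g (G u) := rfl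
  have h3 : (z + t) g = z g + t g := rfl
  have := (abs_lt.1 hG).1
  linarith

/-- The oscillation of `T s u` is controlled by the mixed combinations. -/
theorem eventually_mixFilter_oscillation_le {U : Filter ι} [U.NeBot] {T : ι → X →ₗ[ℝ] Y}
    {u : X} {t : StrongDual ℝ (StrongDual ℝ Y)}
    (ht : ∀ g : StrongDual ℝ Y, Tendsto (fun s => g (T s u)) U (𝓝 (t g))) {q : ℝ}
    (hq : ∀ ε > 0, ∀ᶠ b in U, ∀ᶠ c in U, |‖T b u - T c u‖ - q| < ε)
    (z : StrongDual ℝ (StrongDual ℝ Y)) {ε : ℝ} (hε : 0 < ε) :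
    ∀ᶠ G in mixFilter U T, q ≤ 2 * ‖z + inclusionInDoubleDualLi ℝ (G u)‖ + ε := by
  rw [eventually_mixFilter]
  refine Eventually.of_forall fun a => ?_
  set J := inclusionInDoubleDualLi (E := Y) ℝ
  obtain ⟨g, hg, hz⟩ := exists_norm_sub_lt_apply (z + J (T a u)) (ε := ε / 4) (by positivity)
  have h := Metric.tendsto_nhds.1 (ht g) (ε / 4) (by positivity)
  filter_upwards [h, hq (ε / 4) (by positivity)] with b hb hqb
  filter_upwards [h, hqb] with c hc hqc
  set w := z + J ((T a + T b - T c) u)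
  have h1 := apply_le_norm_of_norm_le_one w hg
  have h2 : w g = (z + J (T a u)) g + (g (T b u) - g (T c u)) := by
    have : w g = z g + g ((T a + T b - T c) u) := rfl
    have h' : (z + J (T a u)) g = z g + g (T a u) := rfl
    rw [this, h']
    simp only [LinearMap.sub_apply, LinearMap.add_apply, map_add, map_sub]
    ring
  have h3 : ‖T b u - T c u‖ ≤ ‖w‖ + ‖z + J (T a u)‖ := by
    rw [← J.norm_map]
    have h4 : (T a + T b - T c) u = T a u + (T b u - T c u) := by
      simp only [LinearMap.sub_apply, LinearMap.add_apply]
      abel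
    have h5 : J (T b u - T c u) = w - (z + J (T a u)) := by
      simp only [w, h4]
      rw [J.map_add]
      abel
    rw [h5]
    exact norm_sub_le w _
  rw [Real.dist_eq, abs_lt] at hb hc
  rw [abs_lt] at hqc
  linarith [hb.1, hc.2, hqc.1]

/-- A lower bound on `T s w` passes to the sum of the oscillation and the weak-star limit. -/
theorem le_oscillation_add_norm_limit {U : Filter ι} [U.NeBot] {y : ι → Y}
    {t : StrongDual ℝ (StrongDual ℝ Y)}
    (ht : ∀ g : StrongDual ℝ Y, Tendsto (fun s => g (y s)) U (𝓝 (t g))) {q : ℝ}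
    (hq : ∀ ε > 0, ∀ᶠ b in U, ∀ᶠ c in U, |‖y b - y c‖ - q| < ε) {m : ℝ}
    (hm : ∀ᶠ s in U, m ≤ ‖y s‖) : m ≤ q + ‖t‖ := by
  refine le_of_forall_pos_le_add fun ε hε => ?_
  obtain ⟨b, hb, hqb⟩ := (hm.and (hq (ε / 2) (half_pos hε))).exists
  obtain ⟨g, hg, hgb⟩ := exists_dual_vector'' ℝ (y b)
  obtain ⟨c, hc, hqc⟩ := ((Metric.tendsto_nhds.1 (ht g) (ε / 2) (half_pos hε)).and hqb).exists
  have h1 : g (y b - y c) ≤ ‖y b - y c‖ :=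
    (le_abs_self _).trans ((g.le_opNorm _).trans (mul_le_of_le_one_left (norm_nonneg _) hg))
  have h2 := apply_le_norm_of_norm_le_one t hg
  rw [map_sub, hgb] at h1
  rw [Real.dist_eq, abs_lt] at hc
  rw [abs_lt] at hqc
  have h4 : (‖y b‖ : ℝ) - g (y c) ≤ ‖y b - y c‖ := h1
  linarith [hc.2, hqc.2]

theorem oscillation_add_le {U : Filter ι} [U.NeBot] {T : ι → X →ₗ[ℝ] Y} {q : X → ℝ}
    (hq : ∀ u, ∀ ε > 0, ∀ᶠ b in U, ∀ᶠ c in U, |‖T b u - T c u‖ - q u| < ε) (u v : X) :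
    q (u + v) ≤ q u + q v := by
  refine le_of_forall_pos_le_add fun ε hε => ?_
  have hε' : 0 < ε / 3 := by positivity
  obtain ⟨b, ⟨h1, h2⟩, h3⟩ := (((hq u _ hε').and (hq v _ hε')).and (hq (u + v) _ hε')).exists
  obtain ⟨c, ⟨h1, h2⟩, h3⟩ := ((h1.and h2).and h3).exists
  have h4 : ‖T b (u + v) - T c (u + v)‖ ≤ ‖T b u - T c u‖ + ‖T b v - T c v‖ := by
    rw [map_add, map_add, add_sub_add_comm]
    exact norm_add_le _ _
  rw [abs_lt] at h1 h2 h3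
  linarith [h1.2, h2.2, h3.1]

end Limits

section Gluing

variable {X Y : Type*} [NormedAddCommGroup X] [NormedSpace ℝ X]
  [NormedAddCommGroup Y] [NormedSpace ℝ Y]

theorem CFinRep.exists_linearMap {C : ℝ} (h : CFinRep C X Y) (s : Finset X) :
    ∃ T : X →ₗ[ℝ] Y, ∀ x ∈ s, ‖x‖ ≤ ‖T x‖ ∧ ‖T x‖ ≤ C * ‖x‖ := by
  obtain ⟨T, hT, hTC⟩ := h (Submodule.span ℝ (s : Set X)) inferInstance
  obtain ⟨S, hS⟩ := LinearMap.exists_extend (T : Submodule.span ℝ (s : Set X) →ₗ[ℝ] Y)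
  refine ⟨S, fun x hx => ?_⟩
  have hx' : x ∈ Submodule.span ℝ (s : Set X) := Submodule.subset_span hx
  have hSx : S x = T ⟨x, hx'⟩ := LinearMap.congr_fun hS ⟨x, hx'⟩
  rw [hSx]
  exact ⟨hT ⟨x, hx'⟩, T.le_of_opNorm_le hTC.le ⟨x, hx'⟩⟩

/-- Finite representability yields a filter of linear maps which, in the limit, behave like the
sum of an additive map `τ` into the bidual and an independent part of size `q`. -/
theorem CFinRep.exists_filter {C : ℝ} (h : CFinRep C X Y) :
    ∃ (L : Filter (X →ₗ[ℝ] Y)) (τ : X → StrongDual ℝ (StrongDual ℝ Y)) (q : X → ℝ), L.NeBot ∧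
      (∀ u, ∀ᶠ G in L, ‖G u‖ ≤ 3 * C * ‖u‖) ∧
      (∀ z u, ∀ ε > 0, ∀ᶠ G in L, ‖z + τ u‖ ≤ ‖z + inclusionInDoubleDualLi ℝ (G u)‖ + ε) ∧
      (∀ z u, ∀ ε > 0, ∀ᶠ G in L, q u ≤ 2 * ‖z + inclusionInDoubleDualLi ℝ (G u)‖ + ε) ∧
      (∀ u v, ‖u + v‖ ≤ q u + q v + ‖τ u + τ v‖) := by
  choose T hT using h.exists_linearMap
  obtain ⟨U, hU⟩ : ∃ U : Ultrafilter (Finset X), (U : Filter (Finset X)) ≤ atTop :=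
    ⟨Ultrafilter.of atTop, Ultrafilter.of_le atTop⟩
  have hmem : ∀ u, ∀ᶠ s in (U : Filter (Finset X)), u ∈ s := fun u =>
    hU ((eventually_ge_atTop {u}).mono fun s hs => hs (by simp))
  have hup : ∀ u, ∀ᶠ s in (U : Filter (Finset X)), ‖T s u‖ ≤ C * ‖u‖ := fun u =>
    (hmem u).mono fun s hs => (hT s u hs).2
  have hτ : ∀ u, ∃ t : StrongDual ℝ (StrongDual ℝ Y), ∀ g : StrongDual ℝ Y,
      Tendsto (fun s => g (T s u)) U (𝓝 (t g)) := fun u => exists_bidual_limit U _ (hup u)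
  have hq : ∀ u, ∃ q : ℝ, ∀ ε > 0, ∀ᶠ b in (U : Filter (Finset X)),
      ∀ᶠ c in (U : Filter (Finset X)), |‖T b u - T c u‖ - q| < ε := fun u =>
    exists_oscillation U _ (hup u)
  choose τ hτ using hτ
  choose q hq using hq
  refine ⟨mixFilter U T, τ, q, inferInstance, ?_, ?_, ?_, ?_⟩
  · exact fun u => eventually_mixFilter_norm_le (hup u)
  · exact fun z u ε hε => eventually_mixFilter_norm_add_limit_le (hτ u) z hε
  · exact fun z u ε hε => eventually_mixFilter_oscillation_le (hτ u) (hq u) z hε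
  intro u v
  have h1 : ∀ g : StrongDual ℝ Y, Tendsto (fun s => g (T s (u + v))) U (𝓝 ((τ u + τ v) g)) := by
    intro g
    simp only [map_add]
    exact (hτ u g).add (hτ v g)
  have h2 : ‖u + v‖ ≤ q (u + v) + ‖τ u + τ v‖ :=
    le_oscillation_add_norm_limit h1 (hq (u + v))
      ((hmem (u + v)).mono fun s hs => (hT s _ hs).1)
  have h3 := oscillation_add_le hq u v
  linarith

/-- Given finite sets `W n`, there are uniformly bounded linear maps `G n` for which consecutive
terms do not cancel on `W n` and `W (n + 1)`, up to small additive errors. -/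
theorem CFinRep.exists_seq_linearMap {C : ℝ} (h : CFinRep C X Y) (W : ℕ → Set X)
    (hW : ∀ n, (W n).Finite) (ε : ℕ → ℝ) (hε : ∀ n, 0 < ε n) :
    ∃ G : ℕ → X →ₗ[ℝ] Y, (∀ n, ∀ u ∈ W n, ‖G n u‖ ≤ 3 * C * ‖u‖) ∧
      ∀ n, ∀ u ∈ W n, ∀ v ∈ W (n + 1),
        ‖u + v‖ ≤ 5 * ‖G n u + G (n + 1) v‖ + (4 * ε n + 4 * ε (n + 1)) := by
  obtain ⟨L, τ, q, hL, hup, hlim, hosc, hlow⟩ := h.exists_filter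
  set J := inclusionInDoubleDualLi (E := Y) ℝ
  let A : ℕ → (X →ₗ[ℝ] Y) → Prop := fun n G => (∀ u ∈ W n, ‖G u‖ ≤ 3 * C * ‖u‖) ∧
    ∀ u ∈ W n, ∀ v ∈ W (n + 1), ‖τ v + τ u‖ ≤ ‖τ v + J (G u)‖ + ε n ∧
      q u ≤ 2 * ‖τ v + J (G u)‖ + ε n
  let R : ℕ → (X →ₗ[ℝ] Y) → (X →ₗ[ℝ] Y) → Prop := fun n G G' =>
    ∀ u ∈ W n, ∀ v ∈ W (n + 1), ‖J (G u) + τ v‖ ≤ ‖J (G u) + J (G' v)‖ + ε (n + 1) ∧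
      q v ≤ 2 * ‖J (G u) + J (G' v)‖ + ε (n + 1)
  have hA : ∀ n, ∀ᶠ G in L, A n G := fun n =>
    ((eventually_all_finite (hW n)).2 fun u _ => hup u).and <|
      (eventually_all_finite (hW n)).2 fun u _ => (eventually_all_finite (hW _)).2 fun v _ =>
        (hlim _ u _ (hε n)).and (hosc _ u _ (hε n))
  have hR : ∀ n G, ∀ᶠ G' in L, R n G G' := fun n G =>
    (eventually_all_finite (hW n)).2 fun u _ => (eventually_all_finite (hW _)).2 fun v _ =>
      (hlim _ v _ (hε _)).and (hosc _ v _ (hε _))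
  obtain ⟨G₀, hG₀⟩ := (hA 0).exists
  choose next hnext using fun n G => ((hA (n + 1)).and (hR n G)).exists
  let G : ℕ → X →ₗ[ℝ] Y := fun n => Nat.rec G₀ next n
  have hGA : ∀ n, A n (G n) := fun n => by
    cases n with
    | zero => exact hG₀
    | succ n => exact (hnext n (G n)).1
  refine ⟨G, fun n => (hGA n).1, fun n u hu v hv => ?_⟩
  obtain ⟨h1, h2⟩ := (hGA n).2 u hu v hv
  obtain ⟨h3, h4⟩ := (hnext n (G n)).2 u hu v hv
  have h5 := hlow u v
  have h6 : ‖J (G n u) + J (G (n + 1) v)‖ = ‖G n u + G (n + 1) v‖ := by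
    rw [← J.map_add, J.norm_map]
  change ‖_‖ ≤ ‖J (G n u) + J (G (n + 1) v)‖ + _ at h3
  change _ ≤ 2 * ‖J (G n u) + J (G (n + 1) v)‖ + _ at h4
  rw [h6] at h3 h4
  rw [add_comm (τ v) (J _)] at h1 h2
  rw [add_comm (τ v)] at h1
  linarith [hε n, hε (n + 1)]

end Gluing

/-- The function equal to `0` on `(-∞, r]`, to `1` on `[2 * r, ∞)`, and affine in between. -/
noncomputable def ramp (r t : ℝ) : ℝ := max 0 (min 1 (t / r - 1))

theorem ramp_nonneg (r t : ℝ) : 0 ≤ ramp r t := le_max_left _ _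

theorem ramp_le_one (r t : ℝ) : ramp r t ≤ 1 := max_le zero_le_one (min_le_left _ _)

theorem ramp_of_le {r t : ℝ} (hr : 0 < r) (h : t ≤ r) : ramp r t = 0 := by
  have : t / r ≤ 1 := (div_le_one hr).2 h
  exact max_eq_left ((min_le_right _ _).trans (by linarith))

theorem ramp_of_two_mul_le {r t : ℝ} (hr : 0 < r) (h : 2 * r ≤ t) : ramp r t = 1 := by
  have : 2 ≤ t / r := (le_div_iff₀ hr).2 h
  rw [ramp, min_eq_left (by linarith)]
  exact max_eq_right zero_le_one

theorem abs_ramp_sub_ramp_mul_le {r s t : ℝ} (hr : 0 < r) (hs : 0 ≤ s) (hst : s ≤ t) :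
    |ramp r s - ramp r t| * s ≤ 2 * (t - s) := by
  rcases le_total (2 * r) s with h | h
  · rw [ramp_of_two_mul_le hr h, ramp_of_two_mul_le hr (h.trans hst)]
    simp only [sub_self, abs_zero, zero_mul]
    linarith
  · have h1 : |ramp r s - ramp r t| ≤ (t - s) / r := by
      have h2 : |ramp r s - ramp r t| ≤ |(s / r - 1) - (t / r - 1)| := by
        unfold ramp
        generalize s / r - 1 = a
        generalize t / r - 1 = b
        grind
      have h3 : (s / r - 1) - (t / r - 1) = -((t - s) / r) := by ring
      rwa [h3, abs_neg, abs_of_nonneg (div_nonneg (by linarith) hr.le)] at h2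
    calc |ramp r s - ramp r t| * s ≤ (t - s) / r * (2 * r) := by gcongr
      _ = 2 * (t - s) := by field_simp

section Radial

variable {X : Type*} [NormedAddCommGroup X] [NormedSpace ℝ X]

/-- Multiplication by a radial weight of logarithmically bounded slope is Lipschitz. -/
theorem norm_smul_sub_smul_le {α : ℝ → ℝ} (h0 : ∀ t, 0 ≤ α t) (h1 : ∀ t, α t ≤ 1)
    (h : ∀ s t, 0 ≤ s → s ≤ t → |α s - α t| * s ≤ 2 * (t - s)) (x y : X) :
    ‖α ‖x‖ • x - α ‖y‖ • y‖ ≤ 3 * ‖x - y‖ := by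
  wlog hxy : ‖x‖ ≤ ‖y‖ generalizing x y
  · rw [norm_sub_rev, norm_sub_rev x]
    exact this y x (le_of_not_ge hxy)
  have h2 : α ‖x‖ • x - α ‖y‖ • y = (α ‖x‖ - α ‖y‖) • x + α ‖y‖ • (x - y) := by module
  have h3 : ‖y‖ - ‖x‖ ≤ ‖x - y‖ := by
    rw [norm_sub_rev]
    exact norm_sub_norm_le y x
  calc ‖α ‖x‖ • x - α ‖y‖ • y‖ ≤ ‖(α ‖x‖ - α ‖y‖) • x‖ + ‖α ‖y‖ • (x - y)‖ := by
        rw [h2]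
        exact norm_add_le _ _
    _ = |α ‖x‖ - α ‖y‖| * ‖x‖ + α ‖y‖ * ‖x - y‖ := by
        rw [norm_smul, norm_smul, Real.norm_eq_abs, Real.norm_eq_abs, abs_of_nonneg (h0 _)]
    _ ≤ 2 * (‖y‖ - ‖x‖) + 1 * ‖x - y‖ :=
        add_le_add (h _ _ (norm_nonneg x) hxy)
          (mul_le_mul_of_nonneg_right (h1 _) (norm_nonneg _))
    _ ≤ 3 * ‖x - y‖ := by linarith

theorem norm_ramp_smul_sub_le {r : ℝ} (hr : 0 < r) (x y : X) :
    ‖ramp r ‖x‖ • x - ramp r ‖y‖ • y‖ ≤ 3 * ‖x - y‖ :=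
  norm_smul_sub_smul_le (ramp_nonneg r) (ramp_le_one r)
    (fun _ _ => abs_ramp_sub_ramp_mul_le hr) x y

theorem norm_one_sub_ramp_smul_sub_le {r : ℝ} (hr : 0 < r) (x y : X) :
    ‖(1 - ramp r ‖x‖) • x - (1 - ramp r ‖y‖) • y‖ ≤ 3 * ‖x - y‖ :=
  norm_smul_sub_smul_le (α := fun t => 1 - ramp r t) (fun t => sub_nonneg.2 (ramp_le_one r t))
    (fun t => sub_le_self _ (ramp_nonneg r t))
    (fun s t hs hst => by
      rw [sub_sub_sub_cancel_left, abs_sub_comm]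
      exact abs_ramp_sub_ramp_mul_le hr hs hst) x y

end Radial

theorem Set.Finite.exists_pos_forall_le_norm_sub {X : Type*} [NormedAddCommGroup X]
    {B : Set X} (hB : B.Finite) :
    ∃ δ > 0, ∀ x ∈ B, ∀ y ∈ B, x ≠ y → δ ≤ ‖x - y‖ := by
  have h : ∀ᶠ δ in 𝓝[>] (0 : ℝ), ∀ x ∈ B, ∀ y ∈ B, x ≠ y → δ ≤ ‖x - y‖ := by
    refine (eventually_all_finite hB).2 fun x _ => (eventually_all_finite hB).2 fun y _ => ?_
    by_cases hxy : x = y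
    · simp [hxy]
    · have := eventually_le_nhds (norm_sub_pos_iff.2 hxy)
      exact (this.filter_mono nhdsWithin_le_nhds).mono fun δ hδ _ => hδ
  obtain ⟨δ, h1, h2⟩ := (h.and self_mem_nhdsWithin).exists
  exact ⟨δ, h2, h1⟩

section Assembly

variable {X Y : Type*} [NormedAddCommGroup X] [NormedSpace ℝ X]
  [NormedAddCommGroup Y] [NormedSpace ℝ Y]

/-- The interpolation between the linear maps `G m` and `G (m + 1)` across the shell
`r ≤ ‖x‖ ≤ 2 * r`. -/
noncomputable def blend (G : ℕ → X →ₗ[ℝ] Y) (r : ℕ → ℝ) (m : ℕ) (x : X) : Y :=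
  G m ((1 - ramp (r m) ‖x‖) • x) + G (m + 1) (ramp (r m) ‖x‖ • x)

/-- The blended maps can be chosen uniformly bi-Lipschitz on prescribed finite sets. -/
theorem CFinRep.exists_blend {C : ℝ} (hC : 0 < C) (h : CFinRep C X Y) {r : ℕ → ℝ}
    (hr : ∀ n, 0 < r n) {B : ℕ → Set X} (hB : ∀ n, (B n).Finite) (hmono : Monotone B) :
    ∃ G : ℕ → X →ₗ[ℝ] Y, ∀ m, ∀ x ∈ B m, ∀ y ∈ B m,
      ‖x - y‖ ≤ 10 * ‖blend G r m x - blend G r m y‖ ∧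
      ‖blend G r m x - blend G r m y‖ ≤ 18 * C * ‖x - y‖ := by
  choose δ hδ0 hδ using fun n => (hB n).exists_pos_forall_le_norm_sub
  let Wu : ℕ → Set X := fun m =>
    Set.image2 (fun x y => (1 - ramp (r m) ‖x‖) • x - (1 - ramp (r m) ‖y‖) • y) (B m) (B m)
  let Wv : ℕ → Set X := fun m =>
    Set.image2 (fun x y => ramp (r m) ‖x‖ • x - ramp (r m) ‖y‖ • y) (B m) (B m)
  obtain ⟨G, hG, hG'⟩ := h.exists_seq_linearMap (fun m => Wu m ∪ Wv (m - 1))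
    (fun m => ((hB _).image2 _ (hB _)).union ((hB _).image2 _ (hB _))) (fun n => δ n / 16)
    (fun n => by have := hδ0 n; positivity)
  refine ⟨G, fun m x hx y hy => ?_⟩
  set u := (1 - ramp (r m) ‖x‖) • x - (1 - ramp (r m) ‖y‖) • y with hu
  set v := ramp (r m) ‖x‖ • x - ramp (r m) ‖y‖ • y with hv
  have huv : u + v = x - y := by
    rw [hu, hv]
    module
  have hd : blend G r m x - blend G r m y = G m u + G (m + 1) v := by
    rw [hu, hv, map_sub, map_sub]
    unfold blend
    abel
  have hum : u ∈ Wu m ∪ Wv (m - 1) := Or.inl ⟨x, hx, y, hy, rfl⟩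
  have hvm : v ∈ Wu (m + 1) ∪ Wv (m + 1 - 1) := Or.inr ⟨x, hx, y, hy, rfl⟩
  rw [hd]
  constructor
  · rcases eq_or_ne x y with rfl | hne
    · simp
    · have h1 := hG' m u hum v hvm
      have h2 := hδ m x hx y hy hne
      have h3 := hδ (m + 1) x (hmono m.le_succ hx) y (hmono m.le_succ hy) hne
      rw [huv] at h1
      linarith
  · have h1 := hG m u hum
    have h2 := hG (m + 1) v hvm
    have h3 : ‖u‖ ≤ 3 * ‖x - y‖ := norm_one_sub_ramp_smul_sub_le (hr m) x y
    have h4 : ‖v‖ ≤ 3 * ‖x - y‖ := norm_ramp_smul_sub_le (hr m) x y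
    calc ‖G m u + G (m + 1) v‖ ≤ ‖G m u‖ + ‖G (m + 1) v‖ := norm_add_le _ _
      _ ≤ 3 * C * ‖u‖ + 3 * C * ‖v‖ := add_le_add h1 h2
      _ ≤ 3 * C * (3 * ‖x - y‖) + 3 * C * (3 * ‖x - y‖) := by gcongr
      _ = 18 * C * ‖x - y‖ := by ring

theorem blend_eq_of_le {G : ℕ → X →ₗ[ℝ] Y} {r : ℕ → ℝ} {m : ℕ} {x : X} (hr : 0 < r m)
    (h : ‖x‖ ≤ r m) : blend G r m x = G m x := by
  simp [blend, ramp_of_le hr h]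

theorem blend_eq_of_two_mul_le {G : ℕ → X →ₗ[ℝ] Y} {r : ℕ → ℝ} {m : ℕ} {x : X} (hr : 0 < r m)
    (h : 2 * r m ≤ ‖x‖) : blend G r m x = G (m + 1) x := by
  simp [blend, ramp_of_two_mul_le hr h]

theorem exists_biLipschitz_of_finite_inter_ball {C : ℝ} (hC : 1 < C) (h : CFinRep C X Y)
    {A : Set X} (hA : ∀ R : ℝ, {x ∈ A | ‖x‖ < R}.Finite) :
    ∃ f : X → Y, ∀ x ∈ A, ∀ y ∈ A,
      ‖x - y‖ ≤ 30 * ‖f x - f y‖ ∧ ‖f x - f y‖ ≤ 54 * C * ‖x - y‖ := by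
  have hC0 : 0 < C := by linarith
  set K : ℝ := 720 * C with hK
  have hK1 : 1 < K := by linarith
  let r : ℕ → ℝ := fun n => K ^ n
  have hr : ∀ n, 0 < r n := fun n => pow_pos (by linarith) n
  have hrm : Monotone r := fun m n hmn => pow_le_pow_right₀ hK1.le hmn
  have hrs : ∀ n, r (n + 1) = K * r n := fun n => pow_succ' K n
  let B : ℕ → Set X := fun m => insert 0 {x ∈ A | ‖x‖ < r (m + 1)}
  have hBm : Monotone B := fun m n hmn => Set.insert_subset_insert fun x hx =>
    ⟨hx.1, hx.2.trans_le (hrm (by omega))⟩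
  obtain ⟨G, hG⟩ := h.exists_blend hC0 hr (fun m => (hA (r (m + 1))).insert 0) hBm
  have hex : ∀ x : X, ∃ n, ‖x‖ < r (n + 1) := fun x => by
    obtain ⟨n, hn⟩ := pow_unbounded_of_one_lt ‖x‖ hK1
    exact ⟨n, hn.trans_le (hrm n.le_succ)⟩
  classical
  let N : X → ℕ := fun x => Nat.find (hex x)
  have hN : ∀ x, ‖x‖ < r (N x + 1) := fun x => Nat.find_spec (hex x)
  have hN' : ∀ x n, n < N x → r (n + 1) ≤ ‖x‖ := fun x n hn => not_lt.1 (Nat.find_min (hex x) hn)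
  have hmem : ∀ x ∈ A, x ∈ B (N x) := fun x hx => Or.inr ⟨hx, hN x⟩
  let f : X → Y := fun x => blend G r (N x) x
  have hf : ∀ x ∈ A, ‖x‖ ≤ 10 * ‖f x‖ ∧ ‖f x‖ ≤ 18 * C * ‖x‖ := fun x hx => by
    have := hG (N x) x (hmem x hx) 0 (Set.mem_insert _ _)
    have h0 : blend G r (N x) 0 = 0 := by simp [blend]
    simpa only [h0, sub_zero] using this
  refine ⟨f, fun x hx y hy => ?_⟩
  wlog hxy : ‖x‖ ≤ ‖y‖ generalizing x y
  · rw [norm_sub_rev, norm_sub_rev (f x)]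
    exact this y hy x hx (le_of_not_ge hxy)
  have hle : N x ≤ N y := Nat.find_min' (hex x) (hxy.trans_lt (hN y))
  have hcases : f x = blend G r (N y) x ∨ 360 * C * ‖x‖ ≤ ‖y‖ := by
    rcases hle.eq_or_lt with heq | hlt
    · exact Or.inl (by rw [← heq])
    obtain ⟨m, hm⟩ : ∃ m, N y = m + 1 := ⟨N y - 1, by omega⟩
    have hym : r (m + 1) ≤ ‖y‖ := hN' y m (by omega)
    rcases le_or_gt (2 * r m) ‖x‖ with h2 | h2
    · left
      have hxm : N x = m := by
        by_contra hne
        have := (hN x).trans_le (hrm (show N x + 1 ≤ m by omega))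
        linarith [hr m]
      have hxr : ‖x‖ ≤ r (m + 1) := hxm ▸ (hN x).le
      rw [hm, blend_eq_of_le (hr _) hxr, ← blend_eq_of_two_mul_le (hr m) h2, ← hxm]
    · right
      rw [hrs] at hym
      calc 360 * C * ‖x‖ ≤ 360 * C * (2 * r m) := by gcongr
        _ = K * r m := by ring
        _ ≤ ‖y‖ := hym
  rcases hcases with hnear | hfar
  · have hxB : x ∈ B (N y) := Or.inr ⟨hx, hxy.trans_lt (hN y)⟩
    obtain ⟨h1, h2⟩ := hG (N y) x hxB y (hmem y hy)
    rw [hnear]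
    change ‖x - y‖ ≤ 30 * ‖blend G r (N y) x - blend G r (N y) y‖ ∧
      ‖blend G r (N y) x - blend G r (N y) y‖ ≤ _
    refine ⟨by linarith [norm_nonneg (x - y)], h2.trans ?_⟩
    gcongr
    norm_num
  · obtain ⟨-, hx2⟩ := hf x hx
    obtain ⟨hy1, hy2⟩ := hf y hy
    have h1 : ‖f y‖ - ‖f x‖ ≤ ‖f x - f y‖ := by
      rw [norm_sub_rev]
      exact norm_sub_norm_le _ _
    have h2 : ‖y‖ - ‖x‖ ≤ ‖x - y‖ := by
      rw [norm_sub_rev]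
      exact norm_sub_norm_le _ _
    have h3 := norm_sub_le x y
    have h4 := norm_sub_le (f x) (f y)
    have h5 : 2 * ‖x‖ ≤ ‖y‖ := by
      refine le_trans ?_ hfar
      gcongr
      linarith
    refine ⟨by linarith, ?_⟩
    have h6 : 18 * C * (‖x‖ + ‖y‖) ≤ 18 * C * (3 * ‖x - y‖) := by
      gcongr
      linarith
    linarith

end Assembly

/-- **Theorem 1.2.** If `X` is finitely crudely representable in `Y`, then any
locally finite subset `A` of `X` admits a bi-Lipschitz embedding into `Y`. -/
theorem locallyFinite_subset_biLipschitz_embeds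
    (X Y : Type*) [NormedAddCommGroup X] [NormedSpace ℝ X] [CompleteSpace X]
    [NormedAddCommGroup Y] [NormedSpace ℝ Y] [CompleteSpace Y]
    (hXinf : ¬ FiniteDimensional ℝ X) (hYinf : ¬ FiniteDimensional ℝ Y)
    (C : ℝ) (hC : 1 < C) (hfcr : CFinRep C X Y)
    (A : Set X) (hloc : ∀ x ∈ A, ∀ R : ℝ, ({y ∈ A | dist y x < R}).Finite) :
    ∃ r : ℝ, 0 < r ∧ ∃ D : ℝ, 1 ≤ D ∧ ∃ f : A → Y,
      ∀ x y : A, r * ‖(x : X) - (y : X)‖ ≤ ‖f x - f y‖ ∧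
        ‖f x - f y‖ ≤ D * r * ‖(x : X) - (y : X)‖ := by
  have hA : ∀ R : ℝ, {x ∈ A | ‖x‖ < R}.Finite := by
    intro R
    rcases A.eq_empty_or_nonempty with rfl | ⟨a, ha⟩
    · simp
    · refine (hloc a ha (R + ‖a‖)).subset fun x hx => ⟨hx.1, ?_⟩
      rw [dist_eq_norm]
      exact (norm_sub_le x a).trans_lt (add_lt_add_left hx.2 _)
  obtain ⟨f, hf⟩ := exists_biLipschitz_of_finite_inter_ball hC hfcr hA
  refine ⟨1 / 30, by norm_num, 1620 * C, by linarith, fun x => f x, fun x y => ?_⟩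
  obtain ⟨h1, h2⟩ := hf x x.2 y y.2
  exact ⟨by linarith, by linarith⟩
end

section
/- Let X be an infinite-dimensional Banach space and p ∈ [1,∞]. Then X contains the ℓ_p^n's uniformly (there exists λ ∈ [1,∞) and a sequence of n-dimensional subspaces E_n of X such that for each n there is a linear isomorphism T_n from ℓ_p^n onto E_n with ‖T_n‖·‖T_n⁻¹‖ ≤ λ) if and only if L_p = L_p([0,1]) is finitely representable in X (L_p is (1+ε)-finitely crudely representable in X for every ε > 0). -/
open MeasureTheory

/-- `X` contains the `ℓ_p^n`'s uniformly: there are `λ ≥ 1` and `n`-dimensional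
subspaces `E n` of `X` isomorphic to `ℓ_p^n` with constant at most `λ`. -/
def ContainsLpnUniformly (p : ENNReal) [Fact (1 ≤ p)] (X : Type*)
    [NormedAddCommGroup X] [NormedSpace ℝ X] : Prop :=
  ∃ lam : ℝ, 1 ≤ lam ∧ ∀ n : ℕ, ∃ E : Submodule ℝ X, Module.finrank ℝ E = n ∧
    ∃ T : (PiLp p fun _ : Fin n => ℝ) ≃L[ℝ] E,
      ‖(T : (PiLp p fun _ : Fin n => ℝ) →L[ℝ] E)‖ *
        ‖(T.symm : E →L[ℝ] (PiLp p fun _ : Fin n => ℝ))‖ ≤ lam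

section FinApprox

open Filter Topology

/-- The function `N` on `V` is approximated, on every finite set, by pullbacks of `M` along
linear maps `V → W`. -/
def FinApprox {V W : Type*} [AddCommGroup V] [Module ℝ V] [AddCommGroup W] [Module ℝ W]
    (N : V → ℝ) (M : W → ℝ) : Prop :=
  ∀ (S : Finset V) (ε : ℝ), 0 < ε → ∃ T : V →ₗ[ℝ] W, ∀ v ∈ S, |M (T v) - N v| ≤ ε

variable {U V W : Type*} [AddCommGroup U] [Module ℝ U] [AddCommGroup V] [Module ℝ V]
  [AddCommGroup W] [Module ℝ W]

theorem FinApprox.trans {L : U → ℝ} {M : V → ℝ} {N : W → ℝ}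
    (h₁ : FinApprox L M) (h₂ : FinApprox M N) : FinApprox L N := by
  classical
  intro S ε hε
  obtain ⟨T, hT⟩ := h₁ S (ε / 2) (half_pos hε)
  obtain ⟨R, hR⟩ := h₂ (S.image T) (ε / 2) (half_pos hε)
  refine ⟨R ∘ₗ T, fun v hv => ?_⟩
  have h1 := hT v hv
  have h2 := hR (T v) (Finset.mem_image_of_mem _ hv)
  rw [LinearMap.comp_apply]
  rw [abs_le] at *
  constructor <;> linarith [h1.1, h1.2, h2.1, h2.2]

/-- A function approximated by a seminorm is a seminorm. -/
theorem FinApprox.exists_seminorm {N : V → ℝ} (M : Seminorm ℝ W) (h : FinApprox N M) :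
    ∃ N' : Seminorm ℝ V, ∀ v, N' v = N v := by
  classical
  refine ⟨Seminorm.of N (fun x y => ?_) (fun a x => ?_), fun v => rfl⟩
  · refine le_of_forall_pos_le_add fun ε hε => ?_
    obtain ⟨T, hT⟩ := h {x, y, x + y} (ε / 3) (by positivity)
    have hx := abs_le.1 (hT x (by simp))
    have hy := abs_le.1 (hT y (by simp))
    have hxy := abs_le.1 (hT (x + y) (by simp))
    have := map_add_le_add M (T x) (T y)
    rw [map_add] at hxy
    linarith [hx.1, hx.2, hy.1, hy.2, hxy.1, hxy.2]
  · refine eq_of_abs_sub_le_all fun ε hε => ?_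
    obtain ⟨T, hT⟩ := h {x, a • x} (ε / (1 + ‖a‖)) (by positivity)
    have hx := hT x (by simp)
    have hax := hT (a • x) (by simp)
    rw [map_smul, map_smul_eq_mul] at hax
    have h3 : |‖a‖ * M (T x) - ‖a‖ * N x| ≤ ‖a‖ * (ε / (1 + ‖a‖)) := by
      rw [← mul_sub, abs_mul, abs_of_nonneg (norm_nonneg a)]
      gcongr
    have h4 : ε / (1 + ‖a‖) + ‖a‖ * (ε / (1 + ‖a‖)) = ε := by
      field_simp
    calc |N (a • x) - ‖a‖ * N x|
        ≤ |N (a • x) - ‖a‖ * M (T x)| + |‖a‖ * M (T x) - ‖a‖ * N x| := abs_sub_le _ _ _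
      _ ≤ ε := by rw [abs_sub_comm]; linarith

theorem exists_tendsto_hyperfilter_of_bounded (f : ℕ → ℝ) (B : ℝ) (hf : ∀ n, |f n| ≤ B) :
    ∃ a, Tendsto f (hyperfilter ℕ) (𝓝 a) := by
  have hK : IsCompact (Set.Icc (-B) B) := isCompact_Icc
  obtain ⟨a, -, ha⟩ := hK.ultrafilter_le_nhds ((hyperfilter ℕ).map f)
    (by
      rw [le_principal_iff]
      exact Filter.mem_map.2 (Filter.univ_mem' fun n => abs_le.1 (hf n)))
  exact ⟨a, ha⟩

theorem exists_seminorm_hyperfilter_limit (M : Seminorm ℝ W) (T : ℕ → V →ₗ[ℝ] W)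
    (hB : ∀ v, ∃ B, ∀ n, M (T n v) ≤ B) :
    ∃ N : Seminorm ℝ V, FinApprox N M ∧
      ∀ v, Tendsto (fun n => M (T n v)) (hyperfilter ℕ) (𝓝 (N v)) := by
  have hex : ∀ v, ∃ a, Tendsto (fun n => M (T n v)) (hyperfilter ℕ) (𝓝 a) := fun v => by
    obtain ⟨B, hB⟩ := hB v
    exact exists_tendsto_hyperfilter_of_bounded _ B fun n => by
      rw [abs_of_nonneg (apply_nonneg _ _)]
      exact hB n
  choose N hN using hex
  have happ : FinApprox N M := by
    intro S ε hε
    have : ∀ᶠ n in (hyperfilter ℕ : Filter ℕ), ∀ v ∈ S, |M (T n v) - N v| ≤ ε := by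
      rw [Filter.eventually_all_finset]
      intro v _
      have := (hN v).eventually (Metric.closedBall_mem_nhds _ hε)
      simpa [Real.dist_eq] using this
    obtain ⟨n, hn⟩ := this.exists
    exact ⟨T n, hn⟩
  obtain ⟨N', hN'⟩ := happ.exists_seminorm M
  have : (N' : V → ℝ) = N := funext hN'
  exact ⟨N', this ▸ happ, fun v => this ▸ hN v⟩

end FinApprox

section NormedSpaces

variable {E X : Type*} [NormedAddCommGroup E] [NormedSpace ℝ E]
  [NormedAddCommGroup X] [NormedSpace ℝ X]

/-- A linear map which is almost isometric on a sufficiently fine net of the unit sphere is almost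
isometric. -/
theorem FinApprox.exists_almost_isometry [FiniteDimensional ℝ E]
    (h : FinApprox (fun v : E => ‖v‖) (fun x : X => ‖x‖)) {ε : ℝ} (hε : 0 < ε) :
    ∃ T : E →L[ℝ] X, (∀ x : E, ‖x‖ ≤ ‖T x‖) ∧ ‖T‖ < 1 + ε := by
  classical
  have : ProperSpace E := FiniteDimensional.proper_real E
  set δ : ℝ := ε / (5 + 3 * ε) with hδ
  have hδ0 : 0 < δ := by positivity
  have hδ1 : 4 * δ + 3 * ε * δ < ε := by
    rw [hδ, mul_div_assoc', mul_div_assoc', ← add_div, div_lt_iff₀ (by positivity)]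
    nlinarith
  have hδ3 : 3 * δ < 1 := by
    rw [hδ, mul_div_assoc', div_lt_one (by positivity)]
    linarith
  obtain ⟨t, hts, htf, htc⟩ :=
    (isCompact_sphere (0 : E) 1).finite_cover_balls hδ0
  obtain ⟨R₀, hR₀⟩ := h htf.toFinset δ hδ0
  set R : E →L[ℝ] X := LinearMap.toContinuousLinearMap R₀ with hR
  have hnet : ∀ z : E, ‖z‖ = 1 → |‖R z‖ - 1| ≤ δ + ‖R‖ * δ := by
    intro z hz
    have hz' : z ∈ ⋃ x ∈ t, Metric.ball x δ := htc (by simp [hz])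
    simp only [Set.mem_iUnion, Metric.mem_ball, exists_prop] at hz'
    obtain ⟨y, hy, hzy⟩ := hz'
    have h1 : |‖R y‖ - ‖y‖| ≤ δ := hR₀ y (by simpa using hy)
    have hy1 : ‖y‖ = 1 := by simpa using hts hy
    rw [hy1] at h1
    have h2 : |‖R z‖ - ‖R y‖| ≤ ‖R‖ * δ := by
      refine (abs_norm_sub_norm_le _ _).trans ?_
      rw [← map_sub]
      refine (R.le_opNorm _).trans ?_
      gcongr
      rw [← dist_eq_norm]
      exact hzy.le
    have := abs_sub_le (‖R z‖) (‖R y‖) 1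
    linarith
  have hRle : ‖R‖ ≤ 1 + (δ + ‖R‖ * δ) :=
    R.opNorm_le_of_unit_norm (by positivity) fun z hz => by
      linarith [(abs_le.1 (hnet z hz)).2]
  have hRle' : ‖R‖ * (1 - δ) ≤ 1 + δ := by linarith
  have hlow : ∀ z : E, (1 - 3 * δ) / (1 - δ) * ‖z‖ ≤ ‖R z‖ := by
    intro z
    rcases eq_or_ne z 0 with rfl | hz
    · simp
    have hz0 : 0 < ‖z‖ := norm_pos_iff.2 hz
    have hu : ‖(‖z‖⁻¹ • z)‖ = 1 := by
      rw [norm_smul, norm_inv, norm_norm, inv_mul_cancel₀ hz0.ne']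
    have h1 := (abs_le.1 (hnet _ hu)).1
    rw [map_smul, norm_smul, norm_inv, norm_norm] at h1
    have h2 : (1 - 3 * δ) / (1 - δ) ≤ 1 - (δ + ‖R‖ * δ) := by
      rw [div_le_iff₀ (by linarith)]
      nlinarith
    calc (1 - 3 * δ) / (1 - δ) * ‖z‖ ≤ (‖z‖⁻¹ * ‖R z‖) * ‖z‖ := by
          gcongr; linarith
      _ = ‖R z‖ := by field_simp
  have hc : 0 < (1 - δ) / (1 - 3 * δ) := div_pos (by linarith) (by linarith)
  refine ⟨((1 - δ) / (1 - 3 * δ)) • R, fun x => ?_, ?_⟩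
  · rw [_root_.smul_apply, norm_smul, Real.norm_of_nonneg hc.le]
    calc ‖x‖ = (1 - δ) / (1 - 3 * δ) * ((1 - 3 * δ) / (1 - δ) * ‖x‖) := by
          have h1 : 1 - δ ≠ 0 := by linarith
          have h2 : 1 - δ * 3 ≠ 0 := by linarith
          field_simp
      _ ≤ _ := by gcongr; exact hlow x
  · rw [norm_smul, Real.norm_of_nonneg hc.le, div_mul_eq_mul_div, div_lt_iff₀ (by linarith)]
    nlinarith

/-- An almost isometric copy of `ℓ_p^n` yields a subspace as required in
`ContainsLpnUniformly`. -/
theorem exists_submodule_of_bounds {n : ℕ} {p : ENNReal} [Fact (1 ≤ p)]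
    (Φ : (PiLp p fun _ : Fin n => ℝ) →L[ℝ] X) {C : ℝ} (hC : 0 ≤ C)
    (h₁ : ∀ a, ‖a‖ ≤ ‖Φ a‖) (h₂ : ∀ a, ‖Φ a‖ ≤ C * ‖a‖) :
    ∃ E : Submodule ℝ X, Module.finrank ℝ E = n ∧
      ∃ T : (PiLp p fun _ : Fin n => ℝ) ≃L[ℝ] E,
        ‖(T : (PiLp p fun _ : Fin n => ℝ) →L[ℝ] E)‖ *
          ‖(T.symm : E →L[ℝ] (PiLp p fun _ : Fin n => ℝ))‖ ≤ C := by
  have hinj : Function.Injective (Φ : (PiLp p fun _ : Fin n => ℝ) →ₗ[ℝ] X) := by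
    rw [← LinearMap.ker_eq_bot, LinearMap.ker_eq_bot']
    intro a ha
    have := h₁ a
    rw [show Φ a = 0 from ha, norm_zero] at this
    exact norm_le_zero_iff.1 this
  let e := LinearEquiv.ofInjective _ hinj
  refine ⟨LinearMap.range (Φ : (PiLp p fun _ : Fin n => ℝ) →ₗ[ℝ] X), ?_,
    e.toContinuousLinearEquiv, ?_⟩
  · rw [← e.finrank_eq]
    rw [LinearEquiv.finrank_eq (WithLp.linearEquiv p ℝ (Fin n → ℝ))]
    simp
  · have b1 : ‖(e.toContinuousLinearEquiv : (PiLp p fun _ : Fin n => ℝ) →L[ℝ]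
        LinearMap.range (Φ : (PiLp p fun _ : Fin n => ℝ) →ₗ[ℝ] X))‖ ≤ C := by
        refine ContinuousLinearMap.opNorm_le_bound _ hC fun a => ?_
        exact h₂ a
    have b2 : ‖(e.toContinuousLinearEquiv.symm : LinearMap.range (Φ : (PiLp p fun _ : Fin n => ℝ) →ₗ[ℝ] X)
        →L[ℝ] (PiLp p fun _ : Fin n => ℝ))‖ ≤ 1 := by
      refine ContinuousLinearMap.opNorm_le_bound _ zero_le_one fun y => ?_
      obtain ⟨a, rfl⟩ := e.surjective y
      have : e.toContinuousLinearEquiv.symm (e a) = a := e.symm_apply_apply a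
      rw [one_mul]
      refine (le_of_eq ?_).trans (h₁ a)
      exact congrArg norm this
    calc _ ≤ C * 1 := mul_le_mul b1 b2 (ContinuousLinearMap.opNorm_nonneg _) hC
      _ = C := mul_one C

end NormedSpaces

section LpEmbedding

open scoped ENNReal

/-- The norm of a finitely-valued function in `L_p`, with the weights given by the masses. -/
theorem eLpNorm_comp_weighted {Ω : Type*} [MeasurableSpace Ω] (μ : Measure Ω) [IsFiniteMeasure μ]
    {κ : Type*} [Fintype κ] [MeasurableSpace κ] [DiscreteMeasurableSpace κ]
    (g : Ω → κ) (hg : Measurable g) (hpos : ∀ i, μ (g ⁻¹' {i}) ≠ 0)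
    (p : ℝ≥0∞) [hp : Fact (1 ≤ p)] (a : PiLp p fun _ : κ => ℝ) :
    (eLpNorm (fun x => a (g x) * (μ (g ⁻¹' {g x})).toReal ^ (-(1 / p.toReal))) p μ).toReal = ‖a‖ := by
  have hmap : ∀ F : κ → ℝ, eLpNorm (fun x => F (g x)) p μ = eLpNorm F p (μ.map g) := fun F =>
    (eLpNorm_map_measure (Measurable.of_discrete).aestronglyMeasurable hg.aemeasurable).symm
  have hmass : ∀ i, μ.map g {i} = μ (g ⁻¹' {i}) := fun i =>
    Measure.map_apply hg (measurableSet_singleton i)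
  rw [hmap fun i => a i * (μ (g ⁻¹' {i})).toReal ^ (-(1 / p.toReal))]
  rcases eq_or_ne p ⊤ with rfl | hptop
  · rw [PiLp.norm_eq_ciSup, eLpNorm_exponent_top, eLpNormEssSup, essSup_eq_iSup
      (fun i => by rw [hmass]; exact hpos i), ENNReal.toReal_iSup (by simp)]
    simp
  · have hp0 : p ≠ 0 := (zero_lt_one.trans_le hp.out).ne'
    have hpr : 0 < p.toReal := ENNReal.toReal_pos hp0 hptop
    rw [PiLp.norm_eq_sum hpr, eLpNorm_eq_lintegral_rpow_enorm_toReal hp0 hptop, lintegral_fintype,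
      ← ENNReal.toReal_rpow, ENNReal.toReal_sum]
    · congr 1
      refine Finset.sum_congr rfl fun i _ => ?_
      have hr : 0 < (μ (g ⁻¹' {i})).toReal :=
        ENNReal.toReal_pos (hpos i) (measure_ne_top _ _)
      rw [hmass, ENNReal.toReal_mul, ← ENNReal.toReal_rpow, toReal_enorm, norm_mul,
        Real.mul_rpow (norm_nonneg _) (norm_nonneg _),
        Real.norm_of_nonneg (Real.rpow_nonneg hr.le _), ← Real.rpow_mul hr.le, mul_assoc]
      have : -(1 / p.toReal) * p.toReal = -1 := by field_simp
      rw [this, Real.rpow_neg_one, inv_mul_cancel₀ hr.ne', mul_one]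
    · intro i _
      rw [hmass]
      exact ENNReal.mul_ne_top (ENNReal.rpow_ne_top_of_nonneg hpr.le enorm_ne_top)
        (measure_ne_top _ _)

theorem exists_isometry_piLp_Lp (n : ℕ) (p : ℝ≥0∞) [hp : Fact (1 ≤ p)] :
    ∃ J : (PiLp p fun _ : Fin n => ℝ) →ₗ[ℝ] Lp ℝ p (volume.restrict (Set.Icc (0 : ℝ) 1)),
      ∀ a, ‖J a‖ = ‖a‖ := by
  rcases Nat.eq_zero_or_pos n with rfl | hn
  · refine ⟨0, fun a => ?_⟩
    have : a = 0 := by ext i; exact i.elim0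
    simp [this]
  have : NeZero n := ⟨hn.ne'⟩
  set μ : Measure ℝ := volume.restrict (Set.Icc (0 : ℝ) 1) with hμ
  set g : ℝ → Fin n := fun x => Fin.ofNat n ⌊(n : ℝ) * x⌋₊ with hgdef
  have hg : Measurable g :=
    (Measurable.of_discrete (f := Fin.ofNat n)).comp
      (Nat.measurable_floor.comp (measurable_id.const_mul (n : ℝ)))
  have hpos : ∀ i, μ (g ⁻¹' {i}) ≠ 0 := by
    intro i hi
    have hn' : (0 : ℝ) < n := by exact_mod_cast hn
    have hsub : Set.Ico ((i : ℝ) / n) (((i : ℝ) + 1) / n) ⊆ g ⁻¹' {i} ∩ Set.Icc 0 1 := by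
      rintro x ⟨h1, h2⟩
      have hx0 : 0 ≤ x := le_trans (by positivity) h1
      rw [div_le_iff₀ hn'] at h1
      rw [lt_div_iff₀ hn'] at h2
      have hfl : ⌊(n : ℝ) * x⌋₊ = i := by
        rw [Nat.floor_eq_iff (by positivity)]
        constructor <;> linarith
      refine ⟨?_, hx0, ?_⟩
      · simp only [Set.mem_preimage, Set.mem_singleton_iff, hgdef, hfl]
        ext
        simp
      · have : ((i : ℕ) : ℝ) + 1 ≤ n := by exact_mod_cast i.2
        by_contra hx
        nlinarith
    rw [hμ, Measure.restrict_apply (hg (measurableSet_singleton i))] at hi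
    have := measure_mono_null hsub hi
    rw [Real.volume_Ico, ENNReal.ofReal_eq_zero, ← sub_div] at this
    have h3 : (0 : ℝ) < ((i : ℝ) + 1 - i) / n := by
      rw [add_sub_cancel_left]; positivity
    linarith
  set w : Fin n → ℝ := fun i => (μ (g ⁻¹' {i})).toReal ^ (-(1 / p.toReal)) with hw
  have hmem : ∀ a : PiLp p fun _ : Fin n => ℝ, MemLp (fun x => a (g x) * w (g x)) p μ := by
    intro a
    obtain ⟨C, hC⟩ := (Set.finite_range fun i => ‖a i * w i‖).bddAbove
    refine MemLp.of_bound ?_ C (Filter.Eventually.of_forall fun x => hC ⟨g x, rfl⟩)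
    exact ((Measurable.of_discrete (f := fun i => a i * w i)).comp hg).aestronglyMeasurable
  refine ⟨{ toFun := fun a => (hmem a).toLp _, map_add' := fun a b => ?_, map_smul' := fun c a => ?_ },
    fun a => ?_⟩
  · rw [← MemLp.toLp_add]
    congr 1
    ext x
    simp [add_mul]
  · rw [RingHom.id_apply, ← MemLp.toLp_const_smul]
    congr 1
    ext x
    simp [mul_assoc]
  · change ‖(hmem a).toLp _‖ = ‖a‖
    rw [Lp.norm_toLp]
    exact eLpNorm_comp_weighted μ g hg hpos p a

end LpEmbedding

section Gauges

variable {ι : Type*}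

/-- The `ℓ_q` norm of a finitely supported function. -/
noncomputable def lpGauge (q : ℝ) (v : ι →₀ ℝ) : ℝ := (v.sum fun _ x => |x| ^ q) ^ (1 / q)

/-- The supremum norm of a finitely supported function. -/
noncomputable def supGauge (v : ι →₀ ℝ) : ℝ := ⨆ i, |v i|

theorem lpGauge_eq_of_support_subset {q : ℝ} (hq : 0 < q) {v : ι →₀ ℝ} {s : Finset ι}
    (hs : v.support ⊆ s) : lpGauge q v = (∑ i ∈ s, |v i| ^ q) ^ (1 / q) := by
  rw [lpGauge, Finsupp.sum_of_support_subset v hs]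
  intro i _
  rw [abs_zero, Real.zero_rpow hq.ne']

open Classical in
theorem sum_single_apply_of_injOn {κ : Type*} {s : Finset κ} {pos : κ → ι}
    (hpos : Set.InjOn pos s) (c : κ → ℝ) {k : κ} (hk : k ∈ s) :
    (∑ k ∈ s, Finsupp.single (pos k) (c k)) (pos k) = c k := by
  rw [Finsupp.finsetSum_apply, Finset.sum_eq_single_of_mem k hk]
  · simp
  · intro j hj hjk
    exact Finsupp.single_eq_of_ne fun h => hjk (hpos hj hk h.symm)

theorem support_sum_single_subset [DecidableEq ι] {κ : Type*} (s : Finset κ) (pos : κ → ι) (c : κ → ℝ) :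
    (∑ k ∈ s, Finsupp.single (pos k) (c k)).support ⊆ s.image pos := by
  intro i hi
  by_contra hcon
  rw [Finsupp.mem_support_iff, Finsupp.finsetSum_apply] at hi
  refine hi (Finset.sum_eq_zero fun k hk => Finsupp.single_eq_of_ne fun h => hcon ?_)
  exact h ▸ Finset.mem_image_of_mem _ hk

open Classical in
theorem lpGauge_sum_single {κ : Type*} {q : ℝ} (hq : 0 < q) {s : Finset κ} {pos : κ → ι}
    (hpos : Set.InjOn pos s) (c : κ → ℝ) :
    lpGauge q (∑ k ∈ s, Finsupp.single (pos k) (c k)) = (∑ k ∈ s, |c k| ^ q) ^ (1 / q) := by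
  rw [lpGauge_eq_of_support_subset hq (support_sum_single_subset s pos c),
    Finset.sum_image hpos]
  congr 1
  exact Finset.sum_congr rfl fun k hk => by rw [sum_single_apply_of_injOn hpos c hk]

theorem bddAbove_range_abs (v : ι →₀ ℝ) : BddAbove (Set.range fun i => |v i|) := by
  refine ⟨∑ j ∈ v.support, |v j|, ?_⟩
  rintro _ ⟨i, rfl⟩
  by_cases hi : i ∈ v.support
  · exact Finset.single_le_sum (f := fun j => |v j|) (fun _ _ => abs_nonneg _) hi
  · simp only [Finsupp.notMem_support_iff.1 hi, abs_zero]
    exact Finset.sum_nonneg fun _ _ => abs_nonneg _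

theorem abs_le_supGauge (v : ι →₀ ℝ) (i : ι) : |v i| ≤ supGauge v :=
  le_ciSup (bddAbove_range_abs v) i

theorem supGauge_nonneg (v : ι →₀ ℝ) : 0 ≤ supGauge v :=
  Real.iSup_nonneg fun _ => abs_nonneg _

theorem supGauge_le {v : ι →₀ ℝ} {B : ℝ} (hB : 0 ≤ B) (h : ∀ i, |v i| ≤ B) : supGauge v ≤ B :=
  Real.iSup_le h hB

/-- Every normed space is approximated by `c₀₀` with the supremum norm. -/
theorem finApprox_supGauge {E : Type*} [NormedAddCommGroup E] [NormedSpace ℝ E] :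
    FinApprox (fun v : E => ‖v‖) (supGauge : (ℕ →₀ ℝ) → ℝ) := by
  classical
  intro S ε hε
  choose φ hφ₁ hφ₂ using fun x : E => exists_dual_vector'' ℝ x
  let e : S → ℕ := fun u => S.equivFin u
  have he : Function.Injective e := Fin.val_injective.comp S.equivFin.injective
  let T : E →ₗ[ℝ] (ℕ →₀ ℝ) :=
    ∑ u : S, Finsupp.lsingle (e u) ∘ₗ ((φ u : E →L[ℝ] ℝ) : E →ₗ[ℝ] ℝ)
  have hT : ∀ v, T v = ∑ u ∈ (Finset.univ : Finset S), Finsupp.single (e u) (φ u v) := fun v => by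
    simp [T]
  refine ⟨T, fun v hv => ?_⟩
  have hle : supGauge (T v) ≤ ‖v‖ := by
    refine supGauge_le (norm_nonneg _) fun i => ?_
    by_cases hi : i ∈ Finset.univ.image e
    · obtain ⟨u, hu, rfl⟩ := Finset.mem_image.1 hi
      rw [hT, sum_single_apply_of_injOn he.injOn _ hu]
      simpa using (φ u).le_of_opNorm_le (hφ₁ u) v
    · have : T v i = 0 := by
        rw [hT]
        exact Finsupp.notMem_support_iff.1 fun h => hi (support_sum_single_subset _ _ _ h)
      rw [this, abs_zero]
      exact norm_nonneg _
  have hge : ‖v‖ ≤ supGauge (T v) := by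
    refine le_trans ?_ (abs_le_supGauge (T v) (e ⟨v, hv⟩))
    rw [hT, sum_single_apply_of_injOn he.injOn _ (Finset.mem_univ _), hφ₂]
    simp
  rw [le_antisymm hle hge, sub_self, abs_zero]
  exact hε.le

open scoped ENNReal in
/-- Finite-dimensional subspaces of `L_p` are approximated by `ℓ_p`. -/
theorem finApprox_lpGauge {Ω : Type*} [MeasurableSpace Ω] {μ : Measure Ω} [IsFiniteMeasure μ]
    {p : ℝ≥0∞} [hp : Fact (1 ≤ p)] (hptop : p ≠ ⊤) (E : Submodule ℝ (Lp ℝ p μ))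
    [FiniteDimensional ℝ E] :
    FinApprox (fun v : E => ‖v‖) (lpGauge p.toReal : (ℕ →₀ ℝ) → ℝ) := by
  classical
  intro S ε hε
  have hp0 : p ≠ 0 := (zero_lt_one.trans_le hp.out).ne'
  have hpr : 0 < p.toReal := ENNReal.toReal_pos hp0 hptop
  let b := Module.finBasis ℝ E
  set d := Module.finrank ℝ E
  let B : Ω → Fin d → ℝ := fun x i => (b i : Lp ℝ p μ) x
  have hB : MemLp B p μ := memLp_pi_iff.2 fun i => Lp.memLp _
  set K : ℝ := ∑ v ∈ S, ∑ i, |b.repr v i| with hK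
  have hK0 : 0 ≤ K := Finset.sum_nonneg fun _ _ => Finset.sum_nonneg fun _ _ => abs_nonneg _
  have hη : 0 < ε / (K + 1) := by positivity
  obtain ⟨s, hs, hsm⟩ := hB.exists_simpleFunc_eLpNorm_sub_lt hptop
    (ε := ENNReal.ofReal (ε / (K + 1))) (by simpa using hη)
  let φ : E → Ω → ℝ := fun v x => ∑ i, b.repr v i * s x i
  have hφm : ∀ v, MemLp (φ v) p μ := fun v =>
    memLp_finsetSum _ fun i _ => (hsm.eval i).const_mul _
  have hae : ∀ v : E, ⇑(v : Lp ℝ p μ) =ᵐ[μ] fun x => ∑ i, b.repr v i * B x i := by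
    intro v
    have h1 : (v : Lp ℝ p μ) = ∑ i, b.repr v i • (b i : Lp ℝ p μ) := by
      have h := congrArg E.subtype (b.sum_repr v)
      rw [map_sum] at h
      exact h.symm
    have h2 : ∀ᵐ x ∂μ, ∀ i, (b.repr v i • (b i : Lp ℝ p μ) : Lp ℝ p μ) x =
        b.repr v i * (b i : Lp ℝ p μ) x :=
      ae_all_iff.2 fun i => Lp.coeFn_smul _ _
    rw [h1]
    filter_upwards [Lp.coeFn_fun_finsetSum Finset.univ
      (fun i => b.repr v i • (b i : Lp ℝ p μ)), h2] with x hx1 hx2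
    rw [hx1]
    exact Finset.sum_congr rfl fun i _ => hx2 i
  have hclose : ∀ v ∈ S, |(eLpNorm (φ v) p μ).toReal - ‖v‖| ≤ ε := by
    intro v hv
    have hvS : ∑ i, |b.repr v i| ≤ K :=
      Finset.single_le_sum (f := fun v => ∑ i, |b.repr v i|)
        (fun _ _ => Finset.sum_nonneg fun _ _ => abs_nonneg _) hv
    have h1 : eLpNorm (φ v - ⇑(v : Lp ℝ p μ)) p μ ≤
        ENNReal.ofReal K * eLpNorm (B - ⇑s) p μ := by
      refine eLpNorm_le_mul_eLpNorm_of_ae_le_mul ?_ p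
      filter_upwards [hae v] with x hx
      rw [Pi.sub_apply, hx, ← Finset.sum_sub_distrib]
      calc ‖∑ i, (b.repr v i * s x i - b.repr v i * B x i)‖
          ≤ ∑ i, ‖b.repr v i * s x i - b.repr v i * B x i‖ := norm_sum_le _ _
        _ ≤ ∑ i, |b.repr v i| * ‖(B - ⇑s) x‖ := by
            refine Finset.sum_le_sum fun i _ => ?_
            rw [← mul_sub, norm_mul, Real.norm_eq_abs, norm_sub_rev]
            gcongr
            exact norm_le_pi_norm ((B - ⇑s) x) i
        _ ≤ K * ‖(B - ⇑s) x‖ := by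
            rw [← Finset.sum_mul]
            gcongr
    have h2 : eLpNorm (φ v - ⇑(v : Lp ℝ p μ)) p μ ≤ ENNReal.ofReal ε := by
      refine h1.trans ((mul_le_mul_right hs.le _).trans ?_)
      rw [← ENNReal.ofReal_mul hK0]
      refine ENNReal.ofReal_le_ofReal ?_
      rw [mul_div_assoc', div_le_iff₀ (by positivity)]
      nlinarith
    have h3 : ‖(hφm v).toLp _ - (v : Lp ℝ p μ)‖ ≤ ε := by
      rw [Lp.norm_def]
      refine ENNReal.toReal_le_of_le_ofReal hε.le (le_trans (le_of_eq ?_) h2)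
      refine eLpNorm_congr_ae ?_
      filter_upwards [Lp.coeFn_sub ((hφm v).toLp _) (v : Lp ℝ p μ), (hφm v).coeFn_toLp]
        with x hx1 hx2
      rw [hx1, Pi.sub_apply, hx2, Pi.sub_apply]
    have h4 := (abs_norm_sub_norm_le ((hφm v).toLp _) (v : Lp ℝ p μ)).trans h3
    rwa [Lp.norm_toLp] at h4
  let e : s.range → ℕ := fun u => s.range.equivFin u
  have he : Function.Injective e := Fin.val_injective.comp s.range.equivFin.injective
  let w : s.range → ℝ := fun y => (μ (s ⁻¹' {(y : Fin d → ℝ)})).toReal ^ (1 / p.toReal)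
  let T : E →ₗ[ℝ] (ℕ →₀ ℝ) :=
    ∑ y : s.range, Finsupp.lsingle (e y) ∘ₗ (∑ i, (w y * (y : Fin d → ℝ) i) • b.coord i)
  have hT : ∀ v, T v = ∑ y ∈ (Finset.univ : Finset s.range),
      Finsupp.single (e y) ((∑ i, b.repr v i * (y : Fin d → ℝ) i) * w y) := fun v => by
    simp only [T, LinearMap.sum_apply, LinearMap.comp_apply, Finsupp.lsingle_apply,
      LinearMap.smul_apply, Module.Basis.coord_apply, smul_eq_mul, Finset.sum_mul]
    refine Finset.sum_congr rfl fun y _ => ?_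
    congr 1
    exact Finset.sum_congr rfl fun i _ => by ring
  refine ⟨T, fun v hv => ?_⟩
  have hg : lpGauge p.toReal (T v) = (eLpNorm (φ v) p μ).toReal := by
    rw [hT, lpGauge_sum_single hpr he.injOn,
      eLpNorm_eq_lintegral_rpow_enorm_toReal hp0 hptop, ← ENNReal.toReal_rpow]
    congr 1
    have h1 : ∫⁻ x, ‖φ v x‖ₑ ^ p.toReal ∂μ =
        (s.map fun y => ‖∑ i, b.repr v i * y i‖ₑ ^ p.toReal).lintegral μ := by
      rw [← SimpleFunc.lintegral_eq_lintegral]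
      rfl
    rw [h1, SimpleFunc.map_lintegral, ENNReal.toReal_sum]
    · refine (Finset.sum_congr rfl fun y _ => ?_).trans (Finset.sum_coe_sort s.range fun a =>
        (‖∑ i, b.repr v i * a i‖ₑ ^ p.toReal * μ (s ⁻¹' {a})).toReal)
      rw [ENNReal.toReal_mul, ← ENNReal.toReal_rpow, toReal_enorm, abs_mul,
        Real.mul_rpow (abs_nonneg _) (abs_nonneg _), Real.norm_eq_abs,
        abs_of_nonneg (Real.rpow_nonneg ENNReal.toReal_nonneg _),
        ← Real.rpow_mul ENNReal.toReal_nonneg, one_div_mul_cancel hpr.ne', Real.rpow_one]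
    · intro y _
      exact ENNReal.mul_ne_top (ENNReal.rpow_ne_top_of_nonneg hpr.le enorm_ne_top)
        (measure_ne_top _ _)
  rw [hg]
  exact hclose v hv

end Gauges

theorem containsLpnUniformly_of_cfinRep {X : Type*} [NormedAddCommGroup X] [NormedSpace ℝ X]
    (p : ENNReal) [Fact (1 ≤ p)] {C : ℝ} (hC : 1 ≤ C)
    (h : CFinRep C (Lp ℝ p (volume.restrict (Set.Icc (0 : ℝ) 1))) X) :
    ContainsLpnUniformly p X := by
  refine ⟨C, hC, fun n => ?_⟩
  obtain ⟨J, hJ⟩ := exists_isometry_piLp_Lp n p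
  obtain ⟨T, hT₁, hT₂⟩ := h (LinearMap.range J) inferInstance
  have hn : ∀ a, ‖J.rangeRestrict a‖ = ‖a‖ := hJ
  refine exists_submodule_of_bounds (T ∘L LinearMap.toContinuousLinearMap J.rangeRestrict)
    (zero_le_one.trans hC) (fun a => ?_) (fun a => ?_)
  · rw [← hn a]
    exact hT₁ _
  · rw [← hn a]
    exact T.le_of_opNorm_le hT₂.le _

section Spreading

open Filter Topology

variable (N : Seminorm ℝ (ℕ →₀ ℝ))

/-- The iterated limit `lim_{n₁} lim_{n₂} ⋯ N (u + c₁ e_{n₁} + c₂ e_{n₂} + ⋯)` along the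
hyperfilter. -/
noncomputable def iterLim : List ℝ → (ℕ →₀ ℝ) → ℝ
  | [], u => N u
  | c :: l, u => limUnder (hyperfilter ℕ : Filter ℕ) fun n => iterLim l (u + Finsupp.single n c)

variable {N}

theorem iterLim_bounds {B : ℝ} (hB : ∀ n, N (Finsupp.single n 1) ≤ B) (l : List ℝ) :
    ∀ u, 0 ≤ iterLim N l u ∧ iterLim N l u ≤ N u + B * (l.map abs).sum ∧
      ∀ c, Tendsto (fun n => iterLim N l (u + Finsupp.single n c)) (hyperfilter ℕ)
        (𝓝 (iterLim N (c :: l) u)) := by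
  have hsingle : ∀ n c, N (Finsupp.single n c) ≤ B * |c| := fun n c => by
    have h1 : Finsupp.single n c = c • Finsupp.single n (1 : ℝ) := by simp
    rw [h1, map_smul_eq_mul, Real.norm_eq_abs, mul_comm]
    gcongr
    exact hB n
  have hadd : ∀ u n c, N (u + Finsupp.single n c) ≤ N u + B * |c| := fun u n c =>
    (map_add_le_add N _ _).trans (by linarith [hsingle n c])
  have key : ∀ l : List ℝ, (∀ u, 0 ≤ iterLim N l u ∧ iterLim N l u ≤ N u + B * (l.map abs).sum) →
      ∀ u c, Tendsto (fun n => iterLim N l (u + Finsupp.single n c)) (hyperfilter ℕ)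
        (𝓝 (iterLim N (c :: l) u)) := by
    intro l hl u c
    refine tendsto_nhds_limUnder (exists_tendsto_hyperfilter_of_bounded _
      (N u + B * |c| + B * (l.map abs).sum) fun n => ?_)
    rw [abs_of_nonneg (hl _).1]
    linarith [(hl (u + Finsupp.single n c)).2, hadd u n c]
  have hb : ∀ u, 0 ≤ iterLim N l u ∧ iterLim N l u ≤ N u + B * (l.map abs).sum := by
    induction l with
    | nil => exact fun u => ⟨apply_nonneg _ _, by simp [iterLim]⟩
    | cons c l ih =>
      intro u
      refine ⟨ge_of_tendsto (key l ih u c) (Eventually.of_forall fun n => (ih _).1),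
        le_of_tendsto (key l ih u c) (Eventually.of_forall fun n => (ih _).2.trans ?_)⟩
      rw [List.map_cons, List.sum_cons]
      linarith [hadd u n c]
  exact fun u => ⟨(hb u).1, (hb u).2, key l hb u⟩

theorem iterLim_filter_ne_zero (l : List ℝ) :
    ∀ u, iterLim N (l.filter (· ≠ 0)) u = iterLim N l u := by
  induction l with
  | nil => simp
  | cons c l ih =>
    intro u
    by_cases hc : c = 0
    · subst hc
      rw [List.filter_cons_of_neg (by simp), ih]
      simp only [iterLim, Finsupp.single_zero, add_zero]
      exact (tendsto_const_nhds.limUnder_eq).symm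
    · rw [List.filter_cons_of_pos (by simpa using hc)]
      simp only [iterLim, ih]

theorem iterLim_approx {ι : Type*} {B : ℝ} (hB : ∀ n, N (Finsupp.single n 1) ≤ B)
    (S : Finset (ι →₀ ℝ)) (is : List ι) (his : is.Nodup) :
    ∀ (u : (ι →₀ ℝ) → ℕ →₀ ℝ) (A : Finset ℕ) (ε : ℝ), 0 < ε →
      ∃ φ : ι → ℕ, (∀ i ∈ is, ∀ j ∈ is, φ i = φ j → i = j) ∧ (∀ i ∈ is, φ i ∉ A) ∧
        ∀ v ∈ S, |N (u v + (is.map fun i => Finsupp.single (φ i) (v i)).sum) -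
          iterLim N (is.map v) (u v)| ≤ ε := by
  classical
  induction is with
  | nil => exact fun u A ε hε => ⟨fun _ => 0, by simp, by simp, by simp [iterLim, hε.le]⟩
  | cons i is ih =>
    intro u A ε hε
    obtain ⟨hi, his'⟩ := List.nodup_cons.1 his
    have h1 : ∀ᶠ n in (hyperfilter ℕ : Filter ℕ), ∀ v ∈ S,
        |iterLim N (is.map v) (u v + Finsupp.single n (v i)) -
          iterLim N ((i :: is).map v) (u v)| ≤ ε / 2 := by
      rw [Filter.eventually_all_finset]
      intro v _
      have := ((iterLim_bounds hB (is.map v) (u v)).2.2 (v i)).eventually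
        (Metric.closedBall_mem_nhds _ (half_pos hε))
      simpa [Real.dist_eq] using this
    have h2 : ∀ᶠ n in (hyperfilter ℕ : Filter ℕ), n ∉ A :=
      hyperfilter_le_cofinite A.finite_toSet.eventually_cofinite_notMem
    obtain ⟨n, hn1, hn2⟩ := (h1.and h2).exists
    obtain ⟨φ, hφ1, hφ2, hφ3⟩ :=
      ih his' (fun v => u v + Finsupp.single n (v i)) (insert n A) (ε / 2) (half_pos hε)
    have hup : ∀ j ∈ is, Function.update φ i n j = φ j := fun j hj =>
      Function.update_of_ne (fun h => hi (by rw [← h]; exact hj)) _ _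
    refine ⟨Function.update φ i n, ?_, ?_, fun v hv => ?_⟩
    · have hne : ∀ j ∈ is, φ j ≠ n := fun j hj h =>
        hφ2 j hj (h ▸ Finset.mem_insert_self _ _)
      intro j hj k hk hjk
      rcases List.mem_cons.1 hj with rfl | hj' <;> rcases List.mem_cons.1 hk with rfl | hk'
      · rfl
      · rw [Function.update_self, hup k hk'] at hjk
        exact absurd hjk.symm (hne k hk')
      · rw [Function.update_self, hup j hj'] at hjk
        exact absurd hjk (hne j hj')
      · rw [hup j hj', hup k hk'] at hjk
        exact hφ1 j hj' k hk' hjk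
    · intro j hj
      rcases List.mem_cons.1 hj with rfl | hj'
      · rwa [Function.update_self]
      · rw [hup j hj']
        exact fun h => hφ2 j hj' (Finset.mem_insert_of_mem h)
    · have h3 := hφ3 v hv
      have h4 : (is.map fun j => Finsupp.single (Function.update φ i n j) (v j)) =
          is.map fun j => Finsupp.single (φ j) (v j) :=
        List.map_congr_left fun j hj => by rw [hup j hj]
      rw [List.map_cons, List.sum_cons, Function.update_self, h4, ← add_assoc]
      have := abs_sub_le (N (u v + Finsupp.single n (v i) +
        (is.map fun j => Finsupp.single (φ j) (v j)).sum))
        (iterLim N (is.map v) (u v + Finsupp.single n (v i)))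
        (iterLim N ((i :: is).map v) (u v))
      linarith [hn1 v hv]

/-- The Brunel–Sucheston construction: a seminorm on `c₀₀(ℕ)` which is bounded on the unit vectors
yields a spreading seminorm on `c₀₀(ι)`, for any linear order `ι`. -/
theorem exists_spreading_seminorm (ι : Type*) [LinearOrder ι] {B : ℝ}
    (hB : ∀ n, N (Finsupp.single n 1) ≤ B) :
    ∃ M : Seminorm ℝ (ι →₀ ℝ),
      (∀ (S : Finset (ι →₀ ℝ)) (ε : ℝ), 0 < ε → ∃ (s : Finset ι) (φ : ι → ℕ),
        Set.InjOn φ s ∧ (∀ v ∈ S, v.support ⊆ s) ∧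
          ∀ v ∈ S, |N (v.mapDomain φ) - M v| ≤ ε) ∧
      ∀ (v : ι →₀ ℝ) (ψ : ι → ι), StrictMonoOn ψ v.support → M (v.mapDomain ψ) = M v := by
  classical
  let M : (ι →₀ ℝ) → ℝ := fun v => iterLim N (v.support.sort.map v) 0
  have hM : ∀ (v : ι →₀ ℝ) (s : Finset ι), v.support ⊆ s → iterLim N (s.sort.map v) 0 = M v := by
    intro v s hs
    have h1 : (s.sort.filter fun i => v i ≠ 0) = v.support.sort := by
      refine List.Perm.eq_of_sortedLE ?_ (Finset.sortedLT_sort _).sortedLE ?_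
      · exact ((Finset.pairwise_sort s _).filter _).sortedLE
      · rw [List.perm_ext_iff_of_nodup ((Finset.sort_nodup s _).filter _)
          (Finset.sort_nodup _ _)]
        intro i
        simp only [List.mem_filter, Finset.mem_sort, Finsupp.mem_support_iff, ne_eq,
          decide_eq_true_eq, and_iff_right_iff_imp]
        exact fun h => hs (Finsupp.mem_support_iff.2 h)
    rw [← iterLim_filter_ne_zero, List.filter_map]
    change iterLim N ((s.sort.filter fun i => v i ≠ 0).map v) 0 = _
    rw [h1]
  have happ : ∀ (S : Finset (ι →₀ ℝ)) (ε : ℝ), 0 < ε → ∃ (s : Finset ι) (φ : ι → ℕ),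
      Set.InjOn φ s ∧ (∀ v ∈ S, v.support ⊆ s) ∧ ∀ v ∈ S, |N (v.mapDomain φ) - M v| ≤ ε := by
    intro S ε hε
    let s := S.biUnion Finsupp.support
    have hs : ∀ v ∈ S, v.support ⊆ s := fun v hv => Finset.subset_biUnion_of_mem _ hv
    obtain ⟨φ, hφ1, -, hφ3⟩ := iterLim_approx hB S s.sort (Finset.sort_nodup _ _)
      (fun _ => 0) ∅ ε hε
    refine ⟨s, φ, fun i hi j hj h => hφ1 i (by simpa using hi) j (by simpa using hj) h, hs,
      fun v hv => ?_⟩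
    have h1 := hφ3 v hv
    rw [hM v s (hs v hv), zero_add] at h1
    have h2 : v.mapDomain φ = (s.sort.map fun i => Finsupp.single (φ i) (v i)).sum := by
      rw [← List.sum_toFinset _ (Finset.sort_nodup _ _), Finset.sort_toFinset, Finsupp.mapDomain,
        Finsupp.sum_of_support_subset v (hs v hv)]
      simp
    rwa [h2]
  have hfin : FinApprox M N := fun S ε hε => by
    obtain ⟨s, φ, -, -, h⟩ := happ S ε hε
    exact ⟨Finsupp.lmapDomain ℝ ℝ φ, h⟩
  obtain ⟨M', hM'⟩ := hfin.exists_seminorm N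
  refine ⟨M', ?_, fun v ψ hψ => ?_⟩
  · simpa only [hM'] using happ
  · rw [hM', hM', ← hM (v.mapDomain ψ) (v.support.image ψ) Finsupp.mapDomain_support]
    change _ = iterLim N (v.support.sort.map v) 0
    have h1 : (v.support.image ψ).sort = v.support.sort.map ψ := by
      refine List.Perm.eq_of_sortedLE (Finset.sortedLT_sort _).sortedLE ?_ ?_
      · refine List.Pairwise.sortedLE (List.pairwise_map.2 ?_)
        refine (Finset.pairwise_sort v.support (· ≤ ·)).imp_of_mem fun ha hb hab => ?_
        exact hψ.monotoneOn (by simpa using ha) (by simpa using hb) hab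
      · rw [List.perm_ext_iff_of_nodup (Finset.sort_nodup _ _)
          ((Finset.sort_nodup _ _).map_on fun a ha b hb => hψ.injOn (by simpa using ha)
            (by simpa using hb))]
        intro i
        simp
    rw [h1, List.map_map]
    congr 1
    refine List.map_congr_left fun i hi => ?_
    exact Finsupp.mapDomain_apply' v.support v subset_rfl hψ.injOn (by simpa using hi)

end Spreading

section Reduction

open Filter Topology

variable {ι : Type*}

theorem lpGauge_mapDomain {κ : Type*} {q : ℝ} (hq : 0 < q) {v : ι →₀ ℝ} {φ : ι → κ}
    (hφ : Set.InjOn φ v.support) : lpGauge q (v.mapDomain φ) = lpGauge q v := by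
  rw [Finsupp.mapDomain, Finsupp.sum, lpGauge_sum_single hq hφ, lpGauge, Finsupp.sum]

theorem supGauge_mapDomain {κ : Type*} {v : ι →₀ ℝ} {φ : ι → κ}
    (hφ : Set.InjOn φ v.support) : supGauge (v.mapDomain φ) = supGauge v := by
  classical
  refine le_antisymm (supGauge_le (supGauge_nonneg _) fun k => ?_)
    (supGauge_le (supGauge_nonneg _) fun i => ?_)
  · by_cases hk : k ∈ (v.mapDomain φ).support
    · obtain ⟨i, hi, rfl⟩ := Finset.mem_image.1 (Finsupp.mapDomain_support hk)
      rw [Finsupp.mapDomain_apply' v.support v subset_rfl hφ hi]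
      exact abs_le_supGauge _ _
    · rw [Finsupp.notMem_support_iff.1 hk, abs_zero]
      exact supGauge_nonneg _
  · by_cases hi : i ∈ v.support
    · rw [← Finsupp.mapDomain_apply' v.support v subset_rfl hφ hi]
      exact abs_le_supGauge _ _
    · rw [Finsupp.notMem_support_iff.1 hi, abs_zero]
      exact supGauge_nonneg _

/-- The `ℓ_p` norm of a finitely supported function, for `p ∈ [1, ∞]`. -/
noncomputable def pGauge (p : ENNReal) (v : ι →₀ ℝ) : ℝ :=
  if p = ⊤ then supGauge v else lpGauge p.toReal v

theorem pGauge_top : pGauge (ι := ι) ⊤ = supGauge := by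
  ext v
  simp [pGauge]

theorem pGauge_of_ne_top {p : ENNReal} (hp : p ≠ ⊤) :
    pGauge (ι := ι) p = lpGauge p.toReal := by
  ext v
  simp [pGauge, hp]

theorem pGauge_mapDomain {κ : Type*} {p : ENNReal} (hp : 1 ≤ p) {v : ι →₀ ℝ} {φ : ι → κ}
    (hφ : Set.InjOn φ v.support) : pGauge p (v.mapDomain φ) = pGauge p v := by
  by_cases h : p = ⊤
  · subst h
    rw [pGauge_top, pGauge_top, supGauge_mapDomain hφ]
  · rw [pGauge_of_ne_top h, pGauge_of_ne_top h,
      lpGauge_mapDomain (ENNReal.toReal_pos (zero_lt_one.trans_le hp).ne' h) hφ]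

theorem pGauge_single {p : ENNReal} (hp : 1 ≤ p) (i : ι) :
    pGauge p (Finsupp.single i (1 : ℝ)) = 1 := by
  by_cases h : p = ⊤
  · subst h
    rw [pGauge_top]
    refine le_antisymm (supGauge_le zero_le_one fun j => ?_) ?_
    · classical
      rw [Finsupp.single_apply]
      split_ifs <;> simp
    · simpa using abs_le_supGauge (Finsupp.single i (1 : ℝ)) i
  · rw [pGauge_of_ne_top h]
    have hq := ENNReal.toReal_pos (zero_lt_one.trans_le hp).ne' h
    simpa using lpGauge_sum_single hq (s := {i}) (pos := id) Function.injective_id.injOn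
      (fun _ => (1 : ℝ))

theorem norm_toLp_eq_pGauge {p : ENNReal} [hp : Fact (1 ≤ p)] {n : ℕ} {v : ℕ →₀ ℝ}
    (hv : v.support ⊆ Finset.range n) :
    ‖WithLp.toLp p fun i : Fin n => v i‖ = pGauge p v := by
  by_cases h : p = ⊤
  · subst h
    rw [pGauge_top, PiLp.norm_eq_ciSup]
    refine le_antisymm (Real.iSup_le (fun i => abs_le_supGauge v i) (supGauge_nonneg v))
      (supGauge_le (Real.iSup_nonneg fun i => norm_nonneg _) fun i => ?_)
    by_cases hi : i ∈ v.support
    · exact le_ciSup (f := fun j : Fin n => ‖v j‖) (Set.finite_range _).bddAbove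
        ⟨i, Finset.mem_range.1 (hv hi)⟩
    · rw [Finsupp.notMem_support_iff.1 hi, abs_zero]
      exact Real.iSup_nonneg fun i => norm_nonneg _
  · have hq := ENNReal.toReal_pos (zero_lt_one.trans_le hp.out).ne' h
    rw [pGauge_of_ne_top h, PiLp.norm_eq_sum hq, lpGauge_eq_of_support_subset hq hv,
      Finset.sum_range]
    rfl

theorem ContainsLpnUniformly.exists_bounds {X : Type*} [NormedAddCommGroup X] [NormedSpace ℝ X]
    {p : ENNReal} [Fact (1 ≤ p)] (h : ContainsLpnUniformly p X) :
    ∃ lam : ℝ, 1 ≤ lam ∧ ∀ n : ℕ, ∃ S : (PiLp p fun _ : Fin n => ℝ) →ₗ[ℝ] X,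
      ∀ a, ‖a‖ ≤ ‖S a‖ ∧ ‖S a‖ ≤ lam * ‖a‖ := by
  obtain ⟨lam, hlam, h⟩ := h
  refine ⟨lam, hlam, fun n => ?_⟩
  obtain ⟨E, -, T, hT⟩ := h n
  set A := ‖(T : (PiLp p fun _ : Fin n => ℝ) →L[ℝ] E)‖
  set B := ‖(T.symm : E →L[ℝ] (PiLp p fun _ : Fin n => ℝ))‖
  refine ⟨B • (E.subtype ∘ₗ (T : (PiLp p fun _ : Fin n => ℝ) →ₗ[ℝ] E)), fun a => ?_⟩
  have h1 : ‖a‖ ≤ B * ‖T a‖ := by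
    simpa using (T.symm : E →L[ℝ] (PiLp p fun _ : Fin n => ℝ)).le_opNorm (T a)
  have h2 : ‖T a‖ ≤ A * ‖a‖ := (T : (PiLp p fun _ : Fin n => ℝ) →L[ℝ] E).le_opNorm a
  have hB : 0 ≤ B := norm_nonneg (T.symm : E →L[ℝ] (PiLp p fun _ : Fin n => ℝ))
  have h3 : ‖(B • (E.subtype ∘ₗ (T : (PiLp p fun _ : Fin n => ℝ) →ₗ[ℝ] E))) a‖ = B * ‖T a‖ := by
    rw [LinearMap.smul_apply, norm_smul, Real.norm_of_nonneg hB]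
    rfl
  rw [h3]
  refine ⟨h1, ?_⟩
  calc B * ‖T a‖ ≤ B * (A * ‖a‖) := by gcongr
    _ = A * B * ‖a‖ := by ring
    _ ≤ lam * ‖a‖ := by gcongr

/-- A space containing the `ℓ_p^n` uniformly has, for every linear order `ι`, a spreading model
on `c₀₀(ι)` equivalent to the `ℓ_p` norm. -/
theorem ContainsLpnUniformly.exists_spreading {X : Type*} [NormedAddCommGroup X]
    [NormedSpace ℝ X] {p : ENNReal} [hp : Fact (1 ≤ p)] (h : ContainsLpnUniformly p X)
    (ι : Type*) [LinearOrder ι] :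
    ∃ (lam : ℝ) (M : Seminorm ℝ (ι →₀ ℝ)), 1 ≤ lam ∧ FinApprox M (fun x : X => ‖x‖) ∧
      (∀ v, pGauge p v ≤ M v ∧ M v ≤ lam * pGauge p v) ∧
      ∀ (v : ι →₀ ℝ) (ψ : ι → ι), StrictMonoOn ψ v.support → M (v.mapDomain ψ) = M v := by
  obtain ⟨lam, hlam, h⟩ := h.exists_bounds
  choose S hS using h
  let R : ∀ n, (ℕ →₀ ℝ) →ₗ[ℝ] PiLp p fun _ : Fin n => ℝ := fun n =>
    { toFun := fun v => WithLp.toLp p fun i : Fin n => v i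
      map_add' := fun _ _ => rfl
      map_smul' := fun _ _ => rfl }
  have hev : ∀ v : ℕ →₀ ℝ, ∃ n₀, ∀ n, n₀ ≤ n → ‖R n v‖ = pGauge p v := fun v => by
    obtain ⟨n₀, hn₀⟩ := v.support.exists_nat_subset_range
    exact ⟨n₀, fun n hn => norm_toLp_eq_pGauge
      (hn₀.trans (Finset.range_subset_range.2 hn))⟩
  have hbd : ∀ v, ∃ B, ∀ n, normSeminorm ℝ X ((S n ∘ₗ R n) v) ≤ B := by
    intro v
    obtain ⟨n₀, hn₀⟩ := hev v
    refine ⟨(∑ n ∈ Finset.range n₀, ‖S n (R n v)‖) + lam * pGauge p v, fun n => ?_⟩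
    have hg : 0 ≤ pGauge p v := by
      rw [← hn₀ n₀ le_rfl]
      exact norm_nonneg _
    rcases lt_or_ge n n₀ with hn | hn
    · have := Finset.single_le_sum (f := fun n => ‖S n (R n v)‖) (fun _ _ => norm_nonneg _)
        (Finset.mem_range.2 hn)
      have h2 : 0 ≤ lam * pGauge p v := by positivity
      simp only [LinearMap.comp_apply, coe_normSeminorm]
      linarith
    · have h1 := (hS n (R n v)).2
      rw [hn₀ n hn] at h1
      have : 0 ≤ ∑ n ∈ Finset.range n₀, ‖S n (R n v)‖ :=
        Finset.sum_nonneg fun _ _ => norm_nonneg _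
      simp only [LinearMap.comp_apply, coe_normSeminorm]
      linarith
  obtain ⟨N, hN₁, hN₂⟩ := exists_seminorm_hyperfilter_limit (normSeminorm ℝ X) _ hbd
  have hN : ∀ v, pGauge p v ≤ N v ∧ N v ≤ lam * pGauge p v := by
    intro v
    obtain ⟨n₀, hn₀⟩ := hev v
    have hge : ∀ᶠ n in (hyperfilter ℕ : Filter ℕ), n₀ ≤ n :=
      Nat.hyperfilter_le_atTop (eventually_ge_atTop n₀)
    constructor
    · refine ge_of_tendsto (hN₂ v) (hge.mono fun n hn => ?_)
      rw [← hn₀ n hn]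
      exact (hS n _).1
    · refine le_of_tendsto (hN₂ v) (hge.mono fun n hn => ?_)
      rw [← hn₀ n hn]
      exact (hS n _).2
  obtain ⟨M, hM₁, hM₂⟩ := exists_spreading_seminorm (N := N) (B := lam) ι fun n => by
    simpa [pGauge_single hp.out] using (hN (Finsupp.single n 1)).2
  have hMN : FinApprox M N := fun S ε hε => by
    obtain ⟨s, φ, -, -, h⟩ := hM₁ S ε hε
    exact ⟨Finsupp.lmapDomain ℝ ℝ φ, h⟩
  refine ⟨lam, M, hlam, hMN.trans hN₁, fun v => ?_, hM₂⟩
  have key : ∀ ε, 0 < ε → pGauge p v ≤ M v + ε ∧ M v ≤ lam * pGauge p v + ε := by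
    intro ε hε
    obtain ⟨s, φ, hφ, hs, h⟩ := hM₁ {v} ε hε
    have h1 := abs_le.1 (h v (Finset.mem_singleton_self v))
    have h2 := hN (v.mapDomain φ)
    rw [pGauge_mapDomain hp.out
      (hφ.mono (Finset.coe_subset.2 (hs v (Finset.mem_singleton_self v))))] at h2
    constructor <;> linarith
  exact ⟨le_of_forall_pos_le_add fun ε hε => (key ε hε).1,
    le_of_forall_pos_le_add fun ε hε => (key ε hε).2⟩

end Reduction

/-- James's distortion argument for spreading seminorms equivalent to the supremum norm. -/
theorem finApprox_supGauge_of_spreading {M : Seminorm ℝ (ℕ →₀ ℝ)} {C : ℝ} (hC : 1 ≤ C)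
    (hM : ∀ v, supGauge v ≤ M v ∧ M v ≤ C * supGauge v)
    (hsp : ∀ (v : ℕ →₀ ℝ) (ψ : ℕ → ℕ), StrictMonoOn ψ v.support → M (v.mapDomain ψ) = M v) :
    FinApprox (supGauge : (ℕ →₀ ℝ) → ℝ) M := by
  classical
  set Q : Set ℝ := M '' {y | supGauge y ≤ 1}
  set Λ : ℝ := sSup Q
  have hbdd : BddAbove Q := by
    refine ⟨C, ?_⟩
    rintro _ ⟨y, hy, rfl⟩
    refine (hM y).2.trans ?_
    nlinarith [hy.out]
  have hone : (1 : ℝ) ≤ Λ := by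
    have h1 : supGauge (Finsupp.single 0 1 : ℕ →₀ ℝ) = 1 := by
      rw [← pGauge_top]
      exact pGauge_single le_top 0
    refine le_trans ?_ (le_csSup hbdd ⟨Finsupp.single 0 1, h1.le, rfl⟩)
    exact h1.symm.le.trans (hM _).1
  have hsmul : ∀ (c : ℝ) (v : ℕ →₀ ℝ), 0 ≤ c → supGauge (c • v) ≤ c * supGauge v := by
    intro c v hc
    refine supGauge_le (mul_nonneg hc (supGauge_nonneg _)) fun i => ?_
    rw [Finsupp.smul_apply, smul_eq_mul, abs_mul, abs_of_nonneg hc]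
    exact mul_le_mul_of_nonneg_left (abs_le_supGauge v i) hc
  have hΛ : ∀ y, M y ≤ Λ * supGauge y := by
    intro y
    rcases (supGauge_nonneg y).eq_or_lt with h0 | h0
    · have := (hM y).2
      rw [← h0] at this ⊢
      simpa using this
    · have h1 : supGauge ((supGauge y)⁻¹ • y) ≤ 1 :=
        (hsmul _ y (inv_nonneg.2 h0.le)).trans (inv_mul_cancel₀ h0.ne').le
      have h2 : M ((supGauge y)⁻¹ • y) ≤ Λ := le_csSup hbdd ⟨_, h1, rfl⟩
      rw [map_smul_eq_mul, Real.norm_of_nonneg (inv_nonneg.2 h0.le), inv_mul_le_iff₀ h0] at h2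
      linarith
  intro S ε hε
  set K : ℝ := ∑ v ∈ S, supGauge v with hK
  have hK0 : 0 ≤ K := Finset.sum_nonneg fun _ _ => supGauge_nonneg _
  set δ : ℝ := min (1 / 2) (ε / (2 * (K + 1)))
  have hδ : 0 < δ := by positivity
  have hδ1 : δ ≤ 1 / 2 := min_le_left _ _
  have hδ2 : δ * (2 * (K + 1)) ≤ ε := (le_div_iff₀ (by positivity)).1 (min_le_right _ _)
  obtain ⟨_, ⟨y, hy, rfl⟩, hyM⟩ := exists_lt_of_lt_csSup
    (⟨_, 0, supGauge_le zero_le_one (by simp), rfl⟩ : Q.Nonempty) (sub_lt_self Λ hδ)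
  have hpair : ∀ i, StrictMono (Nat.pair i) := fun i _ _ h => Nat.pair_lt_pair_right i h
  let L : (ℕ →₀ ℝ) →ₗ[ℝ] (ℕ →₀ ℝ) :=
    Finsupp.linearCombination ℝ fun i => y.mapDomain (Nat.pair i)
  have hLs : ∀ i c, L (Finsupp.single i c) = c • y.mapDomain (Nat.pair i) := fun i c =>
    Finsupp.linearCombination_single ..
  have hL : ∀ a i j, L a (Nat.pair i j) = a i * y j := by
    intro a i j
    induction a using Finsupp.induction_linear with
    | zero => simp
    | add f g hf hg => rw [map_add, Finsupp.add_apply, hf, hg, Finsupp.add_apply, add_mul]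
    | single k c =>
      rw [hLs, Finsupp.smul_apply, smul_eq_mul]
      by_cases hk : k = i
      · subst hk
        rw [Finsupp.mapDomain_apply (hpair k).injective, Finsupp.single_eq_same]
      · rw [Finsupp.mapDomain_of_notMem_range, Finsupp.single_eq_of_ne (Ne.symm hk), mul_zero,
          zero_mul]
        rintro ⟨j', hj'⟩
        exact hk (Nat.pair_eq_pair.1 hj').1
  have hup : ∀ a, M (L a) ≤ Λ * supGauge a := by
    intro a
    refine (hΛ _).trans (mul_le_mul_of_nonneg_left ?_ (by linarith))
    refine supGauge_le (supGauge_nonneg _) fun m => ?_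
    rw [← Nat.pair_unpair m, hL, abs_mul]
    calc _ ≤ supGauge a * 1 := mul_le_mul (abs_le_supGauge _ _)
          ((abs_le_supGauge _ _).trans hy) (abs_nonneg _) (supGauge_nonneg _)
      _ = _ := mul_one _
  have hlow : ∀ a, (Λ - 2 * δ) * supGauge a ≤ M (L a) := by
    intro a
    have h1 : ∀ i, 2 * (Λ - δ) * |a i| ≤ M (L a) + Λ * supGauge a := by
      intro i
      set b : ℕ →₀ ℝ := Finsupp.single i (2 * a i) - a with hb
      have hbs : supGauge b ≤ supGauge a := by
        refine supGauge_le (supGauge_nonneg _) fun j => le_trans (le_of_eq ?_)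
          (abs_le_supGauge a j)
        by_cases hj : i = j
        · subst hj
          rw [hb, Finsupp.sub_apply, Finsupp.single_eq_same]
          ring_nf
        · rw [hb, Finsupp.sub_apply, Finsupp.single_eq_of_ne (Ne.symm hj), zero_sub, abs_neg]
      have h2 : M (L a + L b) = 2 * |a i| * M y := by
        rw [← map_add, hb, add_sub_cancel, hLs, map_smul_eq_mul, hsp y _ ((hpair i).strictMonoOn _),
          Real.norm_eq_abs, abs_mul, abs_two]
      have h3 := map_add_le_add M (L a) (L b)
      have h4 := (hup b).trans (mul_le_mul_of_nonneg_left hbs (by linarith : 0 ≤ Λ))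
      have h5 : 2 * |a i| * (Λ - δ) ≤ 2 * |a i| * M y := by gcongr
      linarith
    have hpos : 0 < 2 * (Λ - δ) := by linarith
    have h2 : supGauge a ≤ (M (L a) + Λ * supGauge a) / (2 * (Λ - δ)) := by
      refine supGauge_le (div_nonneg (add_nonneg (apply_nonneg _ _)
        (mul_nonneg (by linarith) (supGauge_nonneg _))) hpos.le) fun i => ?_
      rw [le_div_iff₀ hpos, mul_comm]
      exact h1 i
    rw [le_div_iff₀ hpos] at h2
    linarith
  refine ⟨Λ⁻¹ • L, fun v hv => ?_⟩
  have hvK : supGauge v ≤ K :=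
    Finset.single_le_sum (f := fun v => supGauge v) (fun _ _ => supGauge_nonneg _) hv
  have hΛ0 : 0 < Λ := by linarith
  have h1 : M ((Λ⁻¹ • L) v) = M (L v) / Λ := by
    rw [LinearMap.smul_apply, map_smul_eq_mul, Real.norm_of_nonneg (inv_nonneg.2 hΛ0.le),
      inv_mul_eq_div]
  have h2 : M (L v) / Λ ≤ supGauge v := by
    rw [div_le_iff₀ hΛ0, mul_comm]
    exact hup v
  have h3 : supGauge v - 2 * δ * supGauge v ≤ M (L v) / Λ := by
    rw [le_div_iff₀ hΛ0]
    have : 0 ≤ δ * supGauge v * (Λ - 1) :=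
      mul_nonneg (mul_nonneg hδ.le (supGauge_nonneg _)) (by linarith)
    nlinarith [hlow v]
  have h4 : δ * supGauge v ≤ δ * K := by gcongr
  rw [h1, abs_le]
  constructor <;> nlinarith

section Folner

open Filter Topology
open scoped Pointwise

theorem card_Icc_pow_le (K L : ℕ) : ((Finset.Icc 1 K) ^ L).card ≤ (L + 1) ^ K := by
  classical
  have hsub : ∀ l, (Finset.Icc 1 K) ^ l ⊆
      (Fintype.piFinset fun _ : Fin K => Finset.range (l + 1)).image
        fun e : Fin K → ℕ => ∏ i : Fin K, ((i : ℕ) + 1) ^ e i := by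
    intro l
    induction l with
    | zero =>
      intro x hx
      rw [pow_zero, Finset.mem_one] at hx
      exact Finset.mem_image.2 ⟨fun _ => 0, by simp, by simp [hx]⟩
    | succ l ih =>
      intro x hx
      rw [pow_succ, Finset.mem_mul] at hx
      obtain ⟨y, hy, z, hz, rfl⟩ := hx
      obtain ⟨e, he, rfl⟩ := Finset.mem_image.1 (ih hy)
      obtain ⟨hz1, hzK⟩ := Finset.mem_Icc.1 hz
      let j : Fin K := ⟨z - 1, by omega⟩
      have hj : (j : ℕ) + 1 = z := Nat.sub_add_cancel hz1
      refine Finset.mem_image.2 ⟨e + Pi.single j 1, ?_, ?_⟩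
      · rw [Fintype.mem_piFinset] at he ⊢
        intro i
        have := Finset.mem_range.1 (he i)
        have h2 : (Pi.single j 1 : Fin K → ℕ) i ≤ 1 := by
          rw [Pi.single_apply]
          split_ifs <;> simp
        rw [Finset.mem_range, Pi.add_apply]
        omega
      · simp only [Pi.add_apply, pow_add, Finset.prod_mul_distrib]
        congr 1
        rw [Finset.prod_eq_single j]
        · simp [hj]
        · intro b _ hb
          simp [Pi.single_eq_of_ne hb]
        · simp
  calc _ ≤ _ := Finset.card_le_card (hsub L)
    _ ≤ _ := Finset.card_image_le
    _ = (L + 1) ^ K := by simp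

/-- Følner sets for the multiplicative semigroup of positive integers. -/
theorem exists_folner_mul (K : ℕ) {δ : ℝ} (hδ : 0 < δ) :
    ∃ F : Finset ℕ, F.Nonempty ∧ 0 ∉ F ∧ ∀ μ, 0 < μ → μ ≤ K →
      ((F \ F.image (μ * ·)).card : ℝ) ≤ δ * F.card ∧
      ((F.image (μ * ·) \ F).card : ℝ) ≤ δ * F.card := by
  classical
  rcases Nat.eq_zero_or_pos K with rfl | hK
  · exact ⟨{1}, by simp, by simp, fun μ h1 h2 => by omega⟩
  set A : Finset ℕ := Finset.Icc 1 K
  have h1A : 1 ∈ A := Finset.mem_Icc.2 ⟨le_rfl, hK⟩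
  have hne : ∀ L, (A ^ L).Nonempty := fun L => ⟨1, by simpa using Finset.pow_mem_pow h1A (n := L)⟩
  have hmono : ∀ L, A ^ L ⊆ A ^ (L + 1) := fun L =>
    Finset.pow_subset_pow_right h1A (Nat.le_succ L)
  obtain ⟨L, hL⟩ : ∃ L, ((A ^ (L + 1)).card : ℝ) ≤ (1 + δ) * (A ^ L).card := by
    by_contra! hcon
    have hgrow : ∀ L, (1 + δ) ^ L ≤ ((A ^ L).card : ℝ) := by
      intro L
      induction L with
      | zero => simp
      | succ L ih =>
        rw [pow_succ, mul_comm]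
        exact (mul_le_mul_of_nonneg_left ih (by positivity)).trans (hcon L).le
    have hlim := (tendsto_pow_const_div_const_pow_of_one_lt K
      (by linarith : (1 : ℝ) < 1 + δ)).comp (tendsto_add_atTop_nat 1)
    have hge : (1 + δ)⁻¹ ≤ (0 : ℝ) := by
      refine ge_of_tendsto hlim (Eventually.of_forall fun L => ?_)
      have h2 : (1 + δ) ^ L ≤ ((L + 1 : ℕ) : ℝ) ^ K :=
        (hgrow L).trans (by exact_mod_cast card_Icc_pow_le K L)
      rw [Function.comp_apply, le_div_iff₀ (by positivity), pow_succ]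
      calc (1 + δ)⁻¹ * ((1 + δ) ^ L * (1 + δ)) = (1 + δ) ^ L := by field_simp
        _ ≤ _ := h2
    have : (0 : ℝ) < (1 + δ)⁻¹ := by positivity
    linarith
  have hzero : ∀ L, 0 ∉ A ^ L := by
    intro L
    induction L with
    | zero => simp
    | succ L ih =>
      rw [pow_succ, Finset.mem_mul]
      rintro ⟨y, hy, z, hz, h⟩
      have := Finset.mem_Icc.1 hz
      rcases mul_eq_zero.1 h with rfl | rfl
      · exact ih hy
      · omega
  refine ⟨A ^ L, hne L, hzero L, fun μ hμ hμK => ?_⟩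
  have hcard : ((A ^ L).image (μ * ·)).card = (A ^ L).card :=
    Finset.card_image_of_injective _ fun a b h => Nat.eq_of_mul_eq_mul_left hμ h
  have hsub : (A ^ L).image (μ * ·) ⊆ A ^ (L + 1) := by
    intro x hx
    obtain ⟨y, hy, rfl⟩ := Finset.mem_image.1 hx
    rw [pow_succ', Finset.mem_mul]
    exact ⟨μ, Finset.mem_Icc.2 ⟨hμ, hμK⟩, y, hy, rfl⟩
  have h2 : (((A ^ L).image (μ * ·) \ A ^ L).card : ℝ) ≤ δ * (A ^ L).card := by
    have h3 := Finset.card_le_card (Finset.sdiff_subset_sdiff hsub (subset_refl (A ^ L)))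
    have h4 := Finset.card_sdiff_add_card_eq_card (hmono L)
    have h5 : (((A ^ L).image (μ * ·) \ A ^ L).card : ℝ) + (A ^ L).card ≤
        (A ^ (L + 1)).card := by
      exact_mod_cast (Nat.add_le_add_right h3 _).trans h4.le
    linarith
  refine ⟨?_, h2⟩
  rwa [Finset.card_sdiff_comm hcard.symm]

end Folner

section Blocks

variable {ι : Type*}

theorem map_sum_single_of_spreading {κ : Type*} [LinearOrder ι] {N : Seminorm ℝ (ι →₀ ℝ)}
    (hsp : ∀ (v : ι →₀ ℝ) (ψ : ι → ι), StrictMonoOn ψ v.support → N (v.mapDomain ψ) = N v)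
    {s : Finset κ} {pos pos' : κ → ι} (hinj : Set.InjOn pos s)
    (hlt : ∀ k ∈ s, ∀ k' ∈ s, pos k < pos k' → pos' k < pos' k') (c : κ → ℝ) :
    N (∑ k ∈ s, Finsupp.single (pos' k) (c k)) = N (∑ k ∈ s, Finsupp.single (pos k) (c k)) := by
  classical
  rcases s.eq_empty_or_nonempty with rfl | ⟨k₀, -⟩
  · simp
  have : Nonempty κ := ⟨k₀⟩
  let ψ : ι → ι := fun i => pos' (Function.invFunOn pos s i)
  have hψ : ∀ k ∈ s, ψ (pos k) = pos' k := fun k hk => by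
    simp only [ψ]
    rw [hinj.leftInvOn_invFunOn hk]
  rw [← hsp (∑ k ∈ s, Finsupp.single (pos k) (c k)) ψ]
  · rw [Finsupp.mapDomain_finsetSum]
    refine congrArg N (Finset.sum_congr rfl fun k hk => ?_)
    rw [Finsupp.mapDomain_single, hψ k hk]
  · intro i hi j hj hij
    obtain ⟨k, hk, rfl⟩ := Finset.mem_image.1 (support_sum_single_subset s pos c hi)
    obtain ⟨k', hk', rfl⟩ := Finset.mem_image.1 (support_sum_single_subset s pos c hj)
    rw [hψ k hk, hψ k' hk']
    exact hlt k hk k' hk' hij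

/-- Position of the index `⟨m, l, s⟩` in a block attached to the rational interval
`[r, r + 1 / μ)`. -/
def blockPos (r : ℚ) (μ σ : ℕ) (x : Σ _ : ℕ, ℕ × ℕ) : ℚ ×ₗ ℕ ×ₗ ℕ :=
  toLex (r + (x.2.1 / x.1 : ℚ) / μ, toLex (x.1 * μ, x.2.2 + σ))

/-- The indices of a block. -/
def blockIndex (t : ℕ) (F : Finset ℕ) : Finset (Σ _ : ℕ, ℕ × ℕ) :=
  F.sigma fun m => Finset.range m ×ˢ Finset.range (2 * t)

/-- The coefficients of a block. -/
noncomputable def blockCoeff (q : ℝ) (x : Σ _ : ℕ, ℕ × ℕ) : ℝ :=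
  (x.1 : ℝ) ^ (-(1 / q)) * (-1) ^ x.2.2

/-- A block of `m ^ (-1 / q)`-weighted alternating sums over the multiples of `1 / (m μ)` in
`[r, r + 1 / μ)`, for `m ∈ F`. -/
noncomputable def block (q : ℝ) (t : ℕ) (F : Finset ℕ) (r : ℚ) (μ σ : ℕ) :
    ℚ ×ₗ ℕ ×ₗ ℕ →₀ ℝ :=
  ∑ x ∈ blockIndex t F, Finsupp.single (blockPos r μ σ x) (blockCoeff q x)

theorem blockPos_fst_bounds {t : ℕ} {F : Finset ℕ} {x : Σ _ : ℕ, ℕ × ℕ}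
    (hx : x ∈ blockIndex t F) {r : ℚ} {μ : ℕ} (hμ : 0 < μ) :
    r ≤ r + (x.2.1 / x.1 : ℚ) / μ ∧ r + (x.2.1 / x.1 : ℚ) / μ < r + 1 / μ := by
  have h1 : x.2.1 < x.1 :=
    Finset.mem_range.1 (Finset.mem_product.1 (Finset.mem_sigma.1 hx).2).1
  have h2 : (0 : ℚ) < x.1 := by exact_mod_cast (Nat.zero_le _).trans_lt h1
  have h3 : (0 : ℚ) < μ := by exact_mod_cast hμ
  have h4 : (x.2.1 / x.1 : ℚ) < 1 := by
    rw [div_lt_one h2]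
    exact_mod_cast h1
  constructor
  · have : 0 ≤ (x.2.1 / x.1 : ℚ) / μ := by positivity
    linarith
  · gcongr

theorem blockPos_injOn (t : ℕ) (F : Finset ℕ) (r : ℚ) {μ : ℕ} (hμ : 0 < μ) (σ : ℕ) :
    Set.InjOn (blockPos r μ σ) (blockIndex t F) := by
  rintro ⟨m, l, s⟩ hx ⟨m', l', s'⟩ hx' h
  have h1 : l < m := Finset.mem_range.1 (Finset.mem_product.1 (Finset.mem_sigma.1 hx).2).1
  have hm : (m : ℚ) ≠ 0 := by exact_mod_cast ((Nat.zero_le _).trans_lt h1).ne'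
  have hμ' : (μ : ℚ) ≠ 0 := by exact_mod_cast hμ.ne'
  have h2 := toLex.injective h
  simp only [Prod.mk.injEq] at h2
  have h3 := toLex.injective h2.2
  simp only [Prod.mk.injEq] at h3
  have h4 : m = m' := Nat.eq_of_mul_eq_mul_right hμ h3.1
  subst h4
  have h5 : (l : ℚ) = l' := by
    have := h2.1
    field_simp at this
    linarith
  have h6 : l = l' := by exact_mod_cast h5
  subst h6
  have h7 : s = s' := by omega
  rw [h7]

theorem blockPos_lt_of_same {r r' : ℚ} {μ μ' σ σ' : ℕ} (hμ : 0 < μ) (hμ' : 0 < μ')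
    {x y : Σ _ : ℕ, ℕ × ℕ} (h : blockPos r μ σ x < blockPos r μ σ y) :
    blockPos r' μ' σ' x < blockPos r' μ' σ' y := by
  have h1 : (0 : ℚ) < μ := by exact_mod_cast hμ
  have h2 : (0 : ℚ) < μ' := by exact_mod_cast hμ'
  simp only [blockPos, Prod.Lex.toLex_lt_toLex, add_lt_add_iff_left, add_right_inj,
    div_lt_div_iff_of_pos_right h1, div_lt_div_iff_of_pos_right h2, div_left_inj' h1.ne',
    div_left_inj' h2.ne', Nat.mul_lt_mul_right hμ, Nat.mul_lt_mul_right hμ',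
    Nat.mul_left_inj hμ.ne', Nat.mul_left_inj hμ'.ne', add_lt_add_iff_right] at h ⊢
  exact h

/-- The norm of a sum of successive blocks depends only on their number. -/
theorem map_sum_block_eq {N : Seminorm ℝ (ℚ ×ₗ ℕ ×ₗ ℕ →₀ ℝ)}
    (hsp : ∀ (v : ℚ ×ₗ ℕ ×ₗ ℕ →₀ ℝ) (ψ : ℚ ×ₗ ℕ ×ₗ ℕ → ℚ ×ₗ ℕ ×ₗ ℕ),
      StrictMonoOn ψ v.support → N (v.mapDomain ψ) = N v)
    (q : ℝ) (t : ℕ) (F : Finset ℕ) {β : Type*} [LinearOrder β] (B : Finset β)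
    (r : β → ℚ) (μ σ : β → ℕ) (hμ : ∀ b ∈ B, 0 < μ b)
    (hr : ∀ b ∈ B, ∀ b' ∈ B, b < b' → r b + 1 / μ b ≤ r b') :
    N (∑ b ∈ B, block q t F (r b) (μ b) (σ b)) =
      N (∑ k ∈ Finset.range B.card, block q t F k 1 0) := by
  let e : Fin B.card ≃o B := B.orderIsoOfFin rfl
  have h1 : ∑ b ∈ B, block q t F (r b) (μ b) (σ b) =
      ∑ k : Fin B.card, block q t F (r (e k)) (μ (e k)) (σ (e k)) := by
    rw [← Finset.sum_coe_sort B, ← Equiv.sum_comp e.toEquiv]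
    rfl
  rw [h1, Finset.sum_range]
  simp only [block]
  rw [← Finset.sum_product', ← Finset.sum_product']
  have hlt : ∀ k k' : Fin B.card, k < k' → ∀ x ∈ blockIndex t F, ∀ y ∈ blockIndex t F,
      blockPos (r (e k)) (μ (e k)) (σ (e k)) x < blockPos (r (e k')) (μ (e k')) (σ (e k')) y := by
    intro k k' hk x hx y hy
    refine Prod.Lex.toLex_lt_toLex.2 (Or.inl ?_)
    have h2 := hr _ (e k).2 _ (e k').2 (Subtype.coe_lt_coe.2 (e.strictMono hk))
    exact (blockPos_fst_bounds hx (hμ _ (e k).2)).2.trans_le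
      (h2.trans (blockPos_fst_bounds hy (hμ _ (e k').2)).1)
  symm
  refine map_sum_single_of_spreading hsp
    (pos := fun p : Fin B.card × (Σ _ : ℕ, ℕ × ℕ) =>
      blockPos (r (e p.1)) (μ (e p.1)) (σ (e p.1)) p.2)
    (pos' := fun p => blockPos (p.1 : ℕ) 1 0 p.2) ?_ ?_ fun p => blockCoeff q p.2
  · rintro ⟨k, x⟩ hp ⟨k', y⟩ hp' h
    have hx := (Finset.mem_product.1 hp).2
    have hy := (Finset.mem_product.1 hp').2
    rcases lt_trichotomy k k' with hk | rfl | hk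
    · exact absurd h (hlt k k' hk x hx y hy).ne
    · exact congrArg _ (blockPos_injOn t F _ (hμ _ (e k).2) _ hx hy h)
    · exact absurd h (hlt k' k hk y hy x hx).ne'
  · rintro ⟨k, x⟩ hp ⟨k', y⟩ hp' h
    have hx := (Finset.mem_product.1 hp).2
    have hy := (Finset.mem_product.1 hp').2
    rcases lt_trichotomy k k' with hk | rfl | hk
    · refine Prod.Lex.toLex_lt_toLex.2 (Or.inl ?_)
      refine (blockPos_fst_bounds hx one_pos).2.trans_le
        (le_trans ?_ (blockPos_fst_bounds hy one_pos).1)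
      have : (k : ℕ) + 1 ≤ (k' : ℕ) := hk
      simpa using (by exact_mod_cast this : ((k : ℕ) : ℚ) + 1 ≤ ((k' : ℕ) : ℚ))
    · exact blockPos_lt_of_same (hμ _ (e k).2) one_pos h
    · exact absurd h (hlt k' k hk y hy x hx).not_gt

theorem sum_abs_blockCoeff_rpow {q : ℝ} (hq : 0 < q) (t : ℕ) {F : Finset ℕ} (hF : 0 ∉ F) :
    ∑ x ∈ blockIndex t F, |blockCoeff q x| ^ q = 2 * t * F.card := by
  have h1 : ∀ m ∈ F, ∑ y ∈ Finset.range m ×ˢ Finset.range (2 * t),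
      |blockCoeff q ⟨m, y⟩| ^ q = 2 * t := by
    intro m hm
    have hm0 : (m : ℝ) ≠ 0 := by
      rintro h
      exact hF (by rwa [← (Nat.cast_eq_zero.1 h : m = 0)])
    have h2 : ∀ y, |blockCoeff q ⟨m, y⟩| ^ q = (m : ℝ)⁻¹ := by
      intro y
      have hm1 : (0 : ℝ) ≤ m := Nat.cast_nonneg _
      rw [blockCoeff, abs_mul, abs_pow, abs_neg, abs_one, one_pow, mul_one,
        abs_of_nonneg (Real.rpow_nonneg hm1 _), ← Real.rpow_mul hm1]
      rw [neg_mul, one_div_mul_cancel hq.ne', Real.rpow_neg_one]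
    simp only [h2, Finset.sum_const, Finset.card_product, Finset.card_range, nsmul_eq_mul]
    push_cast
    field_simp
  rw [blockIndex, Finset.sum_sigma, Finset.sum_congr rfl h1, Finset.sum_const, nsmul_eq_mul,
    mul_comm]

theorem lpGauge_block {q : ℝ} (hq : 0 < q) (t : ℕ) {F : Finset ℕ} (hF : 0 ∉ F) (r : ℚ) (σ : ℕ) :
    lpGauge q (block q t F r 1 σ) = (2 * t * F.card) ^ (1 / q) := by
  rw [block, lpGauge_sum_single hq (blockPos_injOn t F r one_pos σ),
    sum_abs_blockCoeff_rpow hq t hF]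

theorem block_sub_block (q : ℝ) (t : ℕ) (F F' : Finset ℕ) (r : ℚ) (μ σ : ℕ) :
    block q t F r μ σ - block q t F' r μ σ =
      block q t (F \ F') r μ σ - block q t (F' \ F) r μ σ := by
  simp only [block, blockIndex, Finset.sum_sigma]
  exact (Finset.sum_sdiff_sub_sum_sdiff ..).symm

theorem map_block_sub_block_le {q : ℝ} (hq : 0 < q) {N : Seminorm ℝ (ℚ ×ₗ ℕ ×ₗ ℕ →₀ ℝ)} {C : ℝ}
    (hN : ∀ v, N v ≤ C * lpGauge q v) (t : ℕ) {F F' : Finset ℕ} (hF : 0 ∉ F) (hF' : 0 ∉ F')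
    (r : ℚ) (σ : ℕ) :
    N (block q t F r 1 σ - block q t F' r 1 σ) ≤
      C * (2 * t * (F \ F').card) ^ (1 / q) + C * (2 * t * (F' \ F).card) ^ (1 / q) := by
  rw [block_sub_block, ← lpGauge_block hq t (fun h => hF (Finset.sdiff_subset h)) r σ,
    ← lpGauge_block hq t (fun h => hF' (Finset.sdiff_subset h)) r σ]
  exact (map_sub_le_add N _ _).trans (add_le_add (hN _) (hN _))

theorem sum_range_mul_eq {A : Type*} [AddCommMonoid A] (f : ℕ → A) (μ m : ℕ) :
    ∑ l ∈ Finset.range (μ * m), f l =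
      ∑ j ∈ Finset.range μ, ∑ l ∈ Finset.range m, f (j * m + l) := by
  induction μ with
  | zero => simp
  | succ μ ih => rw [Finset.sum_range_succ, ← ih, Nat.succ_mul, Finset.sum_range_add]

/-- Successive blocks on the intervals `[r + j / μ, r + (j + 1) / μ)` join up to a block for the
dilated set. -/
theorem sum_block_eq_smul (q : ℝ) (t : ℕ) {F : Finset ℕ} (hF : 0 ∉ F) (r : ℚ) {μ : ℕ}
    (hμ : 0 < μ) (σ : ℕ) :
    ∑ j ∈ Finset.range μ, block q t F (r + j / μ) μ σ =
      (μ : ℝ) ^ (1 / q) • block q t (F.image (μ * ·)) r 1 σ := by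
  have hμR : (0 : ℝ) < μ := by exact_mod_cast hμ
  have hμQ : (μ : ℚ) ≠ 0 := by exact_mod_cast hμ.ne'
  simp only [block, blockIndex, Finset.sum_sigma]
  rw [Finset.sum_image fun a _ b _ h => Nat.eq_of_mul_eq_mul_left hμ h, Finset.sum_comm,
    Finset.smul_sum]
  refine Finset.sum_congr rfl fun m hm => ?_
  have hm0 : m ≠ 0 := fun h => hF (h ▸ hm)
  have hmQ : (m : ℚ) ≠ 0 := by exact_mod_cast hm0
  rw [Finset.smul_sum, Finset.sum_product, sum_range_mul_eq]
  refine Finset.sum_congr rfl fun j _ => ?_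
  rw [Finset.sum_product]
  refine Finset.sum_congr rfl fun l _ => Finset.sum_congr rfl fun s _ => ?_
  rw [Finsupp.smul_single, smul_eq_mul]
  congr 1
  · simp only [blockPos]
    congr 2
    · push_cast
      field_simp
      ring
    · congr 2
      ring
  · simp only [blockCoeff]
    push_cast
    rw [← mul_assoc, Real.mul_rpow hμR.le (Nat.cast_nonneg m), ← mul_assoc,
      ← Real.rpow_add hμR, add_neg_cancel, Real.rpow_zero, one_mul]

theorem sum_range_alternating {A : Type*} [AddCommGroup A] [Module ℝ A] (e : ℕ → A) (t : ℕ) :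
    ∑ s ∈ Finset.range (2 * t), (((-1 : ℝ) ^ s) • e s + ((-1 : ℝ) ^ s) • e (s + 1)) =
      e 0 - e (2 * t) := by
  have h : ∀ n, ∑ s ∈ Finset.range n, (((-1 : ℝ) ^ s) • e s + ((-1 : ℝ) ^ s) • e (s + 1)) =
      e 0 - ((-1 : ℝ) ^ n) • e n := by
    intro n
    induction n with
    | zero => simp
    | succ n ih =>
      rw [Finset.sum_range_succ, ih, pow_succ]
      module
  rw [h, pow_mul]
  simp

/-- A block and its shift nearly cancel. -/
theorem map_block_add_block_le {q : ℝ} (hq : 0 < q) {N : Seminorm ℝ (ℚ ×ₗ ℕ ×ₗ ℕ →₀ ℝ)} {C : ℝ}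
    (hN : ∀ v, N v ≤ C * lpGauge q v) (t : ℕ) {F : Finset ℕ} (hF : 0 ∉ F) (r : ℚ) :
    N (block q t F r 1 0 + block q t F r 1 1) ≤ 2 * C * (F.card : ℝ) ^ (1 / q) := by
  let I : Finset (Σ _ : ℕ, ℕ × ℕ) := F.sigma fun m => Finset.range m ×ˢ {0}
  let w : ℕ → (ℚ ×ₗ ℕ ×ₗ ℕ →₀ ℝ) := fun s =>
    ∑ x ∈ I, Finsupp.single (blockPos r 1 s x) ((x.1 : ℝ) ^ (-(1 / q)))
  have hI : I ⊆ blockIndex 1 F := by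
    refine Finset.sigma_mono subset_rfl fun m => Finset.product_subset_product_right ?_
    simp
  have hw : ∀ s, N (w s) ≤ C * (F.card : ℝ) ^ (1 / q) := by
    intro s
    refine (hN _).trans (le_of_eq ?_)
    rw [lpGauge_sum_single hq ((blockPos_injOn 1 F r one_pos s).mono (Finset.coe_subset.2 hI)),
      Finset.sum_sigma]
    congr 2
    rw [Finset.card_eq_sum_ones, Nat.cast_sum]
    refine Finset.sum_congr rfl fun m hm => ?_
    have hm0 : (m : ℝ) ≠ 0 := by
      rintro h
      exact hF (by rwa [← (Nat.cast_eq_zero.1 h : m = 0)])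
    have hm1 : (0 : ℝ) ≤ m := Nat.cast_nonneg _
    change ∑ _s ∈ Finset.range m ×ˢ ({0} : Finset ℕ), |(m : ℝ) ^ (-(1 / q))| ^ q = _
    rw [Finset.sum_const, Finset.card_product, Finset.card_range, Finset.card_singleton, mul_one,
      nsmul_eq_mul, abs_of_nonneg (Real.rpow_nonneg hm1 _), ← Real.rpow_mul hm1, neg_mul,
      one_div_mul_cancel hq.ne', Real.rpow_neg_one, mul_inv_cancel₀ hm0, Nat.cast_one]
  have key : block q t F r 1 0 + block q t F r 1 1 = w 0 - w (2 * t) := by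
    simp only [block, blockIndex, w, I, Finset.sum_sigma, Finset.sum_product,
      Finset.sum_singleton]
    rw [← Finset.sum_add_distrib, ← Finset.sum_sub_distrib]
    refine Finset.sum_congr rfl fun m _ => ?_
    rw [← Finset.sum_add_distrib, ← Finset.sum_sub_distrib]
    refine Finset.sum_congr rfl fun l _ => ?_
    rw [← Finset.sum_add_distrib]
    have := sum_range_alternating (fun s => Finsupp.single
      (toLex (r + ((l : ℚ) / m) / (1 : ℕ), toLex (m * 1, s)) : ℚ ×ₗ ℕ ×ₗ ℕ)
        ((m : ℝ) ^ (-(1 / q)))) t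
    simpa only [blockPos, blockCoeff, Finsupp.smul_single, smul_eq_mul, mul_comm, zero_add,
      add_zero] using this
  rw [key]
  linarith [map_sub_le_add N (w 0) (w (2 * t)), hw 0, hw (2 * t)]

end Blocks

section Krivine

open Filter Topology

variable {q : ℝ} {N : Seminorm ℝ (ℚ ×ₗ ℕ ×ₗ ℕ →₀ ℝ)} {C : ℝ}

theorem map_smul_block_sub_sum_block_le (hq : 0 < q) (hC : 0 ≤ C)
    (hN : ∀ v, N v ≤ C * lpGauge q v) {t : ℕ} (ht : 0 < t) {F : Finset ℕ} (hF : 0 ∉ F) {δ : ℝ}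
    (htδ : 1 ≤ δ * (2 * t)) {m : ℕ} (hm : 0 < m)
    (h₁ : ((F \ F.image (m * ·)).card : ℝ) ≤ δ * F.card)
    (h₂ : ((F.image (m * ·) \ F).card : ℝ) ≤ δ * F.card) (r : ℚ) {η : ℝ} (hη : η = 1 ∨ η = -1) :
    N ((η * (m : ℝ) ^ (1 / q)) • block q t F r 1 0 -
        ∑ j ∈ Finset.range m, block q t F (r + j / m) m (if η = 1 then 0 else 1)) ≤
      (m : ℝ) ^ (1 / q) * (4 * C * (δ ^ (1 / q) * (2 * t * F.card) ^ (1 / q))) := by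
  have ht' : (0 : ℝ) < 2 * t := by positivity
  have hδ : 0 ≤ δ := by
    by_contra h
    nlinarith
  have hq' : 0 ≤ 1 / q := by positivity
  have hF' : 0 ∉ F.image (m * ·) := by
    intro h
    obtain ⟨x, hx, hx0⟩ := Finset.mem_image.1 h
    rcases mul_eq_zero.1 hx0 with h | h
    · exact hm.ne' h
    · exact hF (h ▸ hx)
  set D : ℝ := δ ^ (1 / q) * (2 * t * F.card) ^ (1 / q) with hD
  have hD' : D = (δ * (2 * t * F.card)) ^ (1 / q) := by
    rw [hD, ← Real.mul_rpow hδ (by positivity)]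
  have hD0 : 0 ≤ D := by positivity
  have hdiff : ∀ σ, N (block q t F r 1 σ - block q t (F.image (m * ·)) r 1 σ) ≤ 2 * C * D := by
    intro σ
    have hle : ∀ x : ℕ, (x : ℝ) ≤ δ * F.card → (2 * t * x : ℝ) ^ (1 / q) ≤ D := by
      intro x hx
      rw [hD']
      refine Real.rpow_le_rpow (by positivity) ?_ hq'
      nlinarith
    have := map_block_sub_block_le hq hN t hF hF' r σ
    nlinarith [mul_le_mul_of_nonneg_left (hle _ h₁) hC, mul_le_mul_of_nonneg_left (hle _ h₂) hC]
  have hsum : N (block q t F r 1 0 + block q t F r 1 1) ≤ 2 * C * D := by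
    refine (map_block_add_block_le hq hN t hF r).trans ?_
    refine mul_le_mul_of_nonneg_left ?_ (by positivity)
    rw [hD']
    refine Real.rpow_le_rpow (by positivity) ?_ hq'
    have : (0 : ℝ) ≤ F.card := by positivity
    nlinarith
  have hmain : N (η • block q t F r 1 0 -
      block q t (F.image (m * ·)) r 1 (if η = 1 then 0 else 1)) ≤ 4 * C * D := by
    rcases hη with rfl | rfl
    · rw [if_pos rfl, one_smul]
      nlinarith [hdiff 0, mul_nonneg hC hD0]
    · rw [if_neg (by norm_num)]
      have h : (-1 : ℝ) • block q t F r 1 0 - block q t (F.image (m * ·)) r 1 1 =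
          (block q t F r 1 1 - block q t (F.image (m * ·)) r 1 1) -
            (block q t F r 1 0 + block q t F r 1 1) := by
        module
      rw [h]
      linarith [map_sub_le_add N (block q t F r 1 1 - block q t (F.image (m * ·)) r 1 1)
        (block q t F r 1 0 + block q t F r 1 1), hdiff 1]
  rw [sum_block_eq_smul q t hF r hm, mul_comm η, mul_smul, ← smul_sub, map_smul_eq_mul,
    Real.norm_of_nonneg (by positivity)]
  exact mul_le_mul_of_nonneg_left hmain (by positivity)

theorem map_sum_sum_block_eq
    (hsp : ∀ (v : ℚ ×ₗ ℕ ×ₗ ℕ →₀ ℝ) (ψ : ℚ ×ₗ ℕ ×ₗ ℕ → ℚ ×ₗ ℕ ×ₗ ℕ),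
      StrictMonoOn ψ v.support → N (v.mapDomain ψ) = N v)
    (t : ℕ) (F : Finset ℕ) (n : ℕ) (m σ : ℕ → ℕ) :
    N (∑ i ∈ Finset.range n, ∑ j ∈ Finset.range (m i),
        block q t F ((i : ℚ) + j / m i) (m i) (σ i)) =
      N (∑ k ∈ Finset.range (∑ i ∈ Finset.range n, m i), block q t F k 1 0) := by
  let B : Finset (ℕ ×ₗ ℕ) := ((Finset.range n).sigma fun i => Finset.range (m i)).map
    ⟨fun x => toLex (x.1, x.2), by
      rintro ⟨a, b⟩ ⟨c, d⟩ h
      have := toLex.injective h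
      simp only [Prod.mk.injEq] at this
      obtain ⟨rfl, rfl⟩ := this
      rfl⟩
  have hB : ∀ b ∈ B, (ofLex b).2 < m (ofLex b).1 := by
    intro b hb
    obtain ⟨x, hx, rfl⟩ := Finset.mem_map.1 hb
    exact Finset.mem_range.1 (Finset.mem_sigma.1 hx).2
  have hcard : B.card = ∑ i ∈ Finset.range n, m i := by
    simp [B]
  have h := map_sum_block_eq hsp q t F B (fun b => ((ofLex b).1 : ℚ) + (ofLex b).2 / m (ofLex b).1)
    (fun b => m (ofLex b).1) (fun b => σ (ofLex b).1)
    (fun b hb => (Nat.zero_le _).trans_lt (hB b hb)) ?_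
  · rw [hcard] at h
    rw [← h]
    simp only [B, Finset.sum_map, Finset.sum_sigma]
    rfl
  · intro b hb b' hb' hlt
    have h1 := hB b hb
    have h2 : (0 : ℚ) < m (ofLex b).1 := by exact_mod_cast (Nat.zero_le _).trans_lt h1
    have h3 : ((ofLex b).2 : ℚ) + 1 ≤ m (ofLex b).1 := by exact_mod_cast h1
    rw [add_assoc, ← add_div]
    rcases Prod.Lex.lt_iff.1 hlt with h4 | ⟨h4, h5⟩
    · have h5 : ((ofLex b).1 : ℚ) + 1 ≤ (ofLex b').1 := by exact_mod_cast h4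
      have h6 : (((ofLex b).2 : ℚ) + 1) / m (ofLex b).1 ≤ 1 := (div_le_one h2).2 h3
      have h7 : (0 : ℚ) ≤ (ofLex b').2 / m (ofLex b').1 := by positivity
      linarith
    · have h6 : ((ofLex b).2 : ℚ) + 1 ≤ (ofLex b').2 := by exact_mod_cast h5
      rw [← h4]
      gcongr

/-- The limiting norm in Krivine's theorem, computed on vectors whose coordinates have integral
`q`-th powers. -/
theorem exists_krivine_limit (hq : 0 < q) (hC : 0 ≤ C)
    (hN : ∀ v, lpGauge q v ≤ N v ∧ N v ≤ C * lpGauge q v)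
    (hsp : ∀ (v : ℚ ×ₗ ℕ ×ₗ ℕ →₀ ℝ) (ψ : ℚ ×ₗ ℕ ×ₗ ℕ → ℚ ×ₗ ℕ ×ₗ ℕ),
      StrictMonoOn ψ v.support → N (v.mapDomain ψ) = N v) :
    ∃ M : Seminorm ℝ (ℕ →₀ ℝ), FinApprox M N ∧ 1 ≤ M (Finsupp.single 0 1) ∧
      ∀ (n : ℕ) (m : ℕ → ℕ) (η : ℕ → ℝ), (∀ i, η i = 1 ∨ η i = -1) →
        M (∑ i ∈ Finset.range n, Finsupp.single i (η i * (m i : ℝ) ^ (1 / q))) =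
          ((∑ i ∈ Finset.range n, m i : ℕ) : ℝ) ^ (1 / q) * M (Finsupp.single 0 1) := by
  have hN₂ := fun v => (hN v).2
  have hq' : 0 < 1 / q := by positivity
  choose F hFne hF0 hF using fun k : ℕ =>
    exists_folner_mul k (δ := 1 / ((k : ℝ) + 1)) (by positivity)
  let c : ℕ → ℝ := fun k => ((2 * (k + 1 : ℕ) * (F k).card : ℝ) ^ (1 / q))⁻¹
  have hbase : ∀ k, (0 : ℝ) < (2 * (k + 1 : ℕ) * (F k).card : ℝ) ^ (1 / q) := fun k => by
    have : (0 : ℝ) < (F k).card := by exact_mod_cast (hFne k).card_pos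
    positivity
  have hc : ∀ k, 0 < c k := fun k => inv_pos.2 (hbase k)
  let T : ℕ → (ℕ →₀ ℝ) →ₗ[ℝ] (ℚ ×ₗ ℕ ×ₗ ℕ →₀ ℝ) := fun k =>
    Finsupp.linearCombination ℝ fun i : ℕ => c k • block q (k + 1) (F k) i 1 0
  have hT : ∀ k i x, T k (Finsupp.single i x) = x • c k • block q (k + 1) (F k) i 1 0 :=
    fun k i x => Finsupp.linearCombination_single ..
  have hblock : ∀ k (i : ℕ), 1 ≤ N (c k • block q (k + 1) (F k) i 1 0) ∧
      N (c k • block q (k + 1) (F k) i 1 0) ≤ C := by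
    intro k i
    have h := hN (block q (k + 1) (F k) i 1 0)
    rw [lpGauge_block hq (k + 1) (hF0 k)] at h
    rw [map_smul_eq_mul, Real.norm_of_nonneg (hc k).le, inv_mul_eq_div, le_div_iff₀ (hbase k),
      div_le_iff₀ (hbase k), one_mul]
    exact h
  have hbd : ∀ v, ∃ B, ∀ k, N (T k v) ≤ B := by
    intro v
    induction v using Finsupp.induction_linear with
    | zero => exact ⟨0, fun k => by simp⟩
    | add f g hf hg =>
      obtain ⟨B, hB⟩ := hf
      obtain ⟨B', hB'⟩ := hg
      refine ⟨B + B', fun k => ?_⟩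
      rw [map_add]
      exact (map_add_le_add N _ _).trans (add_le_add (hB k) (hB' k))
    | single i x =>
      refine ⟨‖x‖ * C, fun k => ?_⟩
      rw [hT, map_smul_eq_mul]
      exact mul_le_mul_of_nonneg_left (hblock k i).2 (norm_nonneg _)
  obtain ⟨M, hMN, hM⟩ := exists_seminorm_hyperfilter_limit N T hbd
  let P : ℕ → ℕ → ℝ := fun J k =>
    c k * N (∑ b ∈ Finset.range J, block q (k + 1) (F k) b 1 0)
  have key : ∀ (n : ℕ) (m : ℕ → ℕ) (η : ℕ → ℝ), (∀ i, η i = 1 ∨ η i = -1) →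
      Tendsto (P (∑ i ∈ Finset.range n, m i)) (hyperfilter ℕ : Filter ℕ)
        (𝓝 (M (∑ i ∈ Finset.range n, Finsupp.single i (η i * (m i : ℝ) ^ (1 / q))))) := by
    intro n m η hη
    set v : ℕ →₀ ℝ := ∑ i ∈ Finset.range n, Finsupp.single i (η i * (m i : ℝ) ^ (1 / q))
    let G : ℕ → ℕ → (ℚ ×ₗ ℕ ×ₗ ℕ →₀ ℝ) := fun k i =>
      ∑ j ∈ Finset.range (m i), block q (k + 1) (F k) ((i : ℚ) + j / m i) (m i)
        (if η i = 1 then 0 else 1)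
    let E : ℕ → ℕ → (ℚ ×ₗ ℕ ×ₗ ℕ →₀ ℝ) := fun k i =>
      (η i * (m i : ℝ) ^ (1 / q)) • block q (k + 1) (F k) i 1 0 - G k i
    have hE : ∀ i, ∀ k, m i ≤ k →
        c k * N (E k i) ≤ (m i : ℝ) ^ (1 / q) * (4 * C * (1 / ((k : ℝ) + 1)) ^ (1 / q)) := by
      intro i k hk
      rcases Nat.eq_zero_or_pos (m i) with h0 | h0
      · simp [E, G, h0, Real.zero_rpow (inv_pos.2 hq).ne']
      · have h1 := map_smul_block_sub_sum_block_le hq hC hN₂ (Nat.succ_pos k) (hF0 k)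
          (δ := 1 / ((k : ℝ) + 1)) (by push_cast; field_simp; norm_num) h0 (hF k _ h0 hk).1
          (hF k _ h0 hk).2 (i : ℚ) (hη i)
        have h2 := mul_le_mul_of_nonneg_left h1 (hc k).le
        refine h2.trans (le_of_eq ?_)
        have h3 : c k * (2 * (k + 1 : ℕ) * (F k).card : ℝ) ^ (1 / q) = 1 :=
          inv_mul_cancel₀ (hbase k).ne'
        linear_combination ((m i : ℝ) ^ (1 / q) * (4 * C * (1 / ((k : ℝ) + 1)) ^ (1 / q))) * h3
    have hE0 : ∀ i, Tendsto (fun k => c k * N (E k i)) atTop (𝓝 0) := by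
      intro i
      have h1 : Tendsto (fun k : ℕ => (1 / ((k : ℝ) + 1)) ^ (1 / q)) atTop (𝓝 0) := by
        have := (tendsto_one_div_add_atTop_nhds_zero_nat (𝕜 := ℝ)).rpow_const
          (p := 1 / q) (Or.inr hq'.le)
        rwa [Real.zero_rpow hq'.ne'] at this
      have h2 := (h1.const_mul (4 * C)).const_mul ((m i : ℝ) ^ (1 / q))
      simp only [mul_zero] at h2
      exact squeeze_zero' (Eventually.of_forall fun k => mul_nonneg (hc k).le (apply_nonneg _ _))
        ((eventually_ge_atTop (m i)).mono fun k hk => hE i k hk) h2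
    have hTv : ∀ k, T k v = c k • (∑ i ∈ Finset.range n, G k i) +
        c k • ∑ i ∈ Finset.range n, E k i := by
      intro k
      rw [← smul_add, ← Finset.sum_add_distrib, map_sum, Finset.smul_sum]
      refine Finset.sum_congr rfl fun i _ => ?_
      rw [hT, add_sub_cancel, smul_comm]
    have hP : ∀ k, P (∑ i ∈ Finset.range n, m i) k = N (c k • ∑ i ∈ Finset.range n, G k i) := by
      intro k
      rw [map_smul_eq_mul, Real.norm_of_nonneg (hc k).le]
      simp only [P, G]
      rw [map_sum_sum_block_eq hsp]
    have hdist : ∀ k, |P (∑ i ∈ Finset.range n, m i) k - N (T k v)| ≤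
        ∑ i ∈ Finset.range n, c k * N (E k i) := by
      intro k
      rw [hP, hTv, ← Finset.mul_sum]
      refine (abs_sub_map_le_sub N _ _).trans ?_
      rw [sub_add_cancel_left, map_neg_eq_map, map_smul_eq_mul, Real.norm_of_nonneg (hc k).le]
      refine mul_le_mul_of_nonneg_left ?_ (hc k).le
      exact Finset.le_sum_of_subadditive N (map_zero N).le (map_add_le_add N) _ _
    have h0 : Tendsto (fun k => P (∑ i ∈ Finset.range n, m i) k - N (T k v)) atTop (𝓝 0) := by
      refine squeeze_zero_norm hdist ?_
      simpa using tendsto_finsetSum (Finset.range n) fun i _ => hE0 i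
    have h1 := (h0.mono_left Nat.hyperfilter_le_atTop).add (hM v)
    simpa using h1
  refine ⟨M, hMN, ge_of_tendsto (hM _) (Eventually.of_forall fun k => ?_), fun n m η hη => ?_⟩
  · rw [hT, one_smul]
    exact (hblock k 0).1
  · have h1 := key 1 (fun _ => ∑ i ∈ Finset.range n, m i) (fun _ => 1) fun _ => Or.inl rfl
    rw [Finset.sum_range_one, Finset.sum_range_one, one_mul] at h1
    rw [tendsto_nhds_unique (key n m η hη) h1]
    have h2 : ∀ x : ℝ, (Finsupp.single 0 x : ℕ →₀ ℝ) = x • Finsupp.single 0 1 := fun x => by simp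
    rw [h2, map_smul_eq_mul, Real.norm_of_nonneg (by positivity)]

/-- Krivine's theorem for spreading seminorms equivalent to the `ℓ_q` norm. -/
theorem finApprox_lpGauge_of_spreading (hq : 0 < q) (hC : 0 ≤ C)
    (hN : ∀ v, lpGauge q v ≤ N v ∧ N v ≤ C * lpGauge q v)
    (hsp : ∀ (v : ℚ ×ₗ ℕ ×ₗ ℕ →₀ ℝ) (ψ : ℚ ×ₗ ℕ ×ₗ ℕ → ℚ ×ₗ ℕ ×ₗ ℕ),
      StrictMonoOn ψ v.support → N (v.mapDomain ψ) = N v) :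
    FinApprox (lpGauge q : (ℕ →₀ ℝ) → ℝ) N := by
  obtain ⟨M, hMN, hM1, hM⟩ := exists_krivine_limit hq hC hN hsp
  set γ := M (Finsupp.single 0 1)
  have hq' : 0 < 1 / q := by positivity
  have key : ∀ a, M a = lpGauge q a * γ := by
    intro a
    obtain ⟨n, hn⟩ := a.support.exists_nat_subset_range
    let η : ℕ → ℝ := fun i => if 0 ≤ a i then 1 else -1
    have hη : ∀ i, η i = 1 ∨ η i = -1 := fun i => by
      simp only [η]
      split_ifs <;> simp
    have hηa : ∀ i, η i * |a i| = a i := fun i => by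
      simp only [η]
      split_ifs with h
      · rw [abs_of_nonneg h, one_mul]
      · rw [abs_of_neg (not_le.1 h)]
        ring
    let m : ℝ → ℕ → ℕ := fun x i => ⌊|a i| ^ q * x⌋₊
    have hm : ∀ i, Tendsto (fun x => (m x i : ℝ) / x) atTop (𝓝 (|a i| ^ q)) := fun i =>
      tendsto_nat_floor_mul_div_atTop (by positivity)
    let u : ℝ → (ℕ →₀ ℝ) := fun x =>
      ∑ i ∈ Finset.range n, Finsupp.single i (η i * ((m x i : ℝ) / x) ^ (1 / q))
    have hu1 : Tendsto (fun x => M (u x)) atTop (𝓝 (lpGauge q a * γ)) := by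
      have h1 : Tendsto (fun x => (∑ i ∈ Finset.range n, (m x i : ℝ) / x) ^ (1 / q) * γ) atTop
          (𝓝 (lpGauge q a * γ)) := by
        rw [lpGauge_eq_of_support_subset hq hn]
        exact ((tendsto_finsetSum _ fun i _ => hm i).rpow_const (Or.inr hq'.le)).mul_const _
      refine h1.congr' ((eventually_gt_atTop 0).mono fun x hx => ?_)
      have h2 : u x = (x ^ (1 / q))⁻¹ •
          ∑ i ∈ Finset.range n, Finsupp.single i (η i * (m x i : ℝ) ^ (1 / q)) := by
        rw [Finset.smul_sum]
        refine Finset.sum_congr rfl fun i _ => ?_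
        rw [Finsupp.smul_single, smul_eq_mul, Real.div_rpow (Nat.cast_nonneg _) hx.le]
        congr 1
        ring
      beta_reduce
      rw [h2, map_smul_eq_mul, hM n (m x) η hη, Real.norm_of_nonneg (by positivity),
        ← Finset.sum_div, Real.div_rpow (Finset.sum_nonneg fun _ _ => Nat.cast_nonneg _) hx.le]
      push_cast
      ring
    have hu2 : Tendsto (fun x => M (u x)) atTop (𝓝 (M a)) := by
      have ha : a = ∑ i ∈ Finset.range n, Finsupp.single i (a i) := by
        conv_lhs => rw [← a.sum_single, Finsupp.sum_of_support_subset a hn _ (by simp)]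
      have hdist : ∀ x, |M (u x) - M a| ≤ ∑ i ∈ Finset.range n,
          |η i * ((m x i : ℝ) / x) ^ (1 / q) - a i| * M (Finsupp.single i 1) := by
        intro x
        refine (abs_sub_map_le_sub M _ _).trans ?_
        have h1 : u x - a = ∑ i ∈ Finset.range n,
            (η i * ((m x i : ℝ) / x) ^ (1 / q) - a i) • Finsupp.single i 1 := by
          conv_lhs => rw [ha]
          simp only [u]
          rw [← Finset.sum_sub_distrib]
          refine Finset.sum_congr rfl fun i _ => ?_
          rw [← Finsupp.single_sub, Finsupp.smul_single, smul_eq_mul, mul_one]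
        rw [h1]
        refine (Finset.le_sum_of_subadditive M (map_zero M).le (map_add_le_add M) _ _).trans ?_
        refine Finset.sum_le_sum fun i _ => ?_
        rw [map_smul_eq_mul, Real.norm_eq_abs]
      rw [tendsto_iff_norm_sub_tendsto_zero]
      refine squeeze_zero (fun _ => norm_nonneg _) hdist ?_
      have h2 : ∀ i, Tendsto (fun x => |η i * ((m x i : ℝ) / x) ^ (1 / q) - a i| *
          M (Finsupp.single i 1)) atTop (𝓝 0) := by
        intro i
        have h3 := (((hm i).rpow_const (p := 1 / q) (Or.inr hq'.le)).const_mul (η i)).sub_const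
          (a i)
        rw [← Real.rpow_mul (abs_nonneg _), mul_one_div_cancel hq.ne', Real.rpow_one, hηa,
          sub_self] at h3
        simpa using h3.abs.mul_const (M (Finsupp.single i 1))
      simpa using tendsto_finsetSum (Finset.range n) fun i _ => h2 i
    exact tendsto_nhds_unique hu2 hu1
  refine FinApprox.trans (M := M) (fun S ε hε => ⟨γ⁻¹ • LinearMap.id, fun v _ => ?_⟩) hMN
  have hγ : 0 < γ := by linarith
  rw [LinearMap.smul_apply, LinearMap.id_apply, map_smul_eq_mul, key,
    Real.norm_of_nonneg (inv_nonneg.2 hγ.le)]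
  have : γ⁻¹ * (lpGauge q v * γ) - lpGauge q v = 0 := by
    field_simp
    ring
  rw [this, abs_zero]
  exact hε.le

end Krivine

/-- **Remark 3.4, (i) ⇔ (ii).** An infinite-dimensional Banach space `X`
contains the `ℓ_p^n`'s uniformly iff `L_p([0,1])` is finitely representable
in `X`. -/
theorem containsLpnUniformly_iff_Lp_finitely_representable
    (X : Type*) [NormedAddCommGroup X] [NormedSpace ℝ X] [CompleteSpace X]
    (hXinf : ¬ FiniteDimensional ℝ X)
    (p : ENNReal) (hp : 1 ≤ p) [Fact (1 ≤ p)] :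
    ContainsLpnUniformly p X ↔
      ∀ ε : ℝ, 0 < ε →
        CFinRep (1 + ε) (Lp ℝ p (volume.restrict (Set.Icc (0 : ℝ) 1))) X := by
  refine ⟨fun h ε hε E hE => ?_,
    fun h => containsLpnUniformly_of_cfinRep p (by norm_num) (h 1 one_pos)⟩
  refine FinApprox.exists_almost_isometry ?_ hε
  by_cases htop : p = ⊤
  · subst htop
    obtain ⟨lam, M, hlam, hMX, hM, hsp⟩ := h.exists_spreading ℕ
    rw [pGauge_top] at hM
    exact (finApprox_supGauge.trans (finApprox_supGauge_of_spreading hlam hM hsp)).trans hMX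
  · obtain ⟨lam, M, hlam, hMX, hM, hsp⟩ := h.exists_spreading (ℚ ×ₗ ℕ ×ₗ ℕ)
    rw [pGauge_of_ne_top htop] at hM
    have hq := ENNReal.toReal_pos (zero_lt_one.trans_le hp).ne' htop
    exact ((finApprox_lpGauge htop E).trans
      (finApprox_lpGauge_of_spreading hq (zero_le_one.trans hlam) hM hsp)).trans hMX
end

section
/- Let X be an infinite-dimensional Banach space and p ∈ [1,∞]. Then X contains the ℓ_p^n's uniformly (there exists λ ∈ [1,∞) and a sequence of n-dimensional subspaces E_n of X such that for each n there is a linear isomorphism T_n from ℓ_p^n onto E_n with ‖T_n‖·‖T_n⁻¹‖ ≤ λ) if and only if L_p = L_p([0,1]) is finitely crudely representable in the finite-codimensional subspaces of X, i.e., there exists C > 1 such that for every closed subspace Z of X of finite codimension, L_p is C-finitely crudely representable in Z. -/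
open MeasureTheory

open scoped ENNReal

/-- On a finite measure space with finitely many points the `L_p` seminorm is a weighted `ℓ_p^n`
norm. For `p = ∞` this requires every point to have positive mass. -/
lemma toReal_eLpNorm_eq_norm_weighted {ι : Type*} [Fintype ι] [MeasurableSpace ι]
    [MeasurableSingletonClass ι] (ν : Measure ι) [IsFiniteMeasure ν] (p : ℝ≥0∞) [Fact (1 ≤ p)]
    (hν : p ≠ ∞ ∨ ∀ i, ν {i} ≠ 0) (h : ι → ℝ) :
    (eLpNorm h p ν).toReal =
      ‖(WithLp.toLp p fun i => (ν.real {i}) ^ (1 / p.toReal) * h i : PiLp p fun _ : ι => ℝ)‖ := by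
  have hp1 : 1 ≤ p := Fact.out
  by_cases hp : p = ∞
  · subst hp
    have hν : ∀ i, ν {i} ≠ 0 := hν.resolve_left (by simp)
    rw [eLpNorm_exponent_top, eLpNormEssSup, essSup_eq_iSup hν, PiLp.norm_eq_ciSup,
      ENNReal.toReal_iSup (by simp)]
    simp
  · have hpos : 0 < p.toReal := ENNReal.toReal_pos (by positivity) hp
    rw [eLpNorm_eq_lintegral_rpow_enorm_toReal (by positivity) hp, lintegral_fintype,
      PiLp.norm_eq_sum hpos, ← ENNReal.toReal_rpow, ENNReal.toReal_sum]
    · congr 1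
      refine Finset.sum_congr rfl fun i _ => ?_
      rw [norm_mul, Real.mul_rpow (norm_nonneg _) (norm_nonneg _), ENNReal.toReal_mul,
        Real.norm_of_nonneg (by positivity), ← Real.rpow_mul measureReal_nonneg,
        one_div_mul_cancel hpos.ne', Real.rpow_one, ← ENNReal.toReal_rpow, toReal_enorm, mul_comm,
        Measure.real]
    · intro i _
      exact ENNReal.mul_ne_top (by simp [hpos.le]) (measure_ne_top _ _)

lemma memLp_comp_of_finite {Ω ι : Type*} [MeasurableSpace Ω] (μ : Measure Ω) [IsFiniteMeasure μ]
    (p : ℝ≥0∞) [Finite ι] [MeasurableSpace ι] [DiscreteMeasurableSpace ι] {g : Ω → ι}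
    (hg : Measurable g) (h : ι → ℝ) : MemLp (h ∘ g) p μ :=
  (MemLp.of_discrete (μ := μ.map g)).comp_of_map hg.aemeasurable

/-- The elements of `L_p` that are constant on the fibres of a measurable map to `Fin n`. -/
noncomputable def stepLp {Ω : Type*} [MeasurableSpace Ω] (μ : Measure Ω) [IsFiniteMeasure μ]
    (p : ℝ≥0∞) {n : ℕ} {g : Ω → Fin n} (hg : Measurable g) : (Fin n → ℝ) →ₗ[ℝ] Lp ℝ p μ where
  toFun h := (memLp_comp_of_finite μ p hg h).toLp
  map_add' _ _ := rfl
  map_smul' _ _ := rfl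

lemma norm_stepLp {Ω : Type*} [MeasurableSpace Ω] (μ : Measure Ω) [IsFiniteMeasure μ]
    (p : ℝ≥0∞) [Fact (1 ≤ p)] {n : ℕ} {g : Ω → Fin n} (hg : Measurable g)
    (hν : p ≠ ∞ ∨ ∀ i, μ.map g {i} ≠ 0) (h : Fin n → ℝ) :
    ‖stepLp μ p hg h‖ = ‖(WithLp.toLp p fun i => ((μ.map g).real {i}) ^ (1 / p.toReal) * h i :
      PiLp p fun _ : Fin n => ℝ)‖ := by
  change ‖(memLp_comp_of_finite μ p hg h).toLp‖ = _
  rw [Lp.norm_toLp, ← eLpNorm_map_measure AEStronglyMeasurable.of_discrete hg.aemeasurable,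
    toReal_eLpNorm_eq_norm_weighted _ _ hν]

/-- `ℓ_p^n` embeds isometrically into any `L_p` space over a finite measure admitting a measurable
partition into `n` sets of positive measure. -/
lemma exists_linearIsometry_piLp_Lp {Ω : Type*} [MeasurableSpace Ω] (μ : Measure Ω)
    [IsFiniteMeasure μ] (p : ℝ≥0∞) [Fact (1 ≤ p)] {n : ℕ} (g : Ω → Fin n) (hg : Measurable g)
    (hpos : ∀ i, μ (g ⁻¹' {i}) ≠ 0) :
    Nonempty ((PiLp p fun _ : Fin n => ℝ) →ₗᵢ[ℝ] Lp ℝ p μ) := by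
  have hν : ∀ i, μ.map g {i} ≠ 0 := fun i => by
    rw [Measure.map_apply hg (measurableSet_singleton i)]; exact hpos i
  let w : Fin n → ℝ := fun i => ((μ.map g).real {i}) ^ (1 / p.toReal)
  have hw : ∀ i, w i ≠ 0 := fun i =>
    (Real.rpow_pos_of_pos (ENNReal.toReal_pos (hν i) (measure_ne_top _ _)) _).ne'
  let W : (PiLp p fun _ : Fin n => ℝ) →ₗ[ℝ] Fin n → ℝ :=
    LinearMap.pi (fun i => (w i)⁻¹ • LinearMap.proj i) ∘ₗ
      (WithLp.linearEquiv p ℝ (Fin n → ℝ)).toLinearMap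
  refine ⟨stepLp μ p hg ∘ₗ W, fun a => ?_⟩
  change ‖stepLp μ p hg (W a)‖ = _
  rw [norm_stepLp μ p hg (Or.inr hν)]
  congr 1
  ext i
  exact mul_inv_cancel_left₀ (hw i) _

/-- Finitely many elements of `L_p`, `p < ∞`, are simultaneously approximated by functions that are
constant on the pieces of a common finite partition. -/
lemma exists_norm_sub_stepLp_le {Ω : Type*} [MeasurableSpace Ω] (μ : Measure Ω)
    [IsFiniteMeasure μ] (p : ℝ≥0∞) [Fact (1 ≤ p)] (hp : p ≠ ∞) {ι : Type*} [Fintype ι]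
    (f : ι → Lp ℝ p μ) {ε : ℝ} (hε : 0 < ε) :
    ∃ (n : ℕ) (g : Ω → Fin n) (hg : Measurable g) (h : ι → Fin n → ℝ),
      ∀ i, ‖stepLp μ p hg (h i) - f i‖ ≤ ε := by
  have hF : MemLp (fun ω i => f i ω) p μ := memLp_pi_iff.2 fun i => Lp.memLp (f i)
  obtain ⟨S, hS, -⟩ := hF.exists_simpleFunc_eLpNorm_sub_lt hp (ε := ENNReal.ofReal ε) (by simpa)
  let e := S.range.equivFin
  let g : Ω → Fin S.range.card := fun ω => e ⟨S ω, S.mem_range_self ω⟩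
  have hg : Measurable g := measurable_to_countable' fun j => by
    have : g ⁻¹' {j} = S ⁻¹' {(e.symm j : ι → ℝ)} := by
      ext ω
      simp [g, ← Equiv.eq_symm_apply, Subtype.ext_iff]
    rw [this]
    exact S.measurableSet_fiber _
  refine ⟨_, g, hg, fun i j => (e.symm j : ι → ℝ) i, fun i => ?_⟩
  change ‖(memLp_comp_of_finite μ p hg fun j => (e.symm j : ι → ℝ) i).toLp - f i‖ ≤ ε
  conv_lhs => rw [← Lp.toLp_coeFn (f i) (Lp.memLp _)]
  rw [← MemLp.toLp_sub, Lp.norm_toLp]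
  refine ENNReal.toReal_le_of_le_ofReal hε.le ((eLpNorm_mono fun ω => ?_).trans hS.le)
  rw [Pi.sub_apply, norm_sub_rev]
  simpa [g] using norm_le_pi_norm (((fun ω i => f i ω) - ⇑S) ω) i

lemma exists_linearIsometry_piLp_Lp_unitInterval (p : ℝ≥0∞) [Fact (1 ≤ p)] (n : ℕ) :
    Nonempty ((PiLp p fun _ : Fin n => ℝ) →ₗᵢ[ℝ]
      Lp ℝ p (volume.restrict (Set.Icc (0 : ℝ) 1))) := by
  obtain rfl | hn := n.eq_zero_or_pos
  · exact ⟨0, fun x => by simp [Subsingleton.elim x 0]⟩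
  have : NeZero n := ⟨hn.ne'⟩
  have hn' : (0 : ℝ) < n := by exact_mod_cast hn
  let g : ℝ → Fin n := fun x => Fin.ofNat n ⌊n * x⌋₊
  have hg : Measurable g :=
    (measurable_of_countable (Fin.ofNat n)).comp (Nat.measurable_floor.comp (by fun_prop))
  refine exists_linearIsometry_piLp_Lp _ p g hg fun i => ?_
  rw [Measure.restrict_apply (hg (measurableSet_singleton i))]
  refine ne_of_gt (lt_of_lt_of_le ?_ (measure_mono (s := Set.Ico (i / n : ℝ) ((i + 1) / n)) ?_))
  · simp [div_lt_div_iff_of_pos_right hn']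
  · rintro x ⟨h1, h2⟩
    rw [div_le_iff₀ hn'] at h1
    rw [lt_div_iff₀ hn'] at h2
    have hi : ((i : ℕ) : ℝ) + 1 ≤ n := by exact_mod_cast i.2
    have hi0 : (0 : ℝ) ≤ (i : ℕ) := by positivity
    have hfl : ⌊(n : ℝ) * x⌋₊ = i := by
      rw [Nat.floor_eq_iff (by linarith)]
      constructor <;> linarith
    refine ⟨?_, ?_, ?_⟩
    · change Fin.ofNat n ⌊(n : ℝ) * x⌋₊ = i
      rw [hfl]
      simp
    · by_contra! hx
      nlinarith
    · by_contra! hx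
      nlinarith

/-- Every finite-dimensional normed space embeds into some `ℓ_∞^N` with distortion at most `2`. -/
lemma exists_embedding_piLp_top (E : Type*) [NormedAddCommGroup E] [NormedSpace ℝ E]
    [FiniteDimensional ℝ E] :
    ∃ (N : ℕ) (A : E →ₗ[ℝ] PiLp ∞ fun _ : Fin N => ℝ), ∀ x, ‖x‖ ≤ ‖A x‖ ∧ ‖A x‖ ≤ 2 * ‖x‖ := by
  obtain ⟨t, hts, htf, hcov⟩ :=
    (isCompact_sphere (0 : E) 1).finite_cover_balls (e := 1 / 2) (by norm_num)
  choose f hf1 hf2 using fun x : E => exists_dual_vector'' ℝ x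
  have := htf.fintype
  let e := Fintype.equivFin t
  let A : E →ₗ[ℝ] PiLp ∞ fun _ : Fin (Fintype.card t) => ℝ :=
    (WithLp.linearEquiv ∞ ℝ (Fin (Fintype.card t) → ℝ)).symm.toLinearMap ∘ₗ
      LinearMap.pi fun i => (2 : ℝ) • (f (e.symm i)).toLinearMap
  have hA : ∀ x i, A x i = 2 * f (e.symm i) x := fun x i => rfl
  have hsphere : ∀ x : E, ‖x‖ = 1 → 1 ≤ ‖A x‖ := fun x hx => by
    obtain ⟨y, hy, hxy⟩ :=
      Set.mem_iUnion₂.1 (hcov (by simpa using hx : x ∈ Metric.sphere (0 : E) 1))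
    have hy1 : f y y = 1 := by simpa [mem_sphere_zero_iff_norm.1 (hts hy)] using hf2 y
    have h1 : ‖f y (x - y)‖ ≤ ‖x - y‖ := by
      simpa using (f y).le_of_opNorm_le (hf1 y) (x - y)
    rw [map_sub, hy1] at h1
    rw [mem_ball_iff_norm] at hxy
    have h2 := (neg_abs_le (f y x - 1)).trans' (neg_le_neg h1)
    have h3 : A x (e ⟨y, hy⟩) = 2 * f y x := by simp [hA]
    have h4 := (le_abs_self _).trans (PiLp.norm_apply_le (A x) (e ⟨y, hy⟩))
    linarith
  refine ⟨_, A, fun x => ⟨?_, ?_⟩⟩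
  · obtain rfl | hx := eq_or_ne x 0
    · simp
    have hx' : 0 < ‖x‖ := norm_pos_iff.2 hx
    have := hsphere (‖x‖⁻¹ • x) (by rw [norm_smul, norm_inv, norm_norm, inv_mul_cancel₀ hx'.ne'])
    rw [map_smul, norm_smul, norm_inv, norm_norm] at this
    calc ‖x‖ = ‖x‖ * 1 := by ring
      _ ≤ ‖x‖ * (‖x‖⁻¹ * ‖A x‖) := by gcongr
      _ = ‖A x‖ := by field_simp
  · rw [PiLp.norm_eq_ciSup]
    refine Real.iSup_le (fun i => ?_) (by positivity)
    rw [hA, norm_mul, Real.norm_ofNat]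
    gcongr
    simpa using (f (e.symm i)).le_of_opNorm_le (hf1 _) x

/-- For `p < ∞`, every finite-dimensional subspace of an `L_p` space over a finite measure embeds into
some `ℓ_p^N` with distortion at most `2`. -/
lemma exists_embedding_piLp {Ω : Type*} [MeasurableSpace Ω] (μ : Measure Ω)
    [IsFiniteMeasure μ] (p : ℝ≥0∞) [Fact (1 ≤ p)] (hp : p ≠ ∞) (E : Submodule ℝ (Lp ℝ p μ))
    [FiniteDimensional ℝ E] :
    ∃ (N : ℕ) (A : E →ₗ[ℝ] PiLp p fun _ : Fin N => ℝ), ∀ x, ‖x‖ ≤ ‖A x‖ ∧ ‖A x‖ ≤ 2 * ‖x‖ := by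
  let b := Module.finBasis ℝ E
  let c : E →L[ℝ] (Fin (Module.finrank ℝ E) → ℝ) := b.equivFunL
  obtain ⟨K, hK, hcK⟩ := c.bound
  let d : ℝ := Module.finrank ℝ E
  have hd : 0 ≤ d := Nat.cast_nonneg _
  obtain ⟨n, g, hg, h, hh⟩ := exists_norm_sub_stepLp_le μ p hp (fun i => (b i : Lp ℝ p μ))
    (ε := 1 / (3 * (d * K + 1))) (by positivity)
  let H : E →ₗ[ℝ] Fin n → ℝ := b.constr ℝ h
  have hH : ∀ x, ‖stepLp μ p hg (H x) - x‖ ≤ 1 / 3 * ‖x‖ := fun x => by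
    have hx : stepLp μ p hg (H x) - x =
        ∑ i, c x i • (stepLp μ p hg (h i) - (b i : Lp ℝ p μ)) := by
      simp_rw [smul_sub, Finset.sum_sub_distrib, ← map_smul, ← map_sum]
      congr 1
      · simp [H, c, b.constr_apply_fintype ℝ]
      · exact (congrArg E.subtype (b.sum_equivFun x)).symm.trans (by rw [map_sum]; rfl)
    calc _ ≤ ∑ i : Fin (Module.finrank ℝ E), K * ‖x‖ * (1 / (3 * (d * K + 1))) := by
          rw [hx]
          refine norm_sum_le_of_le _ fun i _ => ?_
          rw [norm_smul]
          exact mul_le_mul ((norm_le_pi_norm _ i).trans (hcK x)) (hh i) (norm_nonneg _)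
            (by positivity)
      _ = d * K / (d * K + 1) * (1 / 3 * ‖x‖) := by
          rw [Finset.sum_const, Finset.card_univ, Fintype.card_fin, nsmul_eq_mul]
          field_simp
          exact mul_comm _ _
      _ ≤ 1 * (1 / 3 * ‖x‖) := by
          gcongr
          exact div_le_one_of_le₀ (by linarith) (by positivity)
      _ = _ := one_mul _
  let W : (Fin n → ℝ) →ₗ[ℝ] PiLp p fun _ : Fin n => ℝ :=
    (WithLp.linearEquiv p ℝ (Fin n → ℝ)).symm.toLinearMap ∘ₗ
      LinearMap.pi fun i => ((μ.map g).real {i}) ^ (1 / p.toReal) • LinearMap.proj i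
  refine ⟨n, (3 / 2 : ℝ) • (W ∘ₗ H), fun x => ?_⟩
  have hW : ‖((3 / 2 : ℝ) • (W ∘ₗ H)) x‖ = 3 / 2 * ‖stepLp μ p hg (H x)‖ := by
    rw [norm_stepLp μ p hg (Or.inl hp), LinearMap.smul_apply, norm_smul,
      Real.norm_of_nonneg (by norm_num)]
    rfl
  have h1 := abs_le.1 ((abs_norm_sub_norm_le _ _).trans (hH x))
  rw [Submodule.norm_coe] at h1
  rw [hW]
  constructor <;> linarith [h1.1, h1.2]

/-- A linear map from `ℓ_p^M`, `M = N (k + 1)`, to a space of dimension at most `k` vanishes on an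
isometric copy of `ℓ_p^N` spanned by disjointly supported vectors. -/
lemma exists_linearIsometry_piLp_comp_eq_zero (p : ℝ≥0∞) [Fact (1 ≤ p)] {Q : Type*}
    [AddCommGroup Q] [Module ℝ Q] [FiniteDimensional ℝ Q] (N k : ℕ)
    (hk : Module.finrank ℝ Q ≤ k)
    (φ : (PiLp p fun _ : Fin (N * (k + 1)) => ℝ) →ₗ[ℝ] Q) :
    ∃ B : (PiLp p fun _ : Fin N => ℝ) →ₗᵢ[ℝ] PiLp p fun _ : Fin (N * (k + 1)) => ℝ,
      ∀ a, φ (B a) = 0 := by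
  let V := PiLp p fun _ : Fin (k + 1) => ℝ
  let D : (PiLp p fun _ : Fin N => V) ≃ₗᵢ[ℝ] PiLp p fun _ : Fin (N * (k + 1)) => ℝ :=
    (LinearIsometryEquiv.piLpCurry ℝ p fun (_ : Fin N) (_ : Fin (k + 1)) => ℝ).symm.trans
      (LinearIsometryEquiv.piLpCongrLeft p ℝ ℝ
        ((Equiv.sigmaEquivProd _ _).trans finProdFinEquiv))
  let I : Fin N → V →ₗ[ℝ] PiLp p fun _ : Fin N => V := fun i =>
    (WithLp.linearEquiv p ℝ (Fin N → V)).symm.toLinearMap ∘ₗ LinearMap.single ℝ (fun _ => V) i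
  have hv : ∀ i, ∃ v : V, ‖v‖ = 1 ∧ φ (D (I i v)) = 0 := fun i => by
    let ψ : V →ₗ[ℝ] Q := φ ∘ₗ D.toLinearEquiv.toLinearMap ∘ₗ I i
    have : LinearMap.ker ψ ≠ ⊥ := by
      refine LinearMap.ker_ne_bot_of_finrank_lt ?_
      have : Module.finrank ℝ V = k + 1 := by
        simpa using (WithLp.linearEquiv p ℝ (Fin (k + 1) → ℝ)).finrank_eq
      omega
    obtain ⟨v, hv, hv0⟩ := (Submodule.ne_bot_iff _).1 this
    refine ⟨‖v‖⁻¹ • v, ?_, ?_⟩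
    · rw [norm_smul, norm_inv, norm_norm, inv_mul_cancel₀ (norm_ne_zero_iff.2 hv0)]
    · have : ψ (‖v‖⁻¹ • v) = 0 := by rw [map_smul, LinearMap.mem_ker.1 hv, smul_zero]
      exact this
  choose v hv1 hv0 using hv
  let L : (PiLp p fun _ : Fin N => ℝ) →ₗ[ℝ] PiLp p fun _ : Fin N => V :=
    { toFun := fun a => WithLp.toLp p fun i => a i • v i
      map_add' := fun a b => by ext1 i; simp [add_smul]
      map_smul' := fun c a => by ext1 i; simp [mul_smul] }
  have hL : ∀ a, ‖L a‖ = ‖a‖ := fun a => by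
    have h : ∀ i, ‖L a i‖ = ‖a i‖ := fun i => by
      change ‖a i • v i‖ = _
      rw [norm_smul, hv1, mul_one]
    obtain rfl | hp := eq_or_ne p ∞
    · simp_rw [PiLp.norm_eq_ciSup, h]
    · have hpos : 0 < p.toReal := (ENNReal.toReal_pos_iff_ne_top p).2 hp
      rw [PiLp.norm_eq_sum hpos, PiLp.norm_eq_sum hpos]
      simp only [h]
  refine ⟨D.toLinearIsometry.comp ⟨L, hL⟩, fun a => ?_⟩
  have hsum : L a = ∑ i, a i • I i (v i) := by
    refine PiLp.ext fun j => ?_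
    simp [L, I, Finset.sum_apply, Pi.single_apply]
  change φ (D (L a)) = 0
  simp [hsum, hv0]

/-- If `X` contains the `ℓ_p^n`'s uniformly, then so do its finite-codimensional subspaces, with the
same constant. -/
lemma ContainsLpnUniformly.exists_embedding_of_finite_quotient {p : ℝ≥0∞} [Fact (1 ≤ p)]
    {X : Type*} [NormedAddCommGroup X] [NormedSpace ℝ X] (h : ContainsLpnUniformly p X) :
    ∃ lam : ℝ, 1 ≤ lam ∧ ∀ Z : Submodule ℝ X, FiniteDimensional ℝ (X ⧸ Z) → ∀ N : ℕ,
      ∃ U : (PiLp p fun _ : Fin N => ℝ) →ₗ[ℝ] Z, ∀ a, ‖a‖ ≤ ‖U a‖ ∧ ‖U a‖ ≤ lam * ‖a‖ := by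
  obtain ⟨lam, hlam, h⟩ := h
  have key : ∀ M : ℕ, ∃ S : (PiLp p fun _ : Fin M => ℝ) →ₗ[ℝ] X,
      ∀ a, ‖a‖ ≤ ‖S a‖ ∧ ‖S a‖ ≤ lam * ‖a‖ := fun M => by
    obtain ⟨E, -, T, hT⟩ := h M
    let T₁ : (PiLp p fun _ : Fin M => ℝ) →L[ℝ] E := T
    let T₂ : E →L[ℝ] PiLp p fun _ : Fin M => ℝ := T.symm
    refine ⟨‖T₂‖ • (E.subtype ∘ₗ T₁.toLinearMap), fun a => ?_⟩
    have hS : ‖(‖T₂‖ • (E.subtype ∘ₗ T₁.toLinearMap)) a‖ = ‖T₂‖ * ‖T₁ a‖ := by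
      rw [LinearMap.smul_apply, norm_smul, Real.norm_of_nonneg T₂.opNorm_nonneg]
      rfl
    rw [hS]
    constructor
    · simpa [T₁, T₂] using T₂.le_opNorm (T₁ a)
    · calc _ ≤ ‖T₂‖ * (‖T₁‖ * ‖a‖) := by
            gcongr
            exact T₁.le_opNorm a
        _ = ‖T₁‖ * ‖T₂‖ * ‖a‖ := by ring
        _ ≤ _ := by gcongr
  refine ⟨lam, hlam, fun Z _ N => ?_⟩
  obtain ⟨S, hS⟩ := key (N * (Module.finrank ℝ (X ⧸ Z) + 1))
  obtain ⟨B, hB⟩ := exists_linearIsometry_piLp_comp_eq_zero p N _ le_rfl (Z.mkQ ∘ₗ S)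
  refine ⟨(S ∘ₗ B.toLinearMap).codRestrict Z fun a => (Submodule.Quotient.mk_eq_zero Z).1 (hB a),
    fun a => ?_⟩
  rw [← B.norm_map a]
  exact hS (B a)

lemma containsLpnUniformly_of_embeddings {p : ℝ≥0∞} [Fact (1 ≤ p)] {X : Type*}
    [NormedAddCommGroup X] [NormedSpace ℝ X] {C : ℝ} (hC : 1 ≤ C)
    (h : ∀ n : ℕ, ∃ U : (PiLp p fun _ : Fin n => ℝ) →ₗ[ℝ] X,
      ∀ a, ‖a‖ ≤ ‖U a‖ ∧ ‖U a‖ ≤ C * ‖a‖) :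
    ContainsLpnUniformly p X := by
  refine ⟨C, hC, fun n => ?_⟩
  obtain ⟨U, hU⟩ := h n
  have hinj : Function.Injective U := (injective_iff_map_eq_zero U).2 fun a ha => by
    simpa [ha] using (hU a).1
  let T := (LinearEquiv.ofInjective U hinj).toContinuousLinearEquiv
  have hT : ∀ a, ‖T a‖ = ‖U a‖ := fun a => rfl
  refine ⟨LinearMap.range U, ?_, T, ?_⟩
  · rw [LinearMap.finrank_range_of_inj hinj]
    simpa using (WithLp.linearEquiv p ℝ (Fin n → ℝ)).finrank_eq
  · have h1 : ‖(T : (PiLp p fun _ : Fin n => ℝ) →L[ℝ] LinearMap.range U)‖ ≤ C :=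
      ContinuousLinearMap.opNorm_le_bound _ (by linarith) fun a => (hT a).trans_le (hU a).2
    have h2 : ‖(T.symm : LinearMap.range U →L[ℝ] PiLp p fun _ : Fin n => ℝ)‖ ≤ 1 :=
      ContinuousLinearMap.opNorm_le_bound _ zero_le_one fun y => by
        rw [one_mul]
        simpa [← hT] using (hU (T.symm y)).1
    calc _ ≤ C * 1 := by gcongr
      _ = C := mul_one C

/-- **Remark 3.4, (i) ⇔ (iii).** An infinite-dimensional Banach space `X`
contains the `ℓ_p^n`'s uniformly iff `L_p([0,1])` is finitely crudely
representable in the finite-codimensional subspaces of `X`. -/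
theorem containsLpnUniformly_iff_Lp_fcr_in_cofinite
    (X : Type*) [NormedAddCommGroup X] [NormedSpace ℝ X] [CompleteSpace X]
    (hXinf : ¬ FiniteDimensional ℝ X)
    (p : ENNReal) (hp : 1 ≤ p) [Fact (1 ≤ p)] :
    ContainsLpnUniformly p X ↔
      ∃ C : ℝ, 1 < C ∧
        ∀ Z : Submodule ℝ X, IsClosed (Z : Set X) → FiniteDimensional ℝ (X ⧸ Z) →
          CFinRep C (Lp ℝ p (volume.restrict (Set.Icc (0 : ℝ) 1))) Z := by
  constructor
  · intro h
    obtain ⟨lam, hlam, h⟩ := h.exists_embedding_of_finite_quotient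
    refine ⟨2 * lam + 1, by linarith, fun Z _ hZ E hE => ?_⟩
    obtain ⟨N, A, hA⟩ : ∃ (N : ℕ) (A : E →ₗ[ℝ] PiLp p fun _ : Fin N => ℝ),
        ∀ x, ‖x‖ ≤ ‖A x‖ ∧ ‖A x‖ ≤ 2 * ‖x‖ := by
      by_cases hp : p = ⊤
      · subst hp
        exact exists_embedding_piLp_top E
      · exact exists_embedding_piLp _ p hp E
    obtain ⟨U, hU⟩ := h Z hZ N
    have hbound : ∀ x, ‖(U ∘ₗ A) x‖ ≤ 2 * lam * ‖x‖ := fun x =>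
      calc _ ≤ lam * ‖A x‖ := (hU (A x)).2
        _ ≤ lam * (2 * ‖x‖) := by gcongr; exact (hA x).2
        _ = _ := by ring
    refine ⟨(U ∘ₗ A).mkContinuous (2 * lam) hbound, fun x => (hA x).1.trans (hU (A x)).1, ?_⟩
    exact (LinearMap.mkContinuous_norm_le _ (by linarith) _).trans_lt (by linarith)
  · rintro ⟨C, hC, h⟩
    refine containsLpnUniformly_of_embeddings hC.le fun n => ?_
    obtain ⟨J⟩ := exists_linearIsometry_piLp_Lp_unitInterval p n
    obtain ⟨T, hT1, hT2⟩ := h ⊤ isClosed_univ inferInstance (LinearMap.range J.toLinearMap)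
      inferInstance
    refine ⟨(⊤ : Submodule ℝ X).subtype ∘ₗ T.toLinearMap ∘ₗ J.toLinearMap.rangeRestrict,
      fun a => ?_⟩
    have hJ : ‖J.toLinearMap.rangeRestrict a‖ = ‖a‖ := J.norm_map a
    change _ ≤ ‖T (J.toLinearMap.rangeRestrict a)‖ ∧ ‖T (J.toLinearMap.rangeRestrict a)‖ ≤ _
    rw [← hJ]
    exact ⟨hT1 _, T.le_of_opNorm_le hT2.le _⟩
end
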